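/- arXiv:1706.04950 — 3 statements merged into one kernel-verified Lean document; each statement's English description precedes it below -/
import Mathlib

section
/- There exists a constant C such that for all sufficiently large n the following holds: every properly edge-colored complete graph on n vertices contains a rainbow cycle on at least n - C (log n) √n vertices. -/
/-- An edge-coloring of a graph is a *proper edge-coloring* if the edges incident to any
single vertex receive pairwise distinct colors. -/
def IsProperEdgeColoring {V : Type*} (G : SimpleGraph V) (c : Sym2 V → ℕ) : Prop :=
  ∀ ⦃e₁ e₂ : Sym2 V⦄, e₁ ∈ G.edgeSet → e₂ ∈ G.edgeSet → e₁ ≠ e₂ →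
    (∃ v, v ∈ e₁ ∧ v ∈ e₂) → c e₁ ≠ c e₂

set_option linter.unusedSectionVars false
set_option linter.unusedVariables false

section helpers
open Finset


theorem sum_prod_fun {κ : Type*} [Fintype κ] [DecidableEq κ] (q : ℕ) (g : κ → Fin q → ℝ) :
    ∑ τ : κ → Fin q, ∏ x, g x (τ x) = ∏ x, ∑ y, g x y := by
  rw [Finset.prod_univ_sum]
  simp

/-- The random choice of palettes. -/
theorem exists_palettes {κ ι V : Type*} [Fintype κ] [DecidableEq κ] [Fintype ι] [Fintype V]
    (q N n D : ℕ) (hq : 5 ≤ q) (K : ι → Finset κ) (hK : ∀ i, N ≤ (K i).card)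
    (Γ : V → Finset κ) (hΓ : ∀ v, (Γ v).card ≤ n)
    (h : 4 * (Fintype.card ι : ℝ) * (1 - 1 / (q : ℝ)) ^ N
      + (Fintype.card V : ℝ) * ((1 / 2 : ℝ) ^ D * (1 + 4 / (q : ℝ)) ^ n) < 1) :
    ∃ τ : κ → ℕ, (∀ j < 4, ∀ i, ∃ x ∈ K i, τ x = j) ∧
      ∀ v, ((Γ v).filter (fun x => τ x < 4)).card ≤ D := by
  have hq0 : (0 : ℝ) < q := by positivity
  by_contra hcon
  push Not at hcon
  have key : ∀ τ : κ → Fin q, (1 : ℝ) ≤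
      ∑ j ∈ range 4, ∑ i : ι, ∏ x, (if x ∈ K i then (if (τ x : ℕ) = j then (0:ℝ) else 1) else 1)
      + ∑ v : V, (1 / 2 : ℝ) ^ D * ∏ x, (if x ∈ Γ v then (if (τ x : ℕ) < 4 then (2:ℝ) else 1) else 1) := by
    intro τ
    have n1 : ∀ j ∈ range 4, 0 ≤ ∑ i : ι, ∏ x, (if x ∈ K i then (if (τ x : ℕ) = j then (0:ℝ) else 1) else 1) := by
      intro j _
      apply sum_nonneg; intro i _; apply prod_nonneg; intro x _; split_ifs <;> norm_num
    have n2 : ∀ v ∈ (univ : Finset V), 0 ≤ (1 / 2 : ℝ) ^ D * ∏ x, (if x ∈ Γ v then (if (τ x : ℕ) < 4 then (2:ℝ) else 1) else 1) := by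
      intro v _
      apply mul_nonneg (by positivity); apply prod_nonneg; intro x _; split_ifs <;> norm_num
    by_cases h1 : ∀ j < 4, ∀ i, ∃ x ∈ K i, (τ x : ℕ) = j
    · obtain ⟨v, hv⟩ := hcon (fun x => (τ x : ℕ)) h1
      have e : ∏ x, (if x ∈ Γ v then (if (τ x : ℕ) < 4 then (2:ℝ) else 1) else 1)
          = 2 ^ ((Γ v).filter (fun x => (τ x : ℕ) < 4)).card := by
        rw [Finset.prod_ite_mem, Finset.univ_inter, ← Finset.prod_filter, Finset.prod_const]
      have : (1:ℝ) ≤ (1 / 2 : ℝ) ^ D * ∏ x, (if x ∈ Γ v then (if (τ x : ℕ) < 4 then (2:ℝ) else 1) else 1) := by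
        rw [e]
        calc (1:ℝ) = (1/2:ℝ)^D * 2^D := by rw [← mul_pow]; norm_num
          _ ≤ _ := by gcongr; norm_num
      have h3 := Finset.single_le_sum n2 (mem_univ v)
      have h4 := sum_nonneg n1
      linarith
    · push Not at h1
      obtain ⟨j, hj, i, hi⟩ := h1
      have e : ∏ x, (if x ∈ K i then (if (τ x : ℕ) = j then (0:ℝ) else 1) else 1) = 1 := by
        apply prod_eq_one
        intro x _
        by_cases hx : x ∈ K i
        · simp [hx, hi x hx]
        · simp [hx]
      have h3 : (1:ℝ) ≤ ∑ i : ι, ∏ x, (if x ∈ K i then (if (τ x : ℕ) = j then (0:ℝ) else 1) else 1) := by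
        refine e.symm.le.trans ?_
        apply Finset.single_le_sum (f := fun i => ∏ x, (if x ∈ K i then (if (τ x : ℕ) = j then (0:ℝ) else 1) else 1)) _ (mem_univ i)
        intro i _; apply prod_nonneg; intro x _; split_ifs <;> norm_num
      have h4 := Finset.single_le_sum n1 (mem_range.2 hj)
      have h5 := sum_nonneg n2
      linarith
  have tot := Finset.sum_le_sum (fun τ (_ : τ ∈ (univ : Finset (κ → Fin q))) => key τ)
  rw [Finset.sum_add_distrib, Finset.sum_comm] at tot
  have e1 : ∀ j ∈ range 4, ∑ τ : κ → Fin q, ∑ i : ι, ∏ x, (if x ∈ K i then (if (τ x : ℕ) = j then (0:ℝ) else 1) else 1)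
      ≤ (Fintype.card ι : ℝ) * ((q:ℝ) ^ Fintype.card κ * (1 - 1 / (q:ℝ)) ^ N) := by
    intro j hj
    rw [Finset.sum_comm]
    rw [← Finset.card_univ, ← nsmul_eq_mul]
    apply Finset.sum_le_card_nsmul
    intro i _
    rw [sum_prod_fun q (fun x y => (if x ∈ K i then (if (y : ℕ) = j then (0:ℝ) else 1) else 1))]
    have hs : ∀ x, ∑ y : Fin q, (if x ∈ K i then (if (y : ℕ) = j then (0:ℝ) else 1) else 1)
        = q * (if x ∈ K i then (1 - 1 / (q:ℝ)) else 1) := by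
      intro x
      split_ifs
      · have hjq : j < q := by have := mem_range.1 hj; omega
        have : ∀ y : Fin q, (if (y : ℕ) = j then (0:ℝ) else 1) = 1 - (if y = ⟨j, hjq⟩ then 1 else 0) := by
          intro y
          simp only [Fin.ext_iff]
          split_ifs <;> norm_num
        simp only [this]
        rw [Finset.sum_sub_distrib]
        simp
        field_simp
      · simp
    simp only [hs]
    rw [Finset.prod_mul_distrib, Finset.prod_const, Finset.card_univ, Finset.prod_ite_mem, Finset.univ_inter, Finset.prod_const]
    have hle : 1 / (q:ℝ) ≤ 1 := by
      rw [div_le_one hq0]; exact_mod_cast (by omega : 1 ≤ q)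
    refine mul_le_mul_of_nonneg_left ?_ (by positivity)
    apply pow_le_pow_of_le_one
    · linarith
    · have : 0 < 1 / (q:ℝ) := by positivity
      linarith
    · exact hK i
  have e2 : ∑ τ : κ → Fin q, ∑ v : V, (1 / 2 : ℝ) ^ D * ∏ x, (if x ∈ Γ v then (if (τ x : ℕ) < 4 then (2:ℝ) else 1) else 1)
      ≤ (Fintype.card V : ℝ) * ((q:ℝ) ^ Fintype.card κ * ((1 / 2 : ℝ) ^ D * (1 + 4 / (q:ℝ)) ^ n)) := by
    rw [Finset.sum_comm]
    rw [← Finset.card_univ (α := V), ← nsmul_eq_mul]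
    apply Finset.sum_le_card_nsmul
    intro v _
    rw [← Finset.mul_sum]
    rw [sum_prod_fun q (fun x y => (if x ∈ Γ v then (if (y : ℕ) < 4 then (2:ℝ) else 1) else 1))]
    have hs : ∀ x, ∑ y : Fin q, (if x ∈ Γ v then (if (y : ℕ) < 4 then (2:ℝ) else 1) else 1)
        = q * (if x ∈ Γ v then (1 + 4 / (q:ℝ)) else 1) := by
      intro x
      split_ifs
      · have : ∀ y : Fin q, (if (y : ℕ) < 4 then (2:ℝ) else 1) = 1 + (if (y:ℕ) < 4 then 1 else 0) := by
          intro y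
          split_ifs <;> norm_num
        simp only [this]
        rw [Finset.sum_add_distrib]
        have h4 : ∑ y : Fin q, (if (y:ℕ) < 4 then (1:ℝ) else 0) = 4 := by
          rw [Fin.sum_univ_eq_sum_range (fun y => if y < 4 then (1:ℝ) else 0) q]
          rw [← Finset.sum_filter]
          have : (range q).filter (· < 4) = range 4 := by
            ext a; simp; omega
          rw [this]; simp
        rw [h4]
        simp
        field_simp
      · simp
    simp only [hs]
    rw [Finset.prod_mul_distrib, Finset.prod_const, Finset.card_univ, Finset.prod_ite_mem, Finset.univ_inter, Finset.prod_const]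
    have : (1 + 4 / (q:ℝ)) ^ (Γ v).card ≤ (1 + 4 / (q:ℝ)) ^ n := by
      apply pow_le_pow_right₀
      · have : 0 < 4 / (q:ℝ) := by positivity
        linarith
      · exact hΓ v
    calc (1 / 2 : ℝ) ^ D * ((q:ℝ) ^ Fintype.card κ * (1 + 4 / (q:ℝ)) ^ (Γ v).card)
        = (q:ℝ) ^ Fintype.card κ * ((1 / 2 : ℝ) ^ D * (1 + 4 / (q:ℝ)) ^ (Γ v).card) := by ring
      _ ≤ _ := by gcongr
  have e1' := Finset.sum_le_sum e1
  rw [Finset.sum_const, Finset.card_range] at e1'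
  have hqp : (0:ℝ) < (q:ℝ) ^ Fintype.card κ := by positivity
  have lhs : ∑ τ : κ → Fin q, (1:ℝ) = (q:ℝ) ^ Fintype.card κ := by simp
  rw [lhs] at tot
  have : (q:ℝ) ^ Fintype.card κ * (4 * (Fintype.card ι : ℝ) * (1 - 1 / (q : ℝ)) ^ N
      + (Fintype.card V : ℝ) * ((1 / 2 : ℝ) ^ D * (1 + 4 / (q : ℝ)) ^ n)) < (q:ℝ) ^ Fintype.card κ * 1 := by
    gcongr
  rw [nsmul_eq_mul] at e1'
  push_cast at e1'
  nlinarith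

section pal
variable {V : Type*} [Fintype V] [DecidableEq V]

theorem exists_enum {α : Type*} [Nonempty α] (S : Finset α) (u : ℕ) (h : S.card ≤ u) :
    ∃ g : Fin u → α, ∀ x ∈ S, ∃ i, g i = x := by
  classical
  have a0 : α := Classical.arbitrary α
  refine ⟨fun i => if hi : (i : ℕ) < S.card then (S.equivFin.symm ⟨i, hi⟩ : α) else a0, ?_⟩
  intro x hx
  refine ⟨⟨S.equivFin ⟨x, hx⟩, lt_of_lt_of_le (S.equivFin ⟨x, hx⟩).2 h⟩, ?_⟩
  simp

/-- colours between two sets -/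
def col (c : Sym2 V → ℕ) (A B : Finset V) : Finset ℕ := (A ×ˢ B).image (fun p => c s(p.1, p.2))

theorem palettes (c : Sym2 V → ℕ) [Nonempty V]
    (hc : ∀ u v w : V, u ≠ v → u ≠ w → v ≠ w → c s(u, v) ≠ c s(u, w))
    (s u h N q D : ℕ) (hq : 5 ≤ q) (hN1 : 2 * N + 2 * u ≤ s * s) (hN2 : N + h + 1 ≤ Fintype.card V)
    (hprob : 4 * (((Fintype.card V : ℝ)) ^ (2 * s + 2 * u) + (Fintype.card V : ℝ) ^ (1 + 2 * h)) *
        (1 - 1 / (q : ℝ)) ^ N +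
      (Fintype.card V : ℝ) * ((1 / 2 : ℝ) ^ D * (1 + 4 / (q : ℝ)) ^ (Fintype.card V)) < 1) :
    ∃ τ : ℕ → ℕ,
      (∀ i < 4, ∀ (v : V) (U : Finset ℕ), U.card ≤ h → ∃ w, w ≠ v ∧ τ (c s(v, w)) = i ∧ c s(v, w) ∉ U) ∧
      (∀ i < 4, ∀ (A B : Finset V) (U : Finset ℕ), A.card = s → B.card = s → s * s ≤ 2 * (col c A B).card →
        U.card ≤ u → ∃ a ∈ A, ∃ b ∈ B, τ (c s(a, b)) = i ∧ c s(a, b) ∉ U) ∧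
      (∀ (v : V) (N : Finset V), (∀ w ∈ N, w ≠ v ∧ ¬ 4 ≤ τ (c s(v, w))) → N.card ≤ D) := by
  classical
  obtain ⟨M, hM⟩ : ∃ M, ∀ e : Sym2 V, c e < M := by
    refine ⟨univ.sup c + 1, fun e => ?_⟩
    have := Finset.le_sup (f := c) (Finset.mem_univ e)
    omega
  let c' : Sym2 V → Fin M := fun e => ⟨c e, hM e⟩
  let X := ((Fin s → V) × (Fin s → V) × (Fin u → V × V)) ⊕ (V × (Fin h → V × V))
  let KK : X → Finset (Fin M) := fun x => match x with
    | Sum.inl p => (univ.image (fun ij : Fin s × Fin s => c' s(p.1 ij.1, p.2.1 ij.2))) \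
        (univ.image (fun i => c' s((p.2.2 i).1, (p.2.2 i).2)))
    | Sum.inr p => ((univ.filter (fun w => w ≠ p.1)).image (fun w => c' s(p.1, w))) \
        (univ.image (fun i => c' s((p.2 i).1, (p.2 i).2)))
  let ι := {x : X // N ≤ (KK x).card}
  let Γ : V → Finset (Fin M) := fun v => (univ.filter (fun w => w ≠ v)).image (fun w => c' s(v, w))
  have hq1 : (0 : ℝ) ≤ 1 - 1 / (q : ℝ) := by
    have : (1 : ℝ) ≤ q := by exact_mod_cast (by omega : 1 ≤ q)
    have : 1 / (q : ℝ) ≤ 1 := by rw [div_le_one (by linarith)]; exact this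
    linarith
  have hι : (Fintype.card ι : ℝ) ≤ (Fintype.card V : ℝ) ^ (2 * s + 2 * u) + (Fintype.card V : ℝ) ^ (1 + 2 * h) := by
    have h1 : Fintype.card ι ≤ Fintype.card X := Fintype.card_subtype_le _
    have h2 : Fintype.card X = Fintype.card V ^ (2 * s + 2 * u) + Fintype.card V ^ (1 + 2 * h) := by
      simp only [X, Fintype.card_sum, Fintype.card_prod, Fintype.card_fun, Fintype.card_fin]
      ring
    rw [h2] at h1
    exact_mod_cast h1
  obtain ⟨τ, t1, t2⟩ := exists_palettes (κ := Fin M) (ι := ι) (V := V) q N (Fintype.card V) D hq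
    (fun x => KK x.1) (fun x => x.2) Γ
    (by
      intro v
      exact Finset.card_image_le.trans (Finset.card_le_univ _))
    (by
      refine lt_of_le_of_lt ?_ hprob
      gcongr)
  have pre : ∀ (U : Finset ℕ) (m : ℕ), U.card ≤ m → ∃ g : Fin m → V × V, ∀ a b : V, c s(a, b) ∈ U →
      ∃ i, c' s((g i).1, (g i).2) = c' s(a, b) := by
    intro U m hU
    let U' := U.filter (fun x => ∃ p : V × V, c s(p.1, p.2) = x)
    have hp : ∀ x, ∃ p : V × V, x ∈ U' → c s(p.1, p.2) = x := by
      intro x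
      by_cases hx : x ∈ U'
      · obtain ⟨p, hp⟩ := (Finset.mem_filter.1 hx).2
        exact ⟨p, fun _ => hp⟩
      · exact ⟨Classical.arbitrary _, fun h => absurd h hx⟩
    choose p hp using hp
    obtain ⟨g, hg⟩ := exists_enum (U'.image p) m
      ((Finset.card_image_le.trans (Finset.card_filter_le _ _)).trans hU)
    refine ⟨g, fun a b hab => ?_⟩
    have hmem : c s(a, b) ∈ U' := Finset.mem_filter.2 ⟨hab, (a, b), rfl⟩
    obtain ⟨i, hi⟩ := hg _ (Finset.mem_image_of_mem p hmem)
    refine ⟨i, ?_⟩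
    rw [hi]
    apply Fin.ext
    exact hp _ hmem
  let τ' : ℕ → ℕ := fun x => if hx : x < M then τ ⟨x, hx⟩ else 4
  have hτ : ∀ e, τ' (c e) = τ (c' e) := by
    intro e
    simp only [τ', hM e, dif_pos, c']
  have inj' : ∀ v : V, Set.InjOn (fun w => c' s(v, w)) {w | w ≠ v} := by
    intro v w hw w' hw' hcc
    by_contra hne
    have : c s(v, w) = c s(v, w') := congrArg Fin.val hcc
    exact hc v w w' (Ne.symm hw) (Ne.symm hw') hne this
  have sd : ∀ (S T : Finset (Fin M)), S.card ≤ (S \ T).card + T.card := by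
    intro S T
    have h1 := Finset.card_sdiff_add_card S T
    have h2 := Finset.card_le_card (Finset.subset_union_left (s₁ := S) (s₂ := T))
    omega
  refine ⟨τ', ?_, ?_, ?_⟩
  · intro i hi v U hU
    obtain ⟨g, hg⟩ := pre U h hU
    have hN : N ≤ (KK (Sum.inr (v, g))).card := by
      have h1 := sd ((univ.filter (fun w => w ≠ v)).image (fun w => c' s(v, w)))
        (univ.image (fun i => c' s((g i).1, (g i).2)))
      have h2 : ((univ.filter (fun w => w ≠ v)).image (fun w => c' s(v, w))).card = Fintype.card V - 1 := by
        rw [Finset.card_image_of_injOn (by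
          intro a ha b hb hab
          exact inj' v (by simpa using ha) (by simpa using hb) hab)]
        rw [Finset.filter_ne', Finset.card_erase_of_mem (Finset.mem_univ v), Finset.card_univ]
      have h3 : (univ.image (fun i => c' s((g i).1, (g i).2))).card ≤ h := by
        simpa using (Finset.card_image_le (s := (univ : Finset (Fin h))) (f := fun i => c' s((g i).1, (g i).2)))
      change N ≤ Finset.card (((univ.filter (fun w => w ≠ v)).image (fun w => c' s(v, w))) \
        (univ.image (fun i => c' s((g i).1, (g i).2))))
      omega
    obtain ⟨x, hx, hxi⟩ := t1 i hi (⟨Sum.inr (v, g), hN⟩ : ι)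
    simp only [KK] at hx
    rw [Finset.mem_sdiff, Finset.mem_image] at hx
    obtain ⟨⟨w, hw, rfl⟩, hx2⟩ := hx
    refine ⟨w, by simpa using hw, by rw [hτ]; exact hxi, ?_⟩
    intro hU
    obtain ⟨j, hj⟩ := hg v w hU
    exact hx2 (Finset.mem_image.2 ⟨j, Finset.mem_univ _, hj⟩)
  · intro i hi A B U hA hB hcol hU
    obtain ⟨g, hg⟩ := pre U u hU
    obtain ⟨ga, hga⟩ : ∃ ga : Fin s → V, ∀ x, x ∈ A ↔ ∃ i, ga i = x := by
      refine ⟨fun i => (A.equivFin.symm (Fin.cast hA.symm i) : V), fun x => ⟨fun hx => ?_, ?_⟩⟩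
      · exact ⟨Fin.cast hA (A.equivFin ⟨x, hx⟩), by simp⟩
      · rintro ⟨i, rfl⟩; simp
    obtain ⟨gb, hgb⟩ : ∃ gb : Fin s → V, ∀ x, x ∈ B ↔ ∃ i, gb i = x := by
      refine ⟨fun i => (B.equivFin.symm (Fin.cast hB.symm i) : V), fun x => ⟨fun hx => ?_, ?_⟩⟩
      · exact ⟨Fin.cast hB (B.equivFin ⟨x, hx⟩), by simp⟩
      · rintro ⟨i, rfl⟩; simp
    have hN : N ≤ (KK (Sum.inl (ga, gb, g))).card := by
      have h1 := sd (univ.image (fun ij : Fin s × Fin s => c' s(ga ij.1, gb ij.2)))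
        (univ.image (fun i => c' s((g i).1, (g i).2)))
      have h2 : (col c A B).card ≤ (univ.image (fun ij : Fin s × Fin s => c' s(ga ij.1, gb ij.2))).card := by
        refine le_trans (Finset.card_le_card ?_) (Finset.card_image_le (f := Fin.val))
        intro x hx
        simp only [col, Finset.mem_image, Finset.mem_product] at hx
        obtain ⟨⟨a, b⟩, ⟨ha, hb⟩, rfl⟩ := hx
        obtain ⟨i, rfl⟩ := (hga _).1 ha
        obtain ⟨j, rfl⟩ := (hgb _).1 hb
        rw [Finset.mem_image]
        exact ⟨c' s(ga i, gb j), Finset.mem_image.2 ⟨(i, j), Finset.mem_univ _, rfl⟩, rfl⟩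
      have h3 : (univ.image (fun i => c' s((g i).1, (g i).2))).card ≤ u := by
        simpa using (Finset.card_image_le (s := (univ : Finset (Fin u))) (f := fun i => c' s((g i).1, (g i).2)))
      change N ≤ Finset.card ((univ.image (fun ij : Fin s × Fin s => c' s(ga ij.1, gb ij.2))) \
        (univ.image (fun i => c' s((g i).1, (g i).2))))
      omega
    obtain ⟨x, hx, hxi⟩ := t1 i hi (⟨Sum.inl (ga, gb, g), hN⟩ : ι)
    simp only [KK] at hx
    rw [Finset.mem_sdiff, Finset.mem_image] at hx
    obtain ⟨⟨⟨ia, ib⟩, _, rfl⟩, hx2⟩ := hx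
    refine ⟨ga ia, (hga _).2 ⟨ia, rfl⟩, gb ib, (hgb _).2 ⟨ib, rfl⟩, by rw [hτ]; exact hxi, ?_⟩
    intro hU
    obtain ⟨j, hj⟩ := hg _ _ hU
    exact hx2 (Finset.mem_image.2 ⟨j, Finset.mem_univ _, hj⟩)
  · intro v N' hN'
    refine le_trans ?_ (t2 v)
    apply Finset.card_le_card_of_injOn (fun w => c' s(v, w))
    · intro w hw
      have := hN' w hw
      rw [hτ] at this
      rw [Finset.mem_coe, Finset.mem_filter]
      exact ⟨Finset.mem_image.2 ⟨w, by simpa using this.1, rfl⟩, not_le.1 this.2⟩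
    · intro w hw w' hw' hcc
      exact inj' v (hN' w hw).1 (hN' w' hw').1 hcc

theorem greedy (c : Sym2 V → ℕ)
    (hc : ∀ u v w : V, u ≠ v → u ≠ w → v ≠ w → c s(u, v) ≠ c s(u, w))
    (A Z : Finset V) (hd : Disjoint A Z) : ∀ j : ℕ, (2 * A.card + 1) * j ≤ Z.card →
    ∃ B ⊆ Z, B.card = j ∧ j * A.card ≤ 2 * (col c A B).card := by
  intro j
  induction j with
  | zero => intro _; exact ⟨∅, by simp, by simp⟩
  | succ j ih =>
    intro hj
    have hj' : (2 * A.card + 1) * j + (2 * A.card + 1) ≤ Z.card := by rw [← Nat.mul_succ]; exact hj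
    obtain ⟨B, hB1, hB2, hB3⟩ := ih (by omega)
    set K := col c A B with hK
    have hKc : K.card ≤ A.card * j := by
      rw [← hB2, ← Finset.card_product]; exact Finset.card_image_le
    have hne : ∀ z ∈ Z, ∀ a ∈ A, z ≠ a := by
      rintro z hz a ha rfl
      exact Finset.disjoint_left.1 hd ha hz
    have hex : ∃ z ∈ Z \ B, A.card ≤ 2 * (A.filter (fun a => c s(z, a) ∉ K)).card := by
      by_contra hcon
      push Not at hcon
      have h1 : ∀ z ∈ Z \ B, A.card + 1 ≤ 2 * (A.filter (fun a => c s(z, a) ∈ K)).card := by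
        intro z hz
        have h1 := hcon z hz
        have h2 := Finset.card_filter_add_card_filter_not (s := A) (fun a => c s(z, a) ∈ K)
        omega
      have h2 : (Z \ B).card * (A.card + 1) ≤ ∑ z ∈ Z \ B, 2 * (A.filter (fun a => c s(z, a) ∈ K)).card := by
        rw [← smul_eq_mul]
        exact Finset.card_nsmul_le_sum _ _ _ h1
      have h3 : ∑ z ∈ Z \ B, (A.filter (fun a => c s(z, a) ∈ K)).card ≤ A.card * K.card := by
        have hs := Finset.sum_card_bipartiteAbove_eq_sum_card_bipartiteBelow (s := Z \ B) (t := A)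
          (fun z a => c s(z, a) ∈ K)
        simp only [Finset.bipartiteAbove] at hs
        rw [hs, ← smul_eq_mul]
        apply Finset.sum_le_card_nsmul
        intro a ha
        apply Finset.card_le_card_of_injOn (fun z => c s(a, z))
        · intro z hz
          simp [Finset.bipartiteBelow] at hz
          have := hz.2
          rw [Sym2.eq_swap] at this
          exact this
        · intro z hz z' hz' hcc
          simp [Finset.bipartiteBelow] at hz hz'
          by_contra hzz
          exact hc a z z' (hne z hz.1.1 a ha).symm (hne z' hz'.1.1 a ha).symm hzz hcc
      rw [← Finset.mul_sum] at h2
      have h4 : (Z \ B).card = Z.card - j := by rw [Finset.card_sdiff_of_subset hB1, hB2]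
      have h5 : 2 * A.card * j + 1 ≤ (Z \ B).card := by rw [h4]; rw [Nat.add_mul] at hj'; omega
      have h6 : (2 * A.card * j + 1) * (A.card + 1) ≤ 2 * (A.card * (A.card * j)) :=
        (Nat.mul_le_mul_right _ h5).trans (h2.trans (Nat.mul_le_mul_left _ (h3.trans (Nat.mul_le_mul_left _ hKc))))
      nlinarith [Nat.zero_le (A.card * j), Nat.zero_le A.card]
    obtain ⟨z, hz, hz2⟩ := hex
    rw [Finset.mem_sdiff] at hz
    refine ⟨insert z B, ?_, ?_, ?_⟩
    · intro x hx
      rw [Finset.mem_insert] at hx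
      rcases hx with rfl | hx
      · exact hz.1
      · exact hB1 hx
    · rw [Finset.card_insert_of_notMem hz.2, hB2]
    · have hsub : K ∪ (A.filter (fun a => c s(z, a) ∉ K)).image (fun a => c s(z, a)) ⊆ col c A (insert z B) := by
        intro x hx
        rw [Finset.mem_union] at hx
        simp only [col, Finset.mem_image, Finset.mem_product]
        rcases hx with hx | hx
        · simp only [hK, col, Finset.mem_image, Finset.mem_product] at hx
          obtain ⟨p, hp, rfl⟩ := hx
          exact ⟨p, ⟨hp.1, by simp [hp.2]⟩, rfl⟩
        · rw [Finset.mem_image] at hx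
          obtain ⟨a, ha, rfl⟩ := hx
          exact ⟨(a, z), ⟨(Finset.mem_filter.1 ha).1, by simp⟩, by rw [Sym2.eq_swap]⟩
      have hdis : Disjoint K ((A.filter (fun a => c s(z, a) ∉ K)).image (fun a => c s(z, a))) := by
        rw [Finset.disjoint_left]
        intro x hx hx'
        rw [Finset.mem_image] at hx'
        obtain ⟨a, ha, rfl⟩ := hx'
        exact (Finset.mem_filter.1 ha).2 hx
      have h1 := Finset.card_le_card hsub
      rw [Finset.card_union_of_disjoint hdis, Finset.card_image_of_injOn (by
        intro a ha b hb hab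
        by_contra hne'
        exact hc z a b (hne z hz.1 a (Finset.mem_filter.1 ha).1) (hne z hz.1 b (Finset.mem_filter.1 hb).1) hne' hab)] at h1
      rw [Nat.succ_mul]
      omega

/-- the expansion property of a palette system -/
theorem expansion (c : Sym2 V → ℕ)
    (hc : ∀ u v w : V, u ≠ v → u ≠ w → v ≠ w → c s(u, v) ≠ c s(u, w)) (τ : ℕ → ℕ) (s u : ℕ)
    (hA2 : ∀ i < 4, ∀ (A B : Finset V) (U : Finset ℕ), A.card = s → B.card = s → s * s ≤ 2 * (col c A B).card →
        U.card ≤ u → ∃ a ∈ A, ∃ b ∈ B, τ (c s(a, b)) = i ∧ c s(a, b) ∉ U)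
    (i : ℕ) (hi : i < 4) (A Z : Finset V) (U : Finset ℕ) (hA : s ≤ A.card) (hZ : (2 * s + 2) * s ≤ Z.card)
    (hU : U.card ≤ u) : ∃ a ∈ A, ∃ z ∈ Z, a ≠ z ∧ τ (c s(a, z)) = i ∧ c s(a, z) ∉ U := by
  obtain ⟨A', hA', hA's⟩ := Finset.exists_subset_card_eq hA
  have hd : Disjoint A' (Z \ A') := Finset.disjoint_sdiff
  obtain ⟨B, h1, h2, h3⟩ := greedy c hc A' (Z \ A') hd s (by
    have := Finset.le_card_sdiff A' Z
    rw [hA's] at this ⊢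
    have e : (2 * s + 2) * s = (2 * s + 1) * s + s := by ring
    omega)
  obtain ⟨a, ha, b, hb, h4⟩ := hA2 i hi A' B U hA's h2 (by rw [hA's] at h3; exact h3) hU
  have hb' := h1 hb
  refine ⟨a, hA' ha, b, (Finset.mem_sdiff.1 hb').1, ?_, h4⟩
  rintro rfl
  exact (Finset.mem_sdiff.1 hb').2 ha

end pal

/-- consecutive pairs of a list -/
def ledges {V : Type*} : List V → List (Sym2 V)
  | [] => []
  | [_] => []
  | x :: y :: l => s(x, y) :: ledges (y :: l)

section ledges
variable {V : Type*}

@[simp] theorem ledges_nil : ledges ([] : List V) = [] := rfl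
@[simp] theorem ledges_single (x : V) : ledges [x] = [] := rfl
@[simp] theorem ledges_cons_cons (x y : V) (l : List V) :
    ledges (x :: y :: l) = s(x, y) :: ledges (y :: l) := rfl

theorem ledges_pivot (A : List V) (x : V) (B : List V) :
    ledges (A ++ x :: B) = ledges (A ++ [x]) ++ ledges (x :: B) := by
  induction A with
  | nil => simp
  | cons a A ih =>
    cases A with
    | nil => simp
    | cons a' A => simpa using ih

theorem ledges_reverse (l : List V) : ledges l.reverse = (ledges l).reverse := by
  induction l with
  | nil => simp
  | cons a l ih =>
    cases l with
    | nil => simp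
    | cons b l =>
      have h := ledges_pivot l.reverse b [a]
      simp only [List.reverse_cons, List.append_assoc, List.singleton_append] at ih ⊢
      rw [h]
      simp only [ledges_cons_cons, List.reverse_cons]
      rw [ih]
      simp [Sym2.eq_swap]

@[simp] theorem mem_ledges_reverse (l : List V) (e : Sym2 V) : e ∈ ledges l.reverse ↔ e ∈ ledges l := by
  rw [ledges_reverse]; simp

theorem mem_ledges_iff (l : List V) (e : Sym2 V) :
    e ∈ ledges l ↔ ∃ A x y B, l = A ++ x :: y :: B ∧ e = s(x, y) := by
  constructor
  · intro h
    induction l with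
    | nil => simp at h
    | cons a l ih =>
      cases l with
      | nil => simp at h
      | cons b l =>
        simp only [ledges_cons_cons, List.mem_cons] at h
        rcases h with h | h
        · exact ⟨[], a, b, l, by simp, h⟩
        · obtain ⟨A, x, y, B, h1, h2⟩ := ih h
          exact ⟨a :: A, x, y, B, by simp [h1], h2⟩
  · rintro ⟨A, x, y, B, rfl, rfl⟩
    rw [ledges_pivot]; simp

/-- the junction edge of two lists -/
def Junc (A B : List V) (e : Sym2 V) : Prop :=
  ∃ x y, A.getLast? = some x ∧ B.head? = some y ∧ e = s(x, y)

theorem mem_ledges_append (A B : List V) (e : Sym2 V) :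
    e ∈ ledges (A ++ B) ↔ e ∈ ledges A ∨ e ∈ ledges B ∨ Junc A B e := by
  rcases A.eq_nil_or_concat with rfl | ⟨A, a, rfl⟩
  · simp [Junc]
  · cases B with
    | nil => simp [Junc]
    | cons b B =>
      simp only [List.concat_eq_append, List.append_assoc, List.singleton_append]
      rw [ledges_pivot]
      simp [Junc]
      tauto

theorem mem_of_mem_ledges {l : List V} {x y : V} (h : s(x, y) ∈ ledges l) : x ∈ l ∧ y ∈ l := by
  rw [mem_ledges_iff] at h
  obtain ⟨A, x', y', B, rfl, h2⟩ := h
  rw [Sym2.eq_iff] at h2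
  rcases h2 with ⟨rfl, rfl⟩ | ⟨rfl, rfl⟩ <;> simp

theorem ledges_ne_diag {l : List V} (hl : l.Nodup) {x y : V} (h : s(x, y) ∈ ledges l) : x ≠ y := by
  rw [mem_ledges_iff] at h
  obtain ⟨A, x', y', B, rfl, h2⟩ := h
  rw [List.nodup_append] at hl
  have := hl.2.1
  simp only [List.nodup_cons, List.mem_cons] at this
  rw [Sym2.eq_iff] at h2
  rcases h2 with ⟨rfl, rfl⟩ | ⟨rfl, rfl⟩
  · tauto
  · intro h; subst h; tauto

end ledges

section forest
variable {V : Type*}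

/-- vertex disjoint nonempty paths -/
def IsForest {k : ℕ} (f : Fin k → List V) : Prop :=
  (∀ i, (f i).Nodup) ∧ (∀ i j x, x ∈ f i → x ∈ f j → i = j) ∧ ∀ i, f i ≠ []

/-- edges of a path forest -/
def FE {k : ℕ} (f : Fin k → List V) (e : Sym2 V) : Prop := ∃ i, e ∈ ledges (f i)

theorem rotate_forest_aux {k : ℕ} (f : Fin k → List V) (hf : IsForest f) (j l0 : Fin k) (v x y : V)
    (hv : (f j).head? = some v) (hne : l0 ≠ j) (P Q : List V) (hP : y ∈ P) (hQ : Q.head? = some x)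
    (hperm : (P ++ Q).Perm (f l0))
    (hPe : ∀ e ∈ ledges P, e ∈ ledges (f l0)) (hQe : ∀ e ∈ ledges Q, e ∈ ledges (f l0)) :
    IsForest (Function.update (Function.update f l0 P) j ((f j).reverse ++ Q)) ∧
    (∀ z, (∃ i, z ∈ (Function.update (Function.update f l0 P) j ((f j).reverse ++ Q)) i) ↔ ∃ i, z ∈ f i) ∧
    (∀ e, FE (Function.update (Function.update f l0 P) j ((f j).reverse ++ Q)) e →
      (FE f e ∧ e ≠ s(y, x)) ∨ e = s(v, x)) := by
  obtain ⟨h1, h2, h3⟩ := hf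
  have hxQ : x ∈ Q := List.mem_of_mem_head? hQ
  have hm : ∀ z, z ∈ f l0 ↔ z ∈ P ∨ z ∈ Q := fun z => by rw [← hperm.mem_iff]; simp
  have hnd : (P ++ Q).Nodup := hperm.nodup_iff.2 (h1 l0)
  rw [List.nodup_append] at hnd
  obtain ⟨n1, n2, n3⟩ := hnd
  set g := Function.update (Function.update f l0 P) j ((f j).reverse ++ Q) with hg
  have gj : g j = (f j).reverse ++ Q := by simp [hg]
  have gl : g l0 = P := by simp [hg, hne]
  have go : ∀ i, i ≠ j → i ≠ l0 → g i = f i := by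
    intro i a b; simp [hg, a, b]
  have hjQ : ∀ z ∈ f j, z ∉ f l0 := fun z a b => hne (h2 _ _ z b a)
  refine ⟨⟨?_, ?_, ?_⟩, ?_, ?_⟩
  · intro i
    by_cases hij : i = j
    · subst hij
      rw [gj, List.nodup_append]
      refine ⟨List.nodup_reverse.2 (h1 _), n2, ?_⟩
      intro a ha b hb hab
      subst hab
      exact hjQ a (by simpa using ha) ((hm _).2 (Or.inr hb))
    · by_cases hil : i = l0
      · subst hil; rw [gl]; exact n1
      · rw [go i hij hil]; exact h1 i
  · -- owner function
    have own : ∀ i z, z ∈ g i → (i = j ∧ (z ∈ f j ∨ z ∈ Q)) ∨ (i = l0 ∧ z ∈ P) ∨ (i ≠ j ∧ i ≠ l0 ∧ z ∈ f i) := by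
      intro i z hz
      by_cases hij : i = j
      · subst hij; rw [gj] at hz; left; simpa using hz
      · by_cases hil : i = l0
        · subst hil; rw [gl] at hz; right; left; exact ⟨rfl, hz⟩
        · rw [go i hij hil] at hz; right; right; exact ⟨hij, hil, hz⟩
    have hPQ : ∀ z, z ∈ P → z ∉ Q := fun z a b => n3 z a z b rfl
    intro a b z ha hb
    have A := own a z ha
    have B := own b z hb
    have key : ∀ i, z ∈ f i → ∀ i', z ∈ f i' → i = i' := fun i a i' b => h2 _ _ _ a b
    have m1 := hm z
    have m2 := hPQ z
    have m3 := hjQ z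
    rcases A with ⟨rfl, A⟩ | ⟨rfl, A⟩ | ⟨A1, A2, A⟩ <;> rcases B with ⟨rfl, B⟩ | ⟨rfl, B⟩ | ⟨B1, B2, B⟩ <;>
      first
      | rfl
      | grind
  · intro i
    by_cases hij : i = j
    · subst hij; rw [gj]; simp [h3]
    · by_cases hil : i = l0
      · subst hil; rw [gl]; exact List.ne_nil_of_mem hP
      · rw [go i hij hil]; exact h3 i
  · intro z
    constructor
    · rintro ⟨i, hi⟩
      by_cases hij : i = j
      · subst hij; rw [gj] at hi; simp at hi
        rcases hi with hi | hi
        · exact ⟨_, hi⟩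
        · exact ⟨l0, (hm z).2 (Or.inr hi)⟩
      · by_cases hil : i = l0
        · subst hil; rw [gl] at hi; exact ⟨_, (hm z).2 (Or.inl hi)⟩
        · rw [go i hij hil] at hi; exact ⟨_, hi⟩
    · rintro ⟨i, hi⟩
      by_cases hij : i = j
      · subst hij; exact ⟨i, by rw [gj]; simp [hi]⟩
      · by_cases hil : i = l0
        · subst hil
          rcases (hm z).1 hi with h | h
          · exact ⟨_, by rw [gl]; exact h⟩
          · exact ⟨j, by rw [gj]; simp [h]⟩
        · exact ⟨i, by rw [go i hij hil]; exact hi⟩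
  · rintro e ⟨i, hi⟩
    have hyl : y ∈ f l0 := (hm y).2 (Or.inl hP)
    have hxl : x ∈ f l0 := (hm x).2 (Or.inr hxQ)
    by_cases hij : i = j
    · subst hij
      rw [gj, mem_ledges_append] at hi
      rcases hi with hi | hi | ⟨a, b, ha, hb, rfl⟩
      · left
        rw [mem_ledges_reverse] at hi
        refine ⟨⟨_, hi⟩, ?_⟩
        rintro rfl
        exact hjQ y (mem_of_mem_ledges hi).1 hyl
      · left
        refine ⟨⟨l0, hQe _ hi⟩, ?_⟩
        rintro rfl
        exact n3 y hP y (mem_of_mem_ledges hi).1 rfl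
      · right
        rw [List.getLast?_reverse, hv] at ha
        rw [hQ] at hb
        simp at ha hb
        rw [ha, hb]
    · by_cases hil : i = l0
      · subst hil; rw [gl] at hi
        left
        refine ⟨⟨_, hPe _ hi⟩, ?_⟩
        rintro rfl
        exact n3 x (mem_of_mem_ledges hi).2 x hxQ rfl
      · rw [go i hij hil] at hi
        left
        refine ⟨⟨_, hi⟩, ?_⟩
        rintro rfl
        exact hil (h2 _ _ _ (mem_of_mem_ledges hi).1 hyl)

theorem rotate_forest_self {k : ℕ} (f : Fin k → List V) (hf : IsForest f) (j : Fin k) (v x y : V)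
    (hv : (f j).head? = some v) (A B : List V) (hfj : f j = A ++ y :: x :: B) :
    IsForest (Function.update f j ((A ++ [y]).reverse ++ x :: B)) ∧
    (∀ z, (∃ i, z ∈ (Function.update f j ((A ++ [y]).reverse ++ x :: B)) i) ↔ ∃ i, z ∈ f i) ∧
    (∀ e, FE (Function.update f j ((A ++ [y]).reverse ++ x :: B)) e →
      (FE f e ∧ e ≠ s(y, x)) ∨ e = s(v, x)) := by
  obtain ⟨h1, h2, h3⟩ := hf
  set g := Function.update f j ((A ++ [y]).reverse ++ x :: B) with hg
  have gj : g j = (A ++ [y]).reverse ++ x :: B := by simp [hg]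
  have go : ∀ i, i ≠ j → g i = f i := by intro i a; simp [hg, a]
  have hfj' : f j = (A ++ [y]) ++ x :: B := by simp [hfj]
  have hperm : (g j).Perm (f j) := by
    rw [gj, hfj']
    exact (List.reverse_perm _).append_right _
  have hmem : ∀ i z, z ∈ g i ↔ z ∈ f i := by
    intro i z
    by_cases hij : i = j
    · subst hij; exact hperm.mem_iff
    · rw [go i hij]
  have hnd := h1 j
  rw [hfj', List.nodup_append] at hnd
  obtain ⟨n1, n2, n3⟩ := hnd
  refine ⟨⟨?_, ?_, ?_⟩, ?_, ?_⟩
  · intro i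
    by_cases hij : i = j
    · subst hij; exact hperm.nodup_iff.2 (h1 _)
    · rw [go i hij]; exact h1 i
  · intro a b z ha hb
    rw [hmem] at ha hb
    exact h2 _ _ _ ha hb
  · intro i
    by_cases hij : i = j
    · subst hij; rw [gj]; simp
    · rw [go i hij]; exact h3 i
  · intro z
    simp only [hmem]
  · rintro e ⟨i, hi⟩
    have hyl : y ∈ f j := by simp [hfj]
    by_cases hij : i = j
    · subst hij
      rw [gj, mem_ledges_append] at hi
      rcases hi with hi | hi | ⟨a, b, ha, hb, rfl⟩
      · left
        rw [mem_ledges_reverse] at hi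
        refine ⟨⟨i, ?_⟩, ?_⟩
        · rw [hfj', mem_ledges_append]; exact Or.inl hi
        · rintro rfl
          exact n3 x (mem_of_mem_ledges hi).2 x (by simp) rfl
      · left
        refine ⟨⟨i, ?_⟩, ?_⟩
        · rw [hfj', mem_ledges_append]; exact Or.inr (Or.inl hi)
        · rintro rfl
          exact n3 y (by simp) y (mem_of_mem_ledges hi).1 rfl
      · right
        rw [List.getLast?_reverse] at ha
        have : (A ++ [y]).head? = some v := by
          rw [← hv, hfj]
          cases A <;> simp
        rw [this] at ha
        simp at ha hb
        rw [ha, hb]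
    · rw [go i hij] at hi
      left
      refine ⟨⟨_, hi⟩, ?_⟩
      rintro rfl
      exact hij (h2 _ _ _ (mem_of_mem_ledges hi).1 hyl)

theorem rotate_forest {k : ℕ} (f : Fin k → List V) (hf : IsForest f) (j l0 : Fin k) (v x y : V)
    (hv : (f j).head? = some v)
    (hl0 : (∃ A B, f l0 = A ++ y :: x :: B) ∨ (l0 ≠ j ∧ ∃ A B, f l0 = A ++ x :: y :: B)) :
    ∃ g : Fin k → List V, IsForest g ∧ (∀ z, (∃ i, z ∈ g i) ↔ ∃ i, z ∈ f i) ∧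
    (∀ e, FE g e → (FE f e ∧ e ≠ s(y, x)) ∨ e = s(v, x)) ∧
    (∀ l, l ≠ j → l ≠ l0 → g l = f l) ∧
    (l0 ≠ j → (∃ A B, f l0 = A ++ y :: x :: B) → g l0 <+: f l0) := by
  by_cases hc : ∃ A B, f l0 = A ++ y :: x :: B
  · obtain ⟨A, B, h⟩ := hc
    by_cases hne : l0 = j
    · subst hne
      obtain ⟨a, b, c⟩ := rotate_forest_self f hf l0 v x y hv A B h
      refine ⟨_, a, b, c, ?_, ?_⟩
      · intro l h1 _; simp [h1]
      · intro h; exact absurd rfl h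
    · have h' : f l0 = (A ++ [y]) ++ x :: B := by simp [h]
      obtain ⟨a, b, c⟩ := rotate_forest_aux f hf j l0 v x y hv hne (A ++ [y]) (x :: B) (by simp) (by simp)
        (by rw [h']) (by intro e he; rw [h', mem_ledges_append]; exact Or.inl he)
        (by intro e he; rw [h', mem_ledges_append]; exact Or.inr (Or.inl he))
      refine ⟨_, a, b, c, ?_, ?_⟩
      · intro l h1 h2; simp [h1, h2]
      · intro _ _
        simp only [ne_eq, hne, not_false_eq_true, Function.update_of_ne, Function.update_self]
        rw [h']
        exact List.prefix_append _ _
  · obtain ⟨hne, A, B, h⟩ := hl0.resolve_left hc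
    have h' : f l0 = (A ++ [x]) ++ y :: B := by simp [h]
    obtain ⟨a, b, c⟩ := rotate_forest_aux f hf j l0 v x y hv hne (y :: B) ((A ++ [x]).reverse) (by simp) (by simp)
        (by rw [h']; exact List.perm_append_comm.trans ((List.reverse_perm _).append_right _))
        (by intro e he; rw [h', mem_ledges_append]; exact Or.inr (Or.inl he))
        (by intro e he; rw [h', mem_ledges_append]; rw [mem_ledges_reverse] at he; exact Or.inl he)
    refine ⟨_, a, b, c, ?_, ?_⟩
    · intro l h1 h2; simp [h1, h2]
    · intro _ h; exact absurd h hc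

end forest

section chain
variable {V : Type*}

/-- rainbow forest inside the good edges -/
def RForest {k : ℕ} (c : Sym2 V → ℕ) (Gd : Sym2 V → Prop) (f : Fin k → List V) : Prop :=
  IsForest f ∧ (∀ e, FE f e → Gd e) ∧ (∀ e e', FE f e → FE f e' → c e = c e' → e = e')

/-- `x` follows `y` on one of the paths -/
def Follows {k : ℕ} (f : Fin k → List V) (y x : V) : Prop := ∃ j A B, f j = A ++ y :: x :: B

/-- available colours -/
def Av {k : ℕ} (c : Sym2 V → ℕ) (Gd : Sym2 V → Prop) (f : Fin k → List V) (v : Fin k → V) : ℕ → Set ℕ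
  | 0 => {φ | ∀ e, FE f e → c e ≠ φ}
  | (i + 1) => Av c Gd f v i ∪ {φ | ∃ hi : i < k, ∃ y x, Follows f y x ∧ φ = c s(y, x) ∧
      Gd s(v ⟨i, hi⟩, x) ∧ c s(v ⟨i, hi⟩, x) ∈ Av c Gd f v i}

theorem Follows.FE {k : ℕ} {f : Fin k → List V} {y x : V} (h : Follows f y x) : FE f s(y, x) := by
  obtain ⟨j, A, B, h⟩ := h
  exact ⟨j, (mem_ledges_iff _ _).2 ⟨A, y, x, B, h, rfl⟩⟩

theorem nodup_order {l A B A' B' : List V} {x y : V} (hl : l.Nodup) (h1 : l = A ++ x :: y :: B)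
    (h2 : l = A' ++ y :: x :: B') : False := by
  rw [h1] at hl
  have h3 : [x, y].Sublist (A' ++ y :: x :: B') := by
    rw [← h2, h1]
    exact (List.Sublist.trans (by simp) (List.sublist_append_right A _))
  have h4 : [y, x].Sublist (A ++ x :: y :: B) := by
    rw [← h1, h2]
    exact (List.Sublist.trans (by simp) (List.sublist_append_right A' _))
  rw [List.nodup_append] at hl
  obtain ⟨a, b, d⟩ := hl
  have hyA : y ∉ A := fun h => d y h y (by simp) rfl
  have h5 : [y, x].Sublist (x :: y :: B) := by
    clear h1 h2 h3 a
    induction A with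
    | nil => simpa using h4
    | cons z A ih =>
      rw [List.cons_append, List.cons_sublist_cons'] at h4
      rcases h4 with h4 | h4
      · exact ih h4 (fun u hu w hw => d u (by simp [hu]) w hw) (fun h => hyA (by simp [h]))
      · exact absurd h4.1 (fun h => hyA (by simp [h]))
  simp only [List.nodup_cons, List.mem_cons] at b
  rw [List.cons_sublist_cons'] at h5
  rcases h5 with h5 | h5
  · rw [List.cons_sublist_cons'] at h5
    rcases h5 with h5 | h5
    · have := h5.subset (a := x) (by simp)
      tauto
    · have := h5.2.subset (a := x) (by simp)
      tauto
  · exact b.1 (Or.inl h5.1.symm)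

theorem chain {k : ℕ} (c : Sym2 V → ℕ) (Gd : Sym2 V → Prop) (f : Fin k → List V)
    (hf : RForest c Gd f) (v : Fin k → V) (hv : ∀ i, (f i).head? = some (v i)) :
    ∀ i : ℕ, i ≤ k → ∀ (g : Fin k → List V) (e0 : Sym2 V), IsForest g → (∀ e, FE g e → Gd e) →
      (∀ l : Fin k, (l : ℕ) < i → g l <+: f l) →
      (∀ e e', FE g e → FE g e' → e ≠ e0 → e' ≠ e0 → c e = c e' → e = e') →
      (∀ e, FE g e → e ≠ e0 → c e ∈ Av c Gd f v i → FE f e) → c e0 ∈ Av c Gd f v i →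
      ∃ g' : Fin k → List V, RForest c Gd g' ∧ ∀ z, (∃ i, z ∈ g' i) ↔ ∃ i, z ∈ g i := by
  intro i
  -- finishing criterion
  have fin : ∀ (g : Fin k → List V) (e0 : Sym2 V), IsForest g → (∀ e, FE g e → Gd e) →
      (∀ e e', FE g e → FE g e' → e ≠ e0 → e' ≠ e0 → c e = c e' → e = e') →
      (∀ e, FE g e → e ≠ e0 → c e ≠ c e0) → RForest c Gd g := by
    intro g e0 h1 h2 h3 h4
    refine ⟨h1, h2, ?_⟩
    intro e e' he he' hc
    by_cases a : e = e0
    · by_cases b : e' = e0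
      · rw [a, b]
      · subst a; exact absurd hc.symm (h4 e' he' b)
    · by_cases b : e' = e0
      · subst b; exact absurd hc (h4 e he a)
      · exact h3 e e' he he' a b hc
  induction i with
  | zero =>
    intro _ g e0 hg hG _ hinj hAv h0
    refine ⟨g, fin g e0 hg hG hinj ?_, fun z => Iff.rfl⟩
    intro e he hne hc
    exact h0 e (hAv e he hne (by rw [hc]; exact h0)) hc
  | succ i ih =>
    intro hik g e0 hg hG hpre hinj hAv h0
    have hsub : Av c Gd f v i ⊆ Av c Gd f v (i + 1) := by
      intro φ h; exact Or.inl h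
    by_cases hAi : c e0 ∈ Av c Gd f v i
    · exact ih (by omega) g e0 hg hG (fun l hl => hpre l (by omega)) hinj
        (fun e he hne h => hAv e he hne (hsub h)) hAi
    · rcases id h0 with h | ⟨hi, y, x, hyx, hφ, hGd, hA⟩
      · exact absurd h hAi
      have only : ∀ e, FE g e → e ≠ e0 → c e = c e0 → e = s(y, x) := by
        intro e he hne hc
        have := hAv e he hne (by rw [hc]; exact h0)
        exact hf.2.2 _ _ this hyx.FE (by rw [hc, hφ])
      by_cases hin : FE g s(y, x)
      · obtain ⟨l0, hl0⟩ := hin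
        obtain ⟨j0, A0, B0, hj0⟩ := hyx
        rw [mem_ledges_iff] at hl0
        obtain ⟨A, a, b, B, hgl, hab⟩ := hl0
        have hcase : (∃ A B, g l0 = A ++ y :: x :: B) ∨ (∃ A B, g l0 = A ++ x :: y :: B) := by
          rw [Sym2.eq_iff] at hab
          rcases hab with ⟨rfl, rfl⟩ | ⟨rfl, rfl⟩
          · exact Or.inl ⟨_, _, hgl⟩
          · exact Or.inr ⟨_, _, hgl⟩
        have horient : (l0 : ℕ) < i + 1 → ∃ A B, g l0 = A ++ y :: x :: B := by
          intro hlt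
          rcases hcase with h | ⟨A, B, h⟩
          · exact h
          · exfalso
            obtain ⟨t, ht⟩ := hpre l0 hlt
            have hx1 : x ∈ f l0 := by rw [← ht, h]; simp
            have hx2 : x ∈ f j0 := by rw [hj0]; simp
            have := hf.1.2.1 _ _ _ hx1 hx2
            subst this
            refine nodup_order (hf.1.1 l0) (A := A) (B := B ++ t) (x := x) (y := y) ?_ hj0
            rw [← ht, h]; simp
        set j : Fin k := ⟨i, hi⟩ with hj
        have hgv : (g j).head? = some (v j) := by
          obtain ⟨t, ht⟩ := hpre j (by simp [hj])
          rw [← hv j, ← ht]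
          have := hg.2.2 j
          cases hgj : g j with
          | nil => exact absurd hgj this
          | cons a l => simp
        obtain ⟨g', r1, r2, r3, r4, r5⟩ := rotate_forest g hg j l0 (v j) x y hgv (by
          by_cases hlj : l0 = j
          · exact Or.inl (horient (by rw [hlj]; simp [hj]))
          · rcases hcase with h | h
            · exact Or.inl h
            · exact Or.inr ⟨hlj, h⟩)
        have hne0 : c s(v j, x) ≠ c e0 := by
          intro h; rw [h] at hA; exact hAi hA
        obtain ⟨g'', s1, s2⟩ := ih (by omega) g' s(v j, x) r1
          (by
            intro e he
            rcases r3 e he with h | rfl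
            · exact hG e h.1
            · exact hGd)
          (by
            intro l hl
            have hlj : l ≠ j := by
              rintro rfl; simp [hj] at hl
            by_cases hll : l = l0
            · subst hll
              exact (r5 hlj (horient (by omega))).trans (hpre l (by omega))
            · rw [r4 l hlj hll]; exact hpre l (by omega))
          (by
            intro e e' he he' hne hne' hcc
            have k1 := (r3 e he).resolve_right hne
            have k2 := (r3 e' he').resolve_right hne'
            by_cases a : e = e0
            · by_cases b : e' = e0
              · rw [a, b]
              · subst a; exact absurd (only e' k2.1 b hcc.symm) k2.2
            · by_cases b : e' = e0
              · subst b; exact absurd (only e k1.1 a hcc) k1.2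
              · exact hinj e e' k1.1 k2.1 a b hcc)
          (by
            intro e he hne hAe
            have k1 := (r3 e he).resolve_right hne
            by_cases a : e = e0
            · subst a; exact absurd hAe hAi
            · exact hAv e k1.1 a (hsub hAe))
          hA
        exact ⟨g'', s1, fun z => (s2 z).trans (r2 z)⟩
      · refine ⟨g, fin g e0 hg hG hinj ?_, fun z => Iff.rfl⟩
        intro e he hne hc
        have := only e he hne hc
        subst this
        exact hin he

end chain

section count
variable {V : Type*} [Fintype V] [DecidableEq V]

theorem Follows.unique {k : ℕ} {f : Fin k → List V} (hf : IsForest f) {y y' x : V}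
    (h : Follows f y x) (h' : Follows f y' x) : y = y' := by
  obtain ⟨j, A, B, h⟩ := h
  obtain ⟨j', A', B', h'⟩ := h'
  have : j = j' := hf.2.1 j j' x (by rw [h]; simp) (by rw [h']; simp)
  subst this
  have hn := hf.1 j
  have e1 : f j = (A ++ [y]) ++ x :: B := by simp [h]
  have e2 : f j = (A' ++ [y']) ++ x :: B' := by simp [h']
  have n1 : x ∉ A ++ [y] := by
    rw [e1, List.nodup_append] at hn
    exact fun hx => hn.2.2 x hx x (by simp) rfl
  have n2 : x ∉ A' ++ [y'] := by
    have hn := hf.1 j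
    rw [e2, List.nodup_append] at hn
    exact fun hx => hn.2.2 x hx x (by simp) rfl
  rw [e1] at e2
  have n3 : x ∉ B := by
    rw [e1, List.nodup_append] at hn
    have := hn.2.1
    simp at this
    exact this.1
  have := (List.append_cons_inj_of_notMem n1 n3).1 e2
  have h2 := this.1
  simpa using (List.append_inj' h2 rfl).2

/-- covered vertices -/
noncomputable def fverts {k : ℕ} (f : Fin k → List V) : Finset V := by
  classical exact univ.filter (fun x => ∃ i, x ∈ f i)

@[simp] theorem mem_fverts {k : ℕ} (f : Fin k → List V) (x : V) : x ∈ fverts f ↔ ∃ i, x ∈ f i := by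
  simp [fverts]

theorem exists_forest (c : Sym2 V → ℕ) (Gd : Sym2 V → Prop)
    (hc : ∀ u v w : V, u ≠ v → u ≠ w → v ≠ w → c s(u, v) ≠ c s(u, w))
    (k D g : ℕ) (hk : k ≤ Fintype.card V) (hg : Fintype.card V < k * g)
    (hdeg : ∀ (v : V) (N : Finset V), (∀ w ∈ N, w ≠ v ∧ ¬ Gd s(v, w)) → N.card ≤ D) :
    ∃ f : Fin k → List V, RForest c Gd f ∧ Fintype.card V ≤ (fverts f).card + D + g + 1 := by
  classical
  let S : Set ℕ := {m | ∃ f : Fin k → List V, RForest c Gd f ∧ (fverts f).card = m}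
  have hS1 : S.Nonempty := by
    have : Nonempty (Fin k ↪ V) := by
      apply Function.Embedding.nonempty_of_card_le; simpa using hk
    obtain ⟨em⟩ := this
    refine ⟨_, fun i => [em i], ⟨⟨?_, ?_, ?_⟩, ?_, ?_⟩, rfl⟩
    · simp
    · intro i j x hi hj
      simp at hi hj
      exact em.injective (hi.symm.trans hj)
    · simp
    · rintro e ⟨i, hi⟩; simp at hi
    · rintro e e' ⟨i, hi⟩; simp at hi
  have hS2 : BddAbove S := by
    refine ⟨Fintype.card V, ?_⟩
    rintro m ⟨f, _, rfl⟩
    exact Finset.card_le_univ _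
  obtain ⟨f, hf, hfm⟩ := Nat.sSup_mem hS1 hS2
  have hmax : ∀ f' : Fin k → List V, RForest c Gd f' → (fverts f').card ≤ (fverts f).card := by
    intro f' hf'
    rw [hfm]
    exact le_csSup hS2 ⟨f', hf', rfl⟩
  refine ⟨f, hf, ?_⟩
  by_contra hcon
  push Not at hcon
  have hex : ∀ i, ∃ x, (f i).head? = some x := by
    intro i
    cases h : f i with
    | nil => exact absurd h (hf.1.2.2 i)
    | cons a l => exact ⟨a, rfl⟩
  choose v hv using hex
  have hvm : ∀ i, v i ∈ f i := fun i => List.mem_of_mem_head? (hv i)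
  have hvinj : Function.Injective v := by
    intro i j hij
    exact hf.1.2.1 i j (v i) (hvm i) (by rw [hij]; exact hvm j)
  -- extension is impossible
  have hext : ∀ (i : Fin k) (w : V), w ∉ fverts f → Gd s(v i, w) → c s(v i, w) ∈ Av c Gd f v i → False := by
    intro i w hw hGd hA
    have hw' : ∀ j, w ∉ f j := by simpa using hw
    set g' := Function.update f i (w :: f i) with hg'
    have gi : g' i = w :: f i := by simp [hg']
    have go : ∀ j, j ≠ i → g' j = f j := by intro j hj; simp [hg', hj]
    have hmem : ∀ j x, x ∈ g' j ↔ x ∈ f j ∨ (j = i ∧ x = w) := by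
      intro j x
      by_cases hj : j = i
      · subst hj; rw [gi]; simp; tauto
      · rw [go j hj]; simp [hj]
    have hFE : ∀ e, FE g' e → FE f e ∨ e = s(v i, w) := by
      rintro e ⟨j, hj⟩
      by_cases hji : j = i
      · subst hji
        rw [gi] at hj
        have := hv j
        cases hfj : f j with
        | nil => rw [hfj] at this; simp at this
        | cons a l =>
          rw [hfj] at hj this
          simp at hj this
          rcases hj with rfl | hj
          · right; rw [← this, Sym2.eq_swap]
          · left; exact ⟨j, by rw [hfj]; exact hj⟩
      · rw [go j hji] at hj; exact Or.inl ⟨j, hj⟩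
    obtain ⟨f', h1, h2⟩ := chain c Gd f hf v hv i i.2.le g' s(v i, w)
      (by
        refine ⟨?_, ?_, ?_⟩
        · intro j
          by_cases hj : j = i
          · subst hj; rw [gi]; simp [hw', hf.1.1 j]
          · rw [go j hj]; exact hf.1.1 j
        · intro a b x ha hb
          rw [hmem] at ha hb
          rcases ha with ha | ⟨ha1, ha2⟩ <;> rcases hb with hb | ⟨hb1, hb2⟩
          · exact hf.1.2.1 _ _ _ ha hb
          · exact absurd (hb2 ▸ ha) (hw' _)
          · exact absurd (ha2 ▸ hb) (hw' _)
          · exact ha1.trans hb1.symm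
        · intro j
          by_cases hj : j = i
          · subst hj; rw [gi]; simp
          · rw [go j hj]; exact hf.1.2.2 j)
      (by
        intro e he
        rcases hFE e he with h | rfl
        · exact hf.2.1 e h
        · exact hGd)
      (by
        intro l hl
        rw [go l (by rintro rfl; omega)])
      (by
        intro e e' he he' hne hne' hcc
        exact hf.2.2 e e' ((hFE e he).resolve_right hne) ((hFE e' he').resolve_right hne') hcc)
      (by
        intro e he hne _
        exact (hFE e he).resolve_right hne)
      hA
    have hsub : insert w (fverts f) ⊆ fverts f' := by
      intro z hz
      rw [mem_fverts, h2 z]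
      rw [Finset.mem_insert, mem_fverts] at hz
      rcases hz with rfl | ⟨j, hj⟩
      · exact ⟨i, by rw [hmem]; simp⟩
      · exact ⟨j, by rw [hmem]; simp [hj]⟩
    have := Finset.card_le_card hsub
    rw [Finset.card_insert_of_notMem hw] at this
    have := hmax f' h1
    omega
  -- the freed vertices
  let NH : Finset V := univ.filter (fun x => ∃ y, Follows f y x)
  let X : ℕ → Finset V := fun i => univ.filter (fun x => ∃ y, Follows f y x ∧ c s(y, x) ∈ Av c Gd f v i)
  have hXNH : ∀ i, X i ⊆ NH := by
    intro i x hx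
    simp only [X, NH, Finset.mem_filter, Finset.mem_univ, true_and] at hx ⊢
    obtain ⟨y, hy, _⟩ := hx
    exact ⟨y, hy⟩
  have hnothead : ∀ x ∈ NH, ∀ i, x ≠ v i := by
    intro x hx i hxi
    simp only [NH, Finset.mem_filter, Finset.mem_univ, true_and] at hx
    obtain ⟨y, j, A, B, hj⟩ := hx
    have : j = i := hf.1.2.1 j i x (by rw [hj]; simp) (by rw [hxi]; exact hvm i)
    subst this
    have h1 := hv j
    have h2 := hf.1.1 j
    rw [hj] at h1 h2
    have h3 : A ++ y :: x :: B = (A ++ [y]) ++ x :: B := by simp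
    rw [h3] at h1 h2
    rw [List.nodup_append] at h2
    refine h2.2.2 x ?_ x (by simp) rfl
    have h4 : (A ++ [y]).head? = some (v j) := by
      rw [← h1]; cases A <;> simp
    rw [hxi]
    exact List.mem_of_mem_head? h4
  have hcardW : NH.card + k ≤ (fverts f).card := by
    have hdisj : Disjoint NH (univ.image v) := by
      rw [Finset.disjoint_left]
      intro x hx hx'
      simp at hx'
      obtain ⟨i, hi⟩ := hx'
      exact hnothead x hx i hi.symm
    have : (univ.image v).card = k := by
      rw [Finset.card_image_of_injective _ hvinj]; simp
    have h3 := Finset.card_union_of_disjoint hdisj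
    suffices h : (NH ∪ univ.image v).card ≤ (fverts f).card by omega
    apply Finset.card_le_card
    intro x hx
    simp only [Finset.mem_union, NH, Finset.mem_filter, Finset.mem_univ, true_and, Finset.mem_image] at hx
    rw [mem_fverts]
    rcases hx with ⟨y, j, A, B, h⟩ | ⟨i, rfl⟩
    · exact ⟨j, by rw [h]; simp⟩
    · exact ⟨i, hvm i⟩
  have hcover : ∀ x ∈ fverts f, x ∈ NH ∨ ∃ i, x = v i := by
    intro x hx
    rw [mem_fverts] at hx
    obtain ⟨i, hi⟩ := hx
    obtain ⟨A, B, h⟩ := List.append_of_mem hi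
    rcases A.eq_nil_or_concat with rfl | ⟨A, a, rfl⟩
    · right
      refine ⟨i, ?_⟩
      have := hv i
      rw [h] at this
      simpa using this
    · left
      simp only [NH, Finset.mem_filter, Finset.mem_univ, true_and]
      exact ⟨a, i, A, B, by rw [h]; simp⟩
  have hgrow : ∀ i, i < k → (X i).card + g ≤ (X (i+1)).card := by
    intro i hi
    set u := v ⟨i, hi⟩ with hu
    let N : Finset V := univ.filter (fun w => w ≠ u ∧ Gd s(u, w))
    let N1 : Finset V := N.filter (fun w => c s(u, w) ∈ Av c Gd f v i)
    let N2 : Finset V := N.filter (fun w => ¬ c s(u, w) ∈ Av c Gd f v i)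
    have hN : Fintype.card V ≤ N.card + D + 1 := by
      have h1 := hdeg u (univ.filter (fun w => w ≠ u ∧ ¬ Gd s(u, w))) (by intro w hw; simpa using hw)
      have h2 : (univ : Finset V) ⊆ N ∪ (univ.filter (fun w => w ≠ u ∧ ¬ Gd s(u, w))) ∪ {u} := by
        intro w _
        simp [N]
        tauto
      have h3 := Finset.card_le_card h2
      have h4 := Finset.card_union_le (N ∪ (univ.filter (fun w => w ≠ u ∧ ¬ Gd s(u, w)))) {u}
      have h5 := Finset.card_union_le N (univ.filter (fun w => w ≠ u ∧ ¬ Gd s(u, w)))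
      simp only [Finset.card_univ, Finset.card_singleton] at h3 h4
      omega
    have hN12 : N1.card + N2.card = N.card := Finset.card_filter_add_card_filter_not _
    have hN1 : N1.card ≤ k + (X (i+1)).card := by
      have : N1 ⊆ univ.image v ∪ X (i+1) := by
        intro w hw
        simp only [N1, N, Finset.mem_filter, Finset.mem_univ, true_and] at hw
        obtain ⟨⟨hwu, hwG⟩, hwA⟩ := hw
        have hwW : w ∈ fverts f := by
          by_contra h
          exact hext ⟨i, hi⟩ w h hwG hwA
        rw [Finset.mem_union]
        rcases hcover w hwW with h | ⟨j, h⟩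
        · right
          simp only [NH, X, Finset.mem_filter, Finset.mem_univ, true_and] at h ⊢
          obtain ⟨y, hy⟩ := h
          exact ⟨y, hy, Or.inr ⟨hi, y, w, hy, rfl, hwG, hwA⟩⟩
        · left; simp [h]
      have h1 := Finset.card_le_card this
      have h2 := Finset.card_union_le (univ.image v) (X (i+1))
      have h3 : (univ.image v).card ≤ k := by
        simpa using (Finset.card_image_le (s := (univ : Finset (Fin k))) (f := v))
      omega
    have hN2 : N2.card + (X i).card ≤ NH.card := by
      rw [← Finset.card_sdiff_add_card_eq_card (hXNH i)]
      apply Nat.add_le_add_right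
      have hex : ∀ w, ∃ x, w ∈ N2 → x ∈ NH \ X i ∧ ∃ y, Follows f y x ∧ c s(u, w) = c s(y, x) := by
        intro w
        by_cases hw : w ∈ N2
        · simp only [N2, N, Finset.mem_filter, Finset.mem_univ, true_and] at hw
          have hnot0 : c s(u, w) ∉ Av c Gd f v 0 := by
            intro h
            apply hw.2
            have : ∀ i, Av c Gd f v 0 ⊆ Av c Gd f v i := by
              intro i
              induction i with
              | zero => exact subset_rfl
              | succ i ih => exact ih.trans (fun φ h => Or.inl h)
            exact this i h
          have : ∃ e, FE f e ∧ c e = c s(u, w) := by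
            by_contra h
            push Not at h
            exact hnot0 h
          obtain ⟨e, ⟨j, he⟩, hce⟩ := this
          rw [mem_ledges_iff] at he
          obtain ⟨A, y, x, B, hj, rfl⟩ := he
          have hF : Follows f y x := ⟨j, A, B, hj⟩
          refine ⟨x, fun _ => ⟨?_, y, hF, hce.symm⟩⟩
          rw [Finset.mem_sdiff]
          constructor
          · simp only [NH, Finset.mem_filter, Finset.mem_univ, true_and]; exact ⟨y, hF⟩
          · simp only [X, Finset.mem_filter, Finset.mem_univ, true_and]
            rintro ⟨y', hy', hA⟩
            have := Follows.unique hf.1 hF hy'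
            subst this
            rw [hce] at hA
            exact hw.2 hA
        · exact ⟨u, fun h => absurd h hw⟩
      choose p hp using hex
      apply Finset.card_le_card_of_injOn p
      · intro w hw; exact (hp w hw).1
      · intro w hw w' hw' hpp
        obtain ⟨y, hy, e1⟩ := (hp w hw).2
        obtain ⟨y', hy', e2⟩ := (hp w' hw').2
        rw [hpp] at hy e1
        have := Follows.unique hf.1 hy hy'
        subst this
        by_contra hne
        have hw1 : w ∈ N2 := hw
        have hw2 : w' ∈ N2 := hw'
        simp only [N2, N, Finset.mem_filter, Finset.mem_univ, true_and] at hw1 hw2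
        exact hc u w w' hw1.1.1.symm hw2.1.1.symm hne (e1.trans e2.symm)
    omega
  have hall : ∀ i, i ≤ k → i * g ≤ (X i).card := by
    intro i
    induction i with
    | zero => simp
    | succ i ih =>
      intro h
      have := hgrow i (by omega)
      have := ih (by omega)
      rw [Nat.succ_mul]; omega
  have h1 := hall k le_rfl
  have h2 := Finset.card_le_univ (X k)
  omega

end count

section cyc
variable {V : Type*}

/-- edges of the closed walk along a list -/
def cedges : List V → List (Sym2 V)
  | [] => []
  | a :: l => ledges (a :: l ++ [a])

theorem flatten_edges [DecidableEq V] (LL : List (List V)) (a : V) :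
    ∃ B : Finset (Sym2 V), B.card ≤ LL.length ∧
      ∀ e ∈ ledges (LL.flatten ++ [a]), (∃ l ∈ LL, e ∈ ledges l) ∨ e ∈ B := by
  induction LL with
  | nil => exact ⟨∅, by simp⟩
  | cons l LL ih =>
    obtain ⟨B, h1, h2⟩ := ih
    by_cases h : ∃ e0, Junc l (LL.flatten ++ [a]) e0
    · obtain ⟨e0, h0⟩ := h
      refine ⟨insert e0 B, ?_, ?_⟩
      · have := Finset.card_insert_le e0 B
        simp only [List.length_cons]; omega
      · intro e he
        rw [List.flatten_cons, List.append_assoc, mem_ledges_append] at he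
        rcases he with he | he | he
        · left; exact ⟨l, by simp, he⟩
        · rcases h2 e he with ⟨l', hl', h⟩ | h
          · left; exact ⟨l', by simp [hl'], h⟩
          · right; simp [h]
        · right
          obtain ⟨x, y, hx, hy, rfl⟩ := he
          obtain ⟨x', y', hx', hy', rfl⟩ := h0
          rw [hx] at hx'; rw [hy] at hy'
          simp at hx' hy'
          simp [hx', hy']
    · refine ⟨B, by simp only [List.length_cons]; omega, ?_⟩
      intro e he
      rw [List.flatten_cons, List.append_assoc, mem_ledges_append] at he
      rcases he with he | he | he
      · left; exact ⟨l, by simp, he⟩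
      · rcases h2 e he with ⟨l', hl', h⟩ | h
        · left; exact ⟨l', by simp [hl'], h⟩
        · right; exact h
      · exact absurd ⟨e, he⟩ h

theorem exists_almost_cycle [Fintype V] [DecidableEq V] (c : Sym2 V → ℕ) (Gd : Sym2 V → Prop)
    (hc : ∀ u v w : V, u ≠ v → u ≠ w → v ≠ w → c s(u, v) ≠ c s(u, w))
    (k D g : ℕ) (hk : k ≤ Fintype.card V) (hg : Fintype.card V < k * g)
    (hdeg : ∀ (v : V) (N : Finset V), (∀ w ∈ N, w ≠ v ∧ ¬ Gd s(v, w)) → N.card ≤ D) :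
    ∃ (L : List V) (B : Finset (Sym2 V)), L.Nodup ∧ Fintype.card V ≤ L.length + D + g + 1 ∧
      B.card ≤ k ∧ (∀ e ∈ cedges L, e ∉ B → Gd e) ∧
      ∀ e ∈ cedges L, ∀ e' ∈ cedges L, e ∉ B → e' ∉ B → c e = c e' → e = e' := by
  obtain ⟨f, hf, hcard⟩ := exists_forest c Gd hc k D g hk hg hdeg
  have hmem : ∀ x, x ∈ (List.ofFn f).flatten ↔ x ∈ fverts f := by
    intro x
    rw [mem_fverts, List.mem_flatten]
    constructor
    · rintro ⟨l, hl, hx⟩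
      rw [List.mem_ofFn] at hl
      obtain ⟨i, rfl⟩ := hl
      exact ⟨i, hx⟩
    · rintro ⟨i, hx⟩
      exact ⟨f i, by rw [List.mem_ofFn]; exact ⟨i, rfl⟩, hx⟩
  have hnd : (List.ofFn f).flatten.Nodup := by
    rw [List.nodup_flatten]
    constructor
    · intro l hl
      rw [List.mem_ofFn] at hl
      obtain ⟨i, rfl⟩ := hl
      exact hf.1.1 i
    · rw [List.pairwise_ofFn]
      intro i j hij x hx hx'
      exact absurd (hf.1.2.1 i j x hx hx') hij.ne
  have hlen : (List.ofFn f).flatten.length = (fverts f).card := by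
    rw [← List.toFinset_card_of_nodup hnd]
    congr 1
    ext x; rw [List.mem_toFinset, hmem]
  have key : ∃ B : Finset (Sym2 V), B.card ≤ k ∧ ∀ e ∈ cedges (List.ofFn f).flatten, FE f e ∨ e ∈ B := by
    cases hL : (List.ofFn f).flatten with
    | nil => exact ⟨∅, by simp, by simp [cedges]⟩
    | cons a l =>
      obtain ⟨B, h1, h2⟩ := flatten_edges (List.ofFn f) a
      refine ⟨B, by simpa using h1, ?_⟩
      intro e he
      rw [hL] at h2
      rcases h2 e he with ⟨l, hl, h⟩ | h
      · rw [List.mem_ofFn] at hl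
        obtain ⟨i, rfl⟩ := hl
        exact Or.inl ⟨i, h⟩
      · exact Or.inr h
  obtain ⟨B, hB, hBe⟩ := key
  refine ⟨_, B, hnd, by omega, hB, ?_, ?_⟩
  · intro e he hn
    exact hf.2.1 e ((hBe e he).resolve_right hn)
  · intro e he e' he' hn hn' h
    exact hf.2.2 e e' ((hBe e he).resolve_right hn) ((hBe e' he').resolve_right hn') h

end cyc

section walks
variable {V : Type*}

theorem exists_walk (l : List V) : ∀ (a b : V), (a :: l).Nodup → (a :: l).getLast? = some b →
    ∃ w : (⊤ : SimpleGraph V).Walk a b, w.support = a :: l ∧ w.edges = ledges (a :: l) := by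
  induction l with
  | nil =>
    intro a b _ h
    simp at h
    subst h
    exact ⟨SimpleGraph.Walk.nil, by simp, by simp⟩
  | cons x l ih =>
    intro a b hn h
    have h' : (x :: l).getLast? = some b := by simpa using h
    obtain ⟨w, h1, h2⟩ := ih x b (List.nodup_cons.1 hn).2 h'
    have hax : (⊤ : SimpleGraph V).Adj a x := by
      rw [SimpleGraph.top_adj]
      rintro rfl
      simp at hn
    refine ⟨SimpleGraph.Walk.cons hax w, ?_, ?_⟩
    · simp [h1]
    · simp [h2]

theorem exists_cycle (c : Sym2 V → ℕ) (L : List V) (hL : L.Nodup) (h3 : 3 ≤ L.length)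
    (hc : ∀ e ∈ cedges L, ∀ e' ∈ cedges L, c e = c e' → e = e') :
    ∃ (v : V) (w : (⊤ : SimpleGraph V).Walk v v), w.IsCycle ∧ (w.edges.map c).Nodup ∧
      w.length = L.length := by
  match L, hL, h3, hc with
  | a :: b :: x :: l, hL, h3, hc =>
    have hn : (b :: ((x :: l) ++ [a])).Nodup := by
      have : (a :: b :: x :: l).Perm (b :: ((x :: l) ++ [a])) := by
        have := (List.perm_append_comm (l₁ := [a]) (l₂ := b :: x :: l))
        simpa using this
      exact this.nodup_iff.1 hL
    obtain ⟨w, h1, h2⟩ := exists_walk ((x :: l) ++ [a]) b a hn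
      (by rw [← List.cons_append]; exact List.getLast?_concat)
    have hab : (⊤ : SimpleGraph V).Adj a b := by
      rw [SimpleGraph.top_adj]
      rintro rfl
      simp at hL
    have hcyc : (SimpleGraph.Walk.cons hab w).IsCycle := by
      rw [SimpleGraph.Walk.cons_isCycle_iff]
      refine ⟨SimpleGraph.Walk.IsPath.mk' (by rw [h1]; exact hn), ?_⟩
      rw [h2, List.cons_append, ledges_cons_cons, List.mem_cons]
      rintro (h | h)
      · rw [Sym2.eq_iff] at h
        rcases h with ⟨rfl, rfl⟩ | ⟨rfl, h⟩
        · simp at hL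
        · simp at hL
      · have := (mem_of_mem_ledges h).2
        rw [← List.cons_append] at this
        exact (List.nodup_cons.1 hn).1 this
    refine ⟨a, SimpleGraph.Walk.cons hab w, hcyc, ?_, ?_⟩
    · have he : (SimpleGraph.Walk.cons hab w).edges = cedges (a :: b :: x :: l) := by
        simp [h2, cedges]
      apply List.Nodup.map_on
      · intro e h e' h' hcc
        rw [he] at h h'
        exact hc e h e' h' hcc
      · exact hcyc.edges_nodup
    · have : w.support.length = w.length + 1 := SimpleGraph.Walk.length_support w
      rw [h1] at this
      simp at this ⊢
      omega

theorem cedges_rotate (L A B : List V) (h : L = A ++ B) (e : Sym2 V) :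
    e ∈ cedges (B ++ A) ↔ e ∈ cedges L := by
  subst h
  cases A with
  | nil => simp
  | cons a A =>
    cases B with
    | nil => simp
    | cons b B =>
      simp only [cedges, List.cons_append, List.append_assoc]
      rw [← List.cons_append, ← List.cons_append, mem_ledges_append, mem_ledges_append]
      have h1 : ledges (a :: (A ++ [b])) = ledges ((a :: A) ++ [b]) := rfl
      have e1 := mem_ledges_append (b :: B) ((a :: A) ++ [b]) e
      have e2 := mem_ledges_append (a :: A) ((b :: B) ++ [a]) e
      have e3 := mem_ledges_append (a :: A) [b] e
      have e4 := mem_ledges_append (b :: B) [a] e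
      simp only [Junc, List.cons_append] at *
      simp only [List.head?_cons] at *
      simp at *
      grind

/-- cut a cycle open at a given edge -/
theorem cut_cycle (L : List V) (hL : L.Nodup) (h3 : 3 ≤ L.length) (e : Sym2 V) (he : e ∈ cedges L) :
    ∃ L' : List V, L'.Perm L ∧ (∀ e' ∈ ledges L', e' ∈ cedges L) ∧ e ∉ ledges L' := by
  have main : ∀ (L' : List V) (x y : V), L'.Nodup → 3 ≤ L'.length → L'.head? = some y → L'.getLast? = some x →
      s(x, y) ∉ ledges L' := by
    intro L' x y hn h3 hy hx hmem
    match L', hn, h3 with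
    | a :: b :: d :: l, hn, h3 =>
      simp at hy
      subst hy
      have hx' : x ∈ d :: l := by
        rw [List.getLast?_cons_cons, List.getLast?_cons_cons] at hx
        exact List.mem_of_mem_getLast? hx
      rw [ledges_cons_cons, List.mem_cons] at hmem
      rcases hmem with h | h
      · rw [Sym2.eq_iff] at h
        rcases h with ⟨rfl, h⟩ | ⟨rfl, _⟩
        · subst h; simp at hn
        · exact (List.nodup_cons.1 (List.nodup_cons.1 hn).2).1 hx'
      · exact (List.nodup_cons.1 hn).1 (mem_of_mem_ledges h).2
  have hsub : ∀ (L' : List V), ∀ e' ∈ ledges L', e' ∈ cedges L' := by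
    intro L' e' h
    cases L' with
    | nil => simp at h
    | cons a l => rw [cedges, mem_ledges_append]; exact Or.inl h
  match L, hL, h3, he with
  | a :: l, hL, h3, he =>
    have he0 := he
    rw [cedges, mem_ledges_append] at he
    rcases he with he | he | ⟨x, y, hx, hy, rfl⟩
    · rw [mem_ledges_iff] at he
      obtain ⟨A, x, y, B, h, rfl⟩ := he
      have h' : a :: l = (A ++ [x]) ++ (y :: B) := by simp [h]
      have hp : ((y :: B) ++ (A ++ [x])).Perm (a :: l) := by rw [h']; exact List.perm_append_comm
      refine ⟨(y :: B) ++ (A ++ [x]), hp, ?_, ?_⟩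
      · intro e' h''
        exact (cedges_rotate _ _ _ h' e').1 (hsub _ e' h'')
      · apply main
        · exact hp.nodup_iff.2 hL
        · rw [hp.length_eq]; exact h3
        · simp
        · rw [← List.append_assoc]; exact List.getLast?_concat
    · simp at he
    · refine ⟨a :: l, List.Perm.refl _, hsub _, ?_⟩
      apply main _ _ _ hL h3 _ hx
      simpa using hy

end walks

section iter
variable {V : Type*} [DecidableEq V]

theorem iterate (c : Sym2 V → ℕ) (τ : ℕ → ℕ) (u m0 : ℕ) (hm0 : 3 ≤ m0)
    (hstep : ∀ (L : List V) (U : Finset ℕ), L.Nodup → m0 ≤ L.length → U.card ≤ u →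
      ∃ (L' : List V) (N : Finset (Sym2 V)), L'.Nodup ∧ L.length ≤ L'.length ∧ N.card ≤ 4 ∧
        (∀ e ∈ cedges L', e ∈ ledges L ∨ e ∈ N) ∧ (∀ e ∈ N, c e ∉ U ∧ τ (c e) < 4) ∧
        (∀ e ∈ N, ∀ e' ∈ N, c e = c e' → e = e')) :
    ∀ (b : ℕ) (L : List V) (B : Finset (Sym2 V)) (U : Finset ℕ), B.card ≤ b → U.card + 4 * b ≤ u →
      L.Nodup → m0 ≤ L.length → (∀ e ∈ cedges L, e ∉ B → 4 ≤ τ (c e) ∨ c e ∈ U) →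
      (∀ e ∈ cedges L, ∀ e' ∈ cedges L, e ∉ B → e' ∉ B → c e = c e' → e = e') →
      ∃ L' : List V, L'.Nodup ∧ L.length ≤ L'.length ∧
        ∀ e ∈ cedges L', ∀ e' ∈ cedges L', c e = c e' → e = e' := by
  intro b
  induction b with
  | zero =>
    intro L B U hB hU hn hm h1 h2
    have : B = ∅ := by rw [← Finset.card_eq_zero]; omega
    subst this
    exact ⟨L, hn, le_rfl, fun e he e' he' h => h2 e he e' he' (by simp) (by simp) h⟩
  | succ b ih =>
    intro L B U hB hU hn hm h1 h2
    by_cases hex : ∃ e0 ∈ B, e0 ∈ cedges L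
    · obtain ⟨e0, he0, he0'⟩ := hex
      obtain ⟨L1, hp, hsub, hnot⟩ := cut_cycle L hn (by omega) e0 he0'
      obtain ⟨L2, N, n2, l2, N4, hN1, hN2, hN3⟩ := hstep L1 U (hp.nodup_iff.2 hn) (by rw [hp.length_eq]; exact hm) (by omega)
      have hl := hp.length_eq
      have hold : ∀ e ∈ ledges L1, e ∉ B.erase e0 → e ∉ B := by
        intro e he h hB
        apply h
        rw [Finset.mem_erase]
        exact ⟨by rintro rfl; exact hnot he, hB⟩
      obtain ⟨L', a1, a2, a3⟩ := ih L2 (B.erase e0) (U ∪ N.image c)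
        (by rw [Finset.card_erase_of_mem he0]; omega)
        (by
          have := Finset.card_union_le U (N.image c)
          have := Finset.card_image_le (s := N) (f := c)
          omega) n2 (by omega)
        (by
          intro e he hne
          rcases hN1 e he with h | h
          · rcases h1 e (hsub e h) (hold e h hne) with h | h
            · exact Or.inl h
            · right; simp [h]
          · right
            rw [Finset.mem_union]
            exact Or.inr (Finset.mem_image_of_mem c h))
        (by
          have mix : ∀ e ∈ ledges L1, e ∉ B.erase e0 → ∀ e' ∈ N, c e ≠ c e' := by
            intro e he hne e' he' hcc
            have := hN2 e' he'
            rw [← hcc] at this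
            rcases h1 e (hsub e he) (hold e he hne) with h | h
            · omega
            · exact this.1 h
          intro e he e' he' hne hne' hcc
          rcases hN1 e he with h | h <;> rcases hN1 e' he' with h' | h'
          · exact h2 e (hsub e h) e' (hsub e' h') (hold e h hne) (hold e' h' hne') hcc
          · exact absurd hcc (mix e h hne e' h')
          · exact absurd hcc.symm (mix e' h' hne' e h)
          · exact hN3 e h e' h' hcc)
      exact ⟨L', a1, by omega, a3⟩
    · push Not at hex
      exact ⟨L, hn, le_rfl, fun e he e' he' h => h2 e he e' he' (fun hb => hex e hb he) (fun hb => hex e' hb he') h⟩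

end iter

section step
variable {V : Type*} [DecidableEq V]

theorem split_unique {A B A' B' : List V} {z : V} (hn : (A ++ z :: B).Nodup)
    (h : A ++ z :: B = A' ++ z :: B') : A = A' ∧ B = B' := by
  rw [List.nodup_append] at hn
  have n1 : z ∉ A := fun hx => hn.2.2 z hx z (by simp) rfl
  have n3 : z ∉ B := (List.nodup_cons.1 hn.2.1).1
  have := (List.append_cons_inj_of_notMem n1 n3).1 h
  exact ⟨this.1, this.2.2⟩

theorem cut_order {P Q A B : List V} {z : V} (hn : (P ++ Q).Nodup) (h : P ++ Q = A ++ z :: B) :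
    (z ∈ P → Q <:+ B) ∧ (z ∈ Q → P <+: A) := by
  constructor
  · intro hz
    obtain ⟨P1, P2, rfl⟩ := List.append_of_mem hz
    have e : (P1 ++ z :: P2) ++ Q = P1 ++ z :: (P2 ++ Q) := by simp
    rw [e] at h hn
    rw [← (split_unique hn h).2]
    exact List.suffix_append _ _
  · intro hz
    obtain ⟨P1, P2, rfl⟩ := List.append_of_mem hz
    have e : P ++ (P1 ++ z :: P2) = (P ++ P1) ++ z :: P2 := by simp
    rw [e] at h hn
    rw [← (split_unique hn h).1]
    exact List.prefix_append _ _

theorem preds (X : List V) (b : V) (hX : X.Nodup) (hb : X.head? = some b) (J : Finset V)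
    (hJ : ∀ z ∈ J, z ∈ X) (hbJ : b ∉ J) :
    ∃ A : Finset V, J.card ≤ A.card ∧ ∀ a ∈ A, ∃ z ∈ J, ∃ X1 X2, X = X1 ++ a :: z :: X2 := by
  have : ∀ z, ∃ a, z ∈ J → ∃ X1 X2, X = X1 ++ a :: z :: X2 := by
    intro z
    by_cases hz : z ∈ J
    · obtain ⟨P, Q, h⟩ := List.append_of_mem (hJ z hz)
      rcases P.eq_nil_or_concat with rfl | ⟨P, a, rfl⟩
      · rw [h] at hb
        simp at hb
        subst hb
        exact absurd hz hbJ
      · exact ⟨a, fun _ => ⟨P, Q, by simp [h]⟩⟩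
    · exact ⟨z, fun h => absurd h hz⟩
  choose p hp using this
  refine ⟨J.image p, ?_, ?_⟩
  · rw [Finset.card_image_of_injOn]
    intro z hz z' hz' hpp
    obtain ⟨X1, X2, h⟩ := hp z hz
    obtain ⟨Y1, Y2, h'⟩ := hp z' hz'
    rw [← hpp] at h'
    rw [h] at h' hX
    have := (split_unique hX h').2
    simp at this
    exact this.1
  · intro a ha
    rw [Finset.mem_image] at ha
    obtain ⟨z, hz, rfl⟩ := ha
    exact ⟨z, hz, hp z hz⟩

theorem succs (X : List V) (y : V) (hX : X.Nodup) (hy : X.getLast? = some y) (J : Finset V)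
    (hJ : ∀ z ∈ J, z ∈ X) (hyJ : y ∉ J) :
    ∃ A : Finset V, J.card ≤ A.card ∧ ∀ a ∈ A, ∃ z ∈ J, ∃ X1 X2, X = X1 ++ z :: a :: X2 := by
  obtain ⟨A, h1, h2⟩ := preds X.reverse y (List.nodup_reverse.2 hX) (by rw [List.head?_reverse]; exact hy) J
    (by simpa using hJ) hyJ
  refine ⟨A, h1, fun a ha => ?_⟩
  obtain ⟨z, hz, X1, X2, h⟩ := h2 a ha
  refine ⟨z, hz, X2.reverse, X1.reverse, ?_⟩
  have := congrArg List.reverse h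
  simpa using this

/-- rotating one end -/
def OneSide (X : List V) (b : V) (J : Finset V) (s t : ℕ) : Prop :=
  ∃ (T : List V) (A : Finset V), t ≤ T.length ∧ s ≤ A.card ∧ ∀ a ∈ A, ∃ (R : List V) (z : V), z ∈ J ∧
    R.Nodup ∧ X.length ≤ R.length ∧ R.head? = some a ∧ R.getLast? = X.getLast? ∧
    (∀ x ∈ R, x ∈ X ∨ x ∈ J) ∧ (∀ e ∈ ledges R, e ∈ ledges X ∨ e = s(b, z)) ∧ T <:+: R

theorem majority (J : Finset V) (p : V → Prop) [DecidablePred p] (s : ℕ) (hs : 2 * s ≤ J.card) :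
    s ≤ (J.filter p).card ∨ s ≤ (J.filter (fun x => ¬ p x)).card := by
  have := Finset.card_filter_add_card_filter_not (s := J) p
  omega

theorem oneSide_in (X : List V) (b : V) (hX : X.Nodup) (hb : X.head? = some b) (J : Finset V)
    (hJ : ∀ z ∈ J, z ∈ X) (hbJ : b ∉ J) (s : ℕ) (hs : 2 * s ≤ J.card) : OneSide X b J s (X.length / 2) := by
  obtain ⟨P, Q, hPQ, hP, hQ⟩ : ∃ P Q : List V, P ++ Q = X ∧ X.length / 2 ≤ P.length ∧ X.length / 2 ≤ Q.length :=
    ⟨X.take (X.length / 2), X.drop (X.length / 2), by simp, by simp; omega, by simp; omega⟩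
  -- the rotation
  have rot : ∀ (a z : V) (X1 X2 T : List V), z ∈ J → X = X1 ++ a :: z :: X2 →
      (T <:+: (X1 ++ [a]).reverse ++ z :: X2) → ∃ (R : List V) (z : V), z ∈ J ∧
      R.Nodup ∧ X.length ≤ R.length ∧ R.head? = some a ∧ R.getLast? = X.getLast? ∧
      (∀ x ∈ R, x ∈ X ∨ x ∈ J) ∧ (∀ e ∈ ledges R, e ∈ ledges X ∨ e = s(b, z)) ∧ T <:+: R := by
    intro a z X1 X2 T hz h hT
    have h' : X = (X1 ++ [a]) ++ z :: X2 := by simp [h]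
    have hp : ((X1 ++ [a]).reverse ++ z :: X2).Perm X := by
      rw [h']; exact (List.reverse_perm _).append_right _
    refine ⟨(X1 ++ [a]).reverse ++ z :: X2, z, hz, hp.nodup_iff.2 hX, hp.length_eq.ge, by simp, ?_, ?_, ?_, hT⟩
    · rw [h', List.getLast?_append_of_ne_nil _ (by simp), List.getLast?_append_of_ne_nil _ (by simp)]
    · intro x hx; left; exact hp.mem_iff.1 hx
    · intro e he
      rw [mem_ledges_append] at he
      rw [h', mem_ledges_append]
      rcases he with he | he | ⟨x, y, hx, hy, rfl⟩
      · rw [mem_ledges_reverse] at he; exact Or.inl (Or.inl he)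
      · exact Or.inl (Or.inr (Or.inl he))
      · right
        rw [List.getLast?_reverse] at hx
        have : (X1 ++ [a]).head? = some b := by
          rw [← hb, h]; cases X1 <;> simp
        rw [this] at hx
        simp at hx hy
        rw [hx, hy]
  have hn : (P ++ Q).Nodup := by rw [hPQ]; exact hX
  rcases majority J (fun x => x ∈ P) s hs with hm | hm
  · obtain ⟨A, h1, h2⟩ := preds X b hX hb (J.filter (fun x => x ∈ P))
      (fun z hz => hJ z (Finset.mem_filter.1 hz).1) (fun h => hbJ (Finset.mem_filter.1 h).1)
    refine ⟨Q, A, hQ, hm.trans h1, fun a ha => ?_⟩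
    obtain ⟨z, hz, X1, X2, h⟩ := h2 a ha
    rw [Finset.mem_filter] at hz
    apply rot a z X1 X2 Q hz.1 h
    have := (cut_order (A := X1 ++ [a]) (z := z) (B := X2) hn (by rw [hPQ, h]; simp)).1 hz.2
    exact (this.trans ((List.suffix_cons z X2).trans (List.suffix_append _ _))).isInfix
  · obtain ⟨A, h1, h2⟩ := preds X b hX hb (J.filter (fun x => ¬ x ∈ P))
      (fun z hz => hJ z (Finset.mem_filter.1 hz).1) (fun h => hbJ (Finset.mem_filter.1 h).1)
    refine ⟨P.reverse, A, by simpa using hP, hm.trans h1, fun a ha => ?_⟩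
    obtain ⟨z, hz, X1, X2, h⟩ := h2 a ha
    rw [Finset.mem_filter] at hz
    apply rot a z X1 X2 P.reverse hz.1 h
    have hzQ : z ∈ Q := by
      have := hJ z hz.1
      rw [← hPQ, List.mem_append] at this
      exact this.resolve_left hz.2
    have := (cut_order (A := X1 ++ [a]) (z := z) (B := X2) hn (by rw [hPQ, h]; simp)).2 hzQ
    exact (List.reverse_suffix.2 this).isInfix.trans (List.prefix_append _ _).isInfix

theorem oneSide_out (X : List V) (b : V) (hX : X.Nodup) (hb : X.head? = some b) (J : Finset V)
    (hJ : ∀ z ∈ J, z ∉ X) (s : ℕ) (hs : s ≤ J.card) : OneSide X b J s (X.length / 2) := by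
  refine ⟨X, J, by omega, hs, fun a ha => ⟨a :: X, a, ha, ?_, by simp, by simp, ?_, ?_, ?_, ?_⟩⟩
  · exact List.nodup_cons.2 ⟨hJ a ha, hX⟩
  · cases X with
    | nil => simp at hb
    | cons x X => simp
  · intro x hx
    rw [List.mem_cons] at hx
    rcases hx with rfl | hx
    · exact Or.inr ha
    · exact Or.inl hx
  · intro e he
    cases X with
    | nil => simp at hb
    | cons x X =>
      simp at hb
      subst hb
      rw [ledges_cons_cons, List.mem_cons] at he
      rcases he with rfl | he
      · right; exact Sym2.eq_swap
      · exact Or.inl he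
  · exact (List.suffix_cons a X).isInfix

/-- many choices for both ends -/
def Ends (L : List V) (b y : V) (I J : Finset V) (s t : ℕ) : Prop :=
  ∃ (T : List V) (A B : Finset V), t ≤ T.length ∧ s ≤ A.card ∧ s ≤ B.card ∧ ∀ a ∈ A, ∀ b1 ∈ B,
    ∃ (R : List V) (zi zj : V), zi ∈ I ∧ zj ∈ J ∧ R.Nodup ∧ L.length ≤ R.length ∧
      R.head? = some b1 ∧ R.getLast? = some a ∧
      (∀ e ∈ ledges R, e ∈ ledges L ∨ e = s(y, zi) ∨ e = s(b, zj)) ∧ T <:+: R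

theorem Ends.symm {L : List V} {b y : V} {I J : Finset V} {s t : ℕ} (h : Ends L.reverse y b J I s t) :
    Ends L b y I J s t := by
  obtain ⟨T, A, B, h1, h2, h3, h4⟩ := h
  refine ⟨T.reverse, B, A, by simpa using h1, h3, h2, fun a ha b1 hb => ?_⟩
  obtain ⟨R, zi, zj, r1, r2, r3, r4, r5, r6, r7, r8⟩ := h4 b1 hb a ha
  refine ⟨R.reverse, zj, zi, r2, r1, List.nodup_reverse.2 r3, by simpa using r4, ?_, ?_, ?_, ?_⟩
  · rw [List.head?_reverse]; exact r6
  · rw [List.getLast?_reverse]; exact r5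
  · intro e he
    rw [mem_ledges_reverse] at he
    have := r7 e he
    rw [mem_ledges_reverse] at this
    tauto
  · exact List.reverse_infix.2 r8

theorem Ends.mono {L : List V} {b y : V} {I J : Finset V} {s t t' : ℕ} (h : Ends L b y I J s t)
    (ht : t' ≤ t) : Ends L b y I J s t' := by
  obtain ⟨T, A, B, h1, h⟩ := h
  exact ⟨T, A, B, ht.trans h1, h⟩

theorem case1 (X Y : List V) (b y : V) (I J : Finset V) (s t t' : ℕ)
    (hn : (X ++ Y).Nodup) (hX : X ≠ []) (hY : Y ≠ []) (hIJ : Disjoint I J) (hJY : ∀ x ∈ J, x ∉ Y) (hIX : ∀ x ∈ I, x ∉ X)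
    (h1 : OneSide X b J s t) (h2 : OneSide Y.reverse y I s t') : Ends (X ++ Y) b y I J s t := by
  obtain ⟨T, B, a1, a2, a3⟩ := h1
  obtain ⟨_, A, _, b2, b3⟩ := h2
  refine ⟨T, A, B, a1, b2, a2, fun a ha b1 hb => ?_⟩
  obtain ⟨R, zj, r1, r2, r3, r4, r5, r6, r7, r8⟩ := a3 b1 hb
  obtain ⟨S, zi, s1, s2, s3, s4, s5, s6, s7, _⟩ := b3 a ha
  rw [List.nodup_append] at hn
  refine ⟨R ++ S.reverse, zi, zj, s1, r1, ?_, ?_, ?_, ?_, ?_, ?_⟩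
  · rw [List.nodup_append]
    refine ⟨r2, List.nodup_reverse.2 s2, ?_⟩
    rintro x hx _ hx' rfl
    rw [List.mem_reverse] at hx'
    have c1 := r6 x hx
    have c2 := s6 x hx'
    rw [List.mem_reverse] at c2
    rcases c1 with c1 | c1 <;> rcases c2 with c2 | c2
    · exact hn.2.2 x c1 x c2 rfl
    · exact hIX x c2 c1
    · exact hJY x c1 c2
    · exact Finset.disjoint_left.1 hIJ c2 c1
  · simp at s3 ⊢; omega
  · rw [List.head?_append, r4]; rfl
  · rw [List.getLast?_append, List.getLast?_reverse, s4]; rfl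
  · intro e he
    rw [mem_ledges_append] at he
    rw [mem_ledges_append]
    rcases he with he | he | he
    · have := r7 e he; tauto
    · rw [mem_ledges_reverse] at he
      have := s7 e he
      rw [mem_ledges_reverse] at this
      tauto
    · left; right; right
      obtain ⟨x, x', hx, hx', rfl⟩ := he
      rw [r5] at hx
      rw [List.head?_reverse, s5, List.getLast?_reverse] at hx'
      exact ⟨x, x', hx, hx', rfl⟩
  · exact r8.trans (List.prefix_append _ _).isInfix

theorem case2 (X Y : List V) (b y : V) (I J : Finset V) (s : ℕ)
    (hn : (X ++ Y).Nodup) (hb : X.head? = some b) (hy : Y.getLast? = some y)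
    (hI : ∀ x ∈ I, x ∈ X) (hJ : ∀ x ∈ J, x ∈ Y) (hIl : ∀ x, X.getLast? = some x → x ∉ I) (hJl : y ∉ J)
    (hIs : 2 * s ≤ I.card) (hJs : s ≤ J.card) : Ends (X ++ Y) b y I J s (X.length / 2) := by
  obtain ⟨P, Q, hPQ, hP, hQ⟩ : ∃ P Q : List V, P ++ Q = X ∧ X.length / 2 ≤ P.length ∧ X.length / 2 ≤ Q.length :=
    ⟨X.take (X.length / 2), X.drop (X.length / 2), by simp, by simp; omega, by simp; omega⟩
  have hXn := (List.nodup_append.1 hn).1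
  have hYn := (List.nodup_append.1 hn).2.1
  obtain ⟨w, hw⟩ : ∃ w, X.getLast? = some w := by
    cases X with
    | nil => simp at hb
    | cons x X => exact ⟨_, List.getLast?_eq_some_getLast (by simp)⟩
  obtain ⟨B, hB1, hB2⟩ := succs Y y hYn hy J hJ hJl
  have rot : ∀ (a z : V) (X1 X2 T : List V), z ∈ I → X = X1 ++ z :: a :: X2 →
      (T <:+: (X1 ++ [z]).reverse ∨ T <:+: (a :: X2).reverse) → ∀ b1 ∈ B,
    ∃ (R : List V) (zi zj : V), zi ∈ I ∧ zj ∈ J ∧ R.Nodup ∧ (X ++ Y).length ≤ R.length ∧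
      R.head? = some b1 ∧ R.getLast? = some a ∧
      (∀ e ∈ ledges R, e ∈ ledges (X ++ Y) ∨ e = s(y, zi) ∨ e = s(b, zj)) ∧ T <:+: R := by
    intro a z X1 X2 T hz h hT b1 hb1
    obtain ⟨z', hz', Y1, Y2, h'⟩ := hB2 b1 hb1
    set X1' := X1 ++ [z] with hX1'
    set X2' := a :: X2 with hX2'
    set Y1' := Y1 ++ [z'] with hY1'
    set Y2' := b1 :: Y2 with hY2'
    have hX : X = X1' ++ X2' := by simp [h, X1', X2']
    have hY : Y = Y1' ++ Y2' := by simp [h', Y1', Y2']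
    have e1 : X1'.head? = some b := by
      rw [← hb, h, hX1']; cases X1 <;> simp
    have e2 : X1'.getLast? = some z := by simp [X1']
    have e3 : X2'.head? = some a := by simp [X2']
    have e4 : Y1'.getLast? = some z' := by simp [Y1']
    have e5 : Y2'.head? = some b1 := by simp [Y2']
    have e6 : Y2'.getLast? = some y := by
      rw [← hy, hY, List.getLast?_append_of_ne_nil _ (by simp [Y2'])]
    have hperm : (Y2' ++ (X1'.reverse ++ (Y1'.reverse ++ X2'.reverse))).Perm (X ++ Y) := by
      rw [hX, hY]
      refine (List.Perm.append_left Y2' ((List.reverse_perm X1').append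
        ((List.reverse_perm Y1').append (List.reverse_perm X2')))).trans ?_
      rw [List.perm_iff_count]
      intro x
      simp only [List.count_append]
      omega
    refine ⟨Y2' ++ (X1'.reverse ++ (Y1'.reverse ++ X2'.reverse)), z, z', hz, hz',
      hperm.nodup_iff.2 hn, hperm.length_eq.ge, ?_, ?_, ?_, ?_⟩
    · rw [List.head?_append, e5]; rfl
    · rw [List.getLast?_append, List.getLast?_append, List.getLast?_append, List.getLast?_reverse, e3]; rfl
    · intro e he
      have old1 : e ∈ ledges X1' → e ∈ ledges (X ++ Y) := by
        intro h; rw [mem_ledges_append, hX, mem_ledges_append]; tauto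
      have old2 : e ∈ ledges X2' → e ∈ ledges (X ++ Y) := by
        intro h; rw [mem_ledges_append, hX, mem_ledges_append]; tauto
      have old3 : e ∈ ledges Y1' → e ∈ ledges (X ++ Y) := by
        intro h; rw [mem_ledges_append, hY, mem_ledges_append Y1']; tauto
      have old4 : e ∈ ledges Y2' → e ∈ ledges (X ++ Y) := by
        intro h; rw [mem_ledges_append, hY, mem_ledges_append Y1']; tauto
      rw [mem_ledges_append, mem_ledges_append, mem_ledges_append, mem_ledges_reverse, mem_ledges_reverse,
        mem_ledges_reverse] at he
      rcases he with he | ⟨he | ⟨he | he | ⟨x, x', hx, hx', rfl⟩⟩ | ⟨x, x', hx, hx', rfl⟩⟩ | ⟨x, x', hx, hx', rfl⟩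
      · exact Or.inl (old4 he)
      · exact Or.inl (old1 he)
      · exact Or.inl (old3 he)
      · exact Or.inl (old2 he)
      · left
        rw [List.getLast?_reverse] at hx
        rw [List.head?_reverse] at hx'
        rw [mem_ledges_append]
        right; right
        refine ⟨x', x, ?_, ?_, Sym2.eq_swap⟩
        · rw [hX, List.getLast?_append, hx']; rfl
        · rw [hY, List.head?_append, hx]; rfl
      · right; right
        rw [List.getLast?_reverse, e1] at hx
        rw [List.head?_append, List.head?_reverse, e4] at hx'
        simp at hx hx'
        rw [hx, hx']
      · right; left
        rw [e6] at hx
        rw [List.head?_append, List.head?_reverse, e2] at hx'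
        simp at hx hx'
        rw [hx, hx']
    · rcases hT with hT | hT
      · exact hT.trans ((List.prefix_append _ _).isInfix.trans (List.suffix_append _ _).isInfix)
      · exact hT.trans ((List.suffix_append _ _).trans ((List.suffix_append _ _).trans (List.suffix_append _ _))).isInfix
  have hn' : (P ++ Q).Nodup := by rw [hPQ]; exact hXn
  rcases majority I (fun x => x ∈ P) s hIs with hm | hm
  · obtain ⟨A, h1, h2⟩ := succs X w hXn hw (I.filter (fun x => x ∈ P))
      (fun z hz => hI z (Finset.mem_filter.1 hz).1) (fun h => hIl w hw (Finset.mem_filter.1 h).1)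
    refine ⟨Q.reverse, A, B, by simpa using hQ, hm.trans h1, hJs.trans hB1, fun a ha => ?_⟩
    obtain ⟨z, hz, X1, X2, h⟩ := h2 a ha
    rw [Finset.mem_filter] at hz
    apply rot a z X1 X2 _ hz.1 h
    right
    have := (cut_order (A := X1) (z := z) (B := a :: X2) hn' (by rw [hPQ, h])).1 hz.2
    exact (List.reverse_prefix.2 this).isInfix
  · obtain ⟨A, h1, h2⟩ := succs X w hXn hw (I.filter (fun x => ¬ x ∈ P))
      (fun z hz => hI z (Finset.mem_filter.1 hz).1) (fun h => hIl w hw (Finset.mem_filter.1 h).1)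
    refine ⟨P.reverse, A, B, by simpa using hP, hm.trans h1, hJs.trans hB1, fun a ha => ?_⟩
    obtain ⟨z, hz, X1, X2, h⟩ := h2 a ha
    rw [Finset.mem_filter] at hz
    have hzQ : z ∈ Q := by
      have := hI z hz.1
      rw [← hPQ, List.mem_append] at this
      exact this.resolve_left hz.2
    apply rot a z X1 X2 _ hz.1 h
    left
    have := (cut_order (A := X1) (z := z) (B := a :: X2) hn' (by rw [hPQ, h])).2 hzQ
    exact (List.reverse_suffix.2 (this.trans (List.prefix_append _ _))).isInfix

end step

section step2
variable {V : Type*} [DecidableEq V]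

theorem median_cut (L : List V) (I : Finset V) (hI : ∀ z ∈ I, z ∈ L) (j : ℕ) (hj : j ≤ I.card) :
    ∃ X Y : List V, L = X ++ Y ∧ (I.filter (fun z => z ∈ X)).card = j := by
  let f : ℕ → ℕ := fun k => (I.filter (fun z => z ∈ L.take k)).card
  have hex : ∃ k, j ≤ f k := by
    refine ⟨L.length, ?_⟩
    simp only [f, List.take_length]
    rw [Finset.filter_true_of_mem hI]; exact hj
  have hstep : ∀ k, f (k + 1) ≤ f k + 1 := by
    intro k
    simp only [f]
    rw [List.take_add_one]
    cases h : L[k]? with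
    | none => simp
    | some x =>
      refine le_trans (Finset.card_le_card (t := insert x (I.filter (fun z => z ∈ L.take k))) ?_) (Finset.card_insert_le _ _)
      intro z hz
      simp only [Finset.mem_filter, List.mem_append, Option.toList_some, List.mem_singleton,
        Finset.mem_insert] at hz ⊢
      tauto
  have h1 := Nat.find_spec hex
  have h2 : f (Nat.find hex) ≤ j := by
    cases h : Nat.find hex with
    | zero => simp [f]
    | succ k =>
      have := Nat.find_min hex (m := k) (by omega)
      have := hstep k
      omega
  exact ⟨L.take (Nat.find hex), L.drop (Nat.find hex), by simp, le_antisymm h2 h1⟩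

theorem case1_both (X Y : List V) (b y : V) (I J : Finset V) (s : ℕ)
    (hn : (X ++ Y).Nodup) (hX : X ≠ []) (hY : Y ≠ []) (hIJ : Disjoint I J) (hJY : ∀ x ∈ J, x ∉ Y) (hIX : ∀ x ∈ I, x ∉ X)
    (h1 : OneSide X b J s (X.length / 2)) (h2 : OneSide Y.reverse y I s (Y.reverse.length / 2)) :
    Ends (X ++ Y) b y I J s ((X ++ Y).length / 4) := by
  rcases le_total Y.length X.length with h | h
  · exact (case1 X Y b y I J s _ _ hn hX hY hIJ hJY hIX h1 h2).mono (by simp; omega)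
  · apply Ends.symm
    rw [List.reverse_append]
    refine (case1 Y.reverse X.reverse y b J I s _ _ ?_ (by simpa using hY) (by simpa using hX) hIJ.symm
      (by simpa using hIX) (by simpa using hJY) h2 (by rw [List.reverse_reverse]; exact h1)).mono (by simp; omega)
    rw [← List.reverse_append]; exact List.nodup_reverse.2 hn

theorem case2_both (X Y : List V) (b y : V) (I J : Finset V) (s : ℕ)
    (hn : (X ++ Y).Nodup) (hb : X.head? = some b) (hy : Y.getLast? = some y)
    (hI : ∀ x ∈ I, x ∈ X) (hJ : ∀ x ∈ J, x ∈ Y) (hIl : ∀ x, X.getLast? = some x → x ∉ I) (hJl : y ∉ J)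
    (hJh : ∀ x, Y.head? = some x → x ∉ J) (hIh : b ∉ I)
    (hIs : 2 * s ≤ I.card) (hJs : 2 * s ≤ J.card) : Ends (X ++ Y) b y I J s ((X ++ Y).length / 4) := by
  rcases le_total Y.length X.length with h | h
  · exact (case2 X Y b y I J s hn hb hy hI hJ hIl hJl hIs (by omega)).mono (by simp; omega)
  · apply Ends.symm
    rw [List.reverse_append]
    refine (case2 Y.reverse X.reverse y b J I s ?_ (by rw [List.head?_reverse]; exact hy)
      (by rw [List.getLast?_reverse]; exact hb) (by simpa using hJ) (by simpa using hI)
      (by intro x hx; rw [List.getLast?_reverse] at hx; exact hJh x hx) hIh hJs (by omega)).mono (by simp; omega)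
    rw [← List.reverse_append]; exact List.nodup_reverse.2 hn

theorem exists_ends (L : List V) (b y : V) (hL : L.Nodup) (hb : L.head? = some b) (hy : L.getLast? = some y)
    (hby : b ≠ y) (Ny Nb : Finset V) (hNy : y ∉ Ny) (hNb : b ∉ Nb) (s : ℕ)
    (h1 : 6 * s + 3 ≤ Ny.card) (h2 : 6 * s + 3 ≤ Nb.card) :
    ∃ I ⊆ Ny, ∃ J ⊆ Nb, Ends L b y I J s (L.length / 4) := by
  obtain ⟨M, hM⟩ : ∃ M, L = b :: (M ++ [y]) := by
    cases L with
    | nil => simp at hb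
    | cons x L =>
      simp at hb
      subst hb
      rcases L.eq_nil_or_concat with rfl | ⟨M, z, rfl⟩
      · simp at hy; exact absurd hy hby
      · refine ⟨M, ?_⟩
        rw [List.concat_eq_append, ← List.cons_append, List.getLast?_concat] at hy
        simp at hy
        simp [hy]
  have hM1 : L = (b :: M) ++ [y] := by simp [hM]
  have hM2 : L = [b] ++ (M ++ [y]) := by simp [hM]
  have hyin := Finset.card_filter_add_card_filter_not (s := Ny) (fun x => x ∈ L)
  have hbin := Finset.card_filter_add_card_filter_not (s := Nb) (fun x => x ∈ L)
  set Yi := Ny.filter (fun x => x ∈ L) with hYi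
  set Yo := Ny.filter (fun x => ¬ x ∈ L) with hYo
  set Bi := Nb.filter (fun x => x ∈ L) with hBi
  set Bo := Nb.filter (fun x => ¬ x ∈ L) with hBo
  have mYi : ∀ x ∈ Yi, x ∈ Ny ∧ x ∈ L := fun x hx => Finset.mem_filter.1 hx
  have mYo : ∀ x ∈ Yo, x ∈ Ny ∧ x ∉ L := fun x hx => Finset.mem_filter.1 hx
  have mBi : ∀ x ∈ Bi, x ∈ Nb ∧ x ∈ L := fun x hx => Finset.mem_filter.1 hx
  have mBo : ∀ x ∈ Bo, x ∈ Nb ∧ x ∉ L := fun x hx => Finset.mem_filter.1 hx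
  have n1 : (b :: M).Nodup := by rw [hM1] at hL; exact (List.nodup_append.1 hL).1
  have n2 : (M ++ [y]).Nodup := by rw [hM2] at hL; exact (List.nodup_append.1 hL).2.1
  by_cases hyo : 2 * s ≤ Yo.card
  · by_cases hbo : 2 * s ≤ Bo.card
    · -- both outside
      obtain ⟨J, hJ1, hJ2⟩ := Finset.exists_subset_card_eq (show s ≤ Bo.card by omega)
      have hI := Finset.le_card_sdiff J Yo
      refine ⟨Yo \ J, fun x hx => (mYo x (Finset.mem_sdiff.1 hx).1).1, J, fun x hx => (mBo x (hJ1 hx)).1, ?_⟩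
      have oI : ∀ x ∈ Yo \ J, x ∉ L := fun x hx => (mYo x (Finset.mem_sdiff.1 hx).1).2
      have oJ : ∀ x ∈ J, x ∉ L := fun x hx => (mBo x (hJ1 hx)).2
      rw [hM1] at hL oI oJ ⊢
      refine case1_both (b :: M) [y] b y _ J s hL (by simp) (by simp) Finset.sdiff_disjoint
        (fun x hx h => oJ x hx (List.mem_append_right _ h)) (fun x hx h => oI x hx (List.mem_append_left _ h))
        (oneSide_out _ b n1 (by simp) J (fun x hx h => oJ x hx (List.mem_append_left _ h)) s hJ2.ge)
        (oneSide_out _ y (by simp) (by simp) _ (fun x hx h => oI x hx (List.mem_append_right _ (by simpa using h))) s (by omega))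
    · -- y out, b in
      have hJc : 2 * s ≤ (Bi.erase y).card := by
        have := Finset.pred_card_le_card_erase (s := Bi) (a := y); omega
      have oI : ∀ x ∈ Yo, x ∉ L := fun x hx => (mYo x hx).2
      have oJ : ∀ x ∈ Bi.erase y, x ∈ b :: M := by
        intro x hx
        rw [Finset.mem_erase] at hx
        have := (mBi x hx.2).2
        rw [hM1, List.mem_append] at this
        exact this.resolve_right (by simpa using hx.1)
      refine ⟨Yo, fun x hx => (mYo x hx).1, Bi.erase y, fun x hx => (mBi x (Finset.mem_erase.1 hx).2).1, ?_⟩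
      have hd : Disjoint Yo (Bi.erase y) := by
        rw [Finset.disjoint_left]
        intro x hx hx'
        exact (mYo x hx).2 (mBi x (Finset.mem_erase.1 hx').2).2
      rw [hM1] at hL oI ⊢
      exact case1_both (b :: M) [y] b y _ _ s hL (by simp) (by simp) hd
        (fun x hx h => by simp at h; exact (Finset.mem_erase.1 hx).1 h)
        (fun x hx h => oI x hx (List.mem_append_left _ h))
        (oneSide_in _ b n1 (by simp) _ oJ (fun h => hNb (mBi b (Finset.mem_erase.1 h).2).1) s hJc)
        (oneSide_out _ y (by simp) (by simp) _ (fun x hx h => oI x hx (List.mem_append_right _ (by simpa using h))) s (by omega))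
  · by_cases hbo : 2 * s ≤ Bo.card
    · have hIc : 2 * s ≤ (Yi.erase b).card := by
        have := Finset.pred_card_le_card_erase (s := Yi) (a := b); omega
      have oJ : ∀ x ∈ Bo, x ∉ L := fun x hx => (mBo x hx).2
      have oI : ∀ x ∈ Yi.erase b, x ∈ M ++ [y] := by
        intro x hx
        rw [Finset.mem_erase] at hx
        have := (mYi x hx.2).2
        rw [hM2, List.mem_append] at this
        exact this.resolve_left (by simpa using hx.1)
      refine ⟨Yi.erase b, fun x hx => (mYi x (Finset.mem_erase.1 hx).2).1, Bo, fun x hx => (mBo x hx).1, ?_⟩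
      have hd : Disjoint (Yi.erase b) Bo := by
        rw [Finset.disjoint_left]
        intro x hx hx'
        exact (mBo x hx').2 (mYi x (Finset.mem_erase.1 hx).2).2
      rw [hM2] at hL oJ ⊢
      exact case1_both [b] (M ++ [y]) b y _ _ s hL (by simp) (by simp) hd
        (fun x hx h => oJ x hx (List.mem_append_right _ h))
        (fun x hx h => by simp at h; exact (Finset.mem_erase.1 hx).1 h)
        (oneSide_out _ b (by simp) (by simp) _ (fun x hx h => oJ x hx (List.mem_append_left _ h)) s (by omega))
        (oneSide_in _ y (List.nodup_reverse.2 n2) (by simp) _ (fun x hx => List.mem_reverse.2 (oI x hx))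
          (fun h => hNy (mYi y (Finset.mem_erase.1 h).2).1) s hIc)
    · -- both inside
      have hIc : 4 * s + 2 ≤ (Yi.erase b).card := by
        have := Finset.pred_card_le_card_erase (s := Yi) (a := b); omega
      have hJc : 4 * s + 2 ≤ (Bi.erase y).card := by
        have := Finset.pred_card_le_card_erase (s := Bi) (a := y); omega
      set I0 := Yi.erase b with hI0
      set J0 := Bi.erase y with hJ0
      have mI0 : ∀ x ∈ I0, x ≠ b ∧ x ∈ Ny ∧ x ∈ L := fun x hx => ⟨(Finset.mem_erase.1 hx).1, mYi x (Finset.mem_erase.1 hx).2⟩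
      have mJ0 : ∀ x ∈ J0, x ≠ y ∧ x ∈ Nb ∧ x ∈ L := fun x hx => ⟨(Finset.mem_erase.1 hx).1, mBi x (Finset.mem_erase.1 hx).2⟩
      obtain ⟨X, Y, hXY, hcut⟩ := median_cut L I0 (fun z hz => (mI0 z hz).2.2) (2 * s + 1) (by omega)
      have hsum := Finset.card_filter_add_card_filter_not (s := I0) (fun x => x ∈ X)
      have hX : X ≠ [] := by
        rintro rfl
        simp at hcut
      have hY : Y ≠ [] := by
        rintro rfl
        have : I0.filter (fun x => ¬ x ∈ X) = ∅ := by
          apply Finset.filter_false_of_mem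
          intro x hx
          have := (mI0 x hx).2.2
          rw [hXY] at this
          simpa using this
        rw [this] at hsum
        simp at hsum
        omega
      have hbX : X.head? = some b := by
        rw [hXY] at hb
        cases X with
        | nil => exact absurd rfl hX
        | cons x X => simpa using hb
      have hyY : Y.getLast? = some y := by
        rw [hXY, List.getLast?_append_of_ne_nil _ hY] at hy; exact hy
      have hn := hL
      rw [hXY] at hn
      have hdis : ∀ x, x ∈ X → x ∈ Y → False := fun x hx hy => (List.nodup_append.1 hn).2.2 x hx x hy rfl
      have mL : ∀ x, x ∈ L → x ∉ X → x ∈ Y := by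
        intro x hx hx'
        rw [hXY, List.mem_append] at hx
        exact hx.resolve_left hx'
      rcases majority J0 (fun x => x ∈ X) (2 * s + 1) (by omega) with hm | hm
      · refine ⟨I0.filter (fun x => ¬ x ∈ X), fun x hx => (mI0 x (Finset.mem_filter.1 hx).1).2.1,
          J0.filter (fun x => x ∈ X), fun x hx => (mJ0 x (Finset.mem_filter.1 hx).1).2.1, ?_⟩
        rw [hXY]
        refine case1_both X Y b y _ _ s hn hX hY ?_ ?_ ?_ ?_ ?_
        · rw [Finset.disjoint_left]
          intro x hx hx'
          exact (Finset.mem_filter.1 hx).2 (Finset.mem_filter.1 hx').2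
        · intro x hx h
          exact hdis x (Finset.mem_filter.1 hx).2 h
        · intro x hx h
          exact (Finset.mem_filter.1 hx).2 h
        · refine oneSide_in X b (List.nodup_append.1 hn).1 hbX _ (fun x hx => (Finset.mem_filter.1 hx).2) ?_ s
            (le_trans (Nat.le_succ _) hm)
          intro h
          exact hNb (mJ0 b (Finset.mem_filter.1 h).1).2.1
        · refine oneSide_in Y.reverse y (List.nodup_reverse.2 (List.nodup_append.1 hn).2.1)
            (by rw [List.head?_reverse]; exact hyY) _ ?_ ?_ s (by omega)
          · intro x hx
            rw [List.mem_reverse]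
            exact mL x (mI0 x (Finset.mem_filter.1 hx).1).2.2 (Finset.mem_filter.1 hx).2
          · intro h
            exact hNy (mI0 y (Finset.mem_filter.1 h).1).2.1
      · obtain ⟨w, hw⟩ : ∃ w, X.getLast? = some w := ⟨_, List.getLast?_eq_some_getLast hX⟩
        obtain ⟨w', hw'⟩ : ∃ w', Y.head? = some w' := ⟨_, List.head?_eq_some_head hY⟩
        refine ⟨(I0.filter (fun x => x ∈ X)).erase w,
          fun x hx => (mI0 x (Finset.mem_filter.1 (Finset.mem_erase.1 hx).2).1).2.1,
          (J0.filter (fun x => ¬ x ∈ X)).erase w',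
          fun x hx => (mJ0 x (Finset.mem_filter.1 (Finset.mem_erase.1 hx).2).1).2.1, ?_⟩
        rw [hXY]
        have c1 := Finset.pred_card_le_card_erase (s := I0.filter (fun x => x ∈ X)) (a := w)
        have c2 := Finset.pred_card_le_card_erase (s := J0.filter (fun x => ¬ x ∈ X)) (a := w')
        refine case2_both X Y b y _ _ s hn hbX hyY ?_ ?_ ?_ ?_ ?_ ?_ (by omega) (by omega)
        · intro x hx; exact (Finset.mem_filter.1 (Finset.mem_erase.1 hx).2).2
        · intro x hx
          have := Finset.mem_filter.1 (Finset.mem_erase.1 hx).2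
          exact mL x (mJ0 x this.1).2.2 this.2
        · intro x hx h
          rw [hw] at hx
          simp at hx
          exact (Finset.mem_erase.1 h).1 hx.symm
        · intro h
          exact (mJ0 y (Finset.mem_filter.1 (Finset.mem_erase.1 h).2).1).1 rfl
        · intro x hx h
          rw [hw'] at hx
          simp at hx
          exact (Finset.mem_erase.1 h).1 hx.symm
        · intro h
          exact (mI0 b (Finset.mem_filter.1 (Finset.mem_erase.1 h).2).1).1 rfl

end step2

section step3
variable {V : Type*} [Fintype V] [DecidableEq V]

theorem cedges_eq {L : List V} {x : V} (h : L.head? = some x) : cedges L = ledges (L ++ [x]) := by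
  cases L with
  | nil => simp at h
  | cons a l => simp at h; subst h; rfl

theorem consec_aux (p q : V → Bool) : ∀ T : List V,
    (∀ T1 x y T2, T = T1 ++ x :: y :: T2 → p x = true ∨ q y = true) →
    T.length ≤ 1 + T.countP p + T.tail.countP q := by
  intro T
  induction T with
  | nil => intro _; simp
  | cons x T ih =>
    intro h
    cases T with
    | nil => simp
    | cons y T =>
      have h1 := ih (by
        intro T1 a b T2 e
        exact h (x :: T1) a b T2 (by rw [e]; rfl))
      have h2 := h [] x y T rfl
      simp only [List.tail_cons, List.countP_cons, List.length_cons] at h1 ⊢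
      rcases h2 with h2 | h2 <;> simp only [h2, if_true] <;> omega

theorem consec (T : List V) (hT : T.Nodup) (p q : V → Prop) (m : ℕ)
    (hp : ∀ Z : Finset V, (∀ x ∈ Z, ¬ p x) → Z.card ≤ m) (hq : ∀ Z : Finset V, (∀ x ∈ Z, ¬ q x) → Z.card ≤ m)
    (hl : 2 * m + 2 ≤ T.length) : ∃ T1 x y T2, T = T1 ++ x :: y :: T2 ∧ p x ∧ q y := by
  classical
  by_contra hcon
  push Not at hcon
  have h1 := consec_aux (fun x => decide (¬ p x)) (fun x => decide (¬ q x)) T (by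
    intro T1 x y T2 h
    have := hcon T1 x y T2 h
    simp only [decide_eq_true_eq]
    tauto)
  have h2 : ∀ r : V → Prop, (∀ Z : Finset V, (∀ x ∈ Z, ¬ r x) → Z.card ≤ m) →
      T.countP (fun x => decide (¬ r x)) ≤ m := by
    intro r hr
    rw [List.countP_eq_length_filter, ← List.toFinset_card_of_nodup (hT.filter _)]
    apply hr
    intro x hx
    simp at hx
    exact hx.2
  have h3 := h2 p hp
  have h4 := h2 q hq
  have h5 : T.tail.countP (fun x => decide (¬ q x)) ≤ T.countP (fun x => decide (¬ q x)) :=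
    (List.tail_sublist T).countP_le
  omega

theorem fresh_nbrs (c : Sym2 V → ℕ) (τ : ℕ → ℕ) (u h w : ℕ)
    (hA1 : ∀ i < 4, ∀ (v : V) (U : Finset ℕ), U.card ≤ h → ∃ w, w ≠ v ∧ τ (c s(v, w)) = i ∧ c s(v, w) ∉ U)
    (hh : u + w ≤ h) (i : ℕ) (hi : i < 4) (v : V) (U : Finset ℕ) (hU : U.card ≤ u) :
    ∃ N : Finset V, w ≤ N.card ∧ ∀ x ∈ N, x ≠ v ∧ τ (c s(v, x)) = i ∧ c s(v, x) ∉ U := by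
  classical
  refine ⟨univ.filter (fun x => x ≠ v ∧ τ (c s(v, x)) = i ∧ c s(v, x) ∉ U), ?_, fun x hx => (Finset.mem_filter.1 hx).2⟩
  by_contra hcon
  set N := univ.filter (fun x => x ≠ v ∧ τ (c s(v, x)) = i ∧ c s(v, x) ∉ U) with hN
  obtain ⟨x, h1, h2, h3⟩ := hA1 i hi v (U ∪ N.image (fun x => c s(v, x))) (by
    have a1 := Finset.card_union_le U (N.image (fun x => c s(v, x)))
    have a2 := Finset.card_image_le (s := N) (f := fun x => c s(v, x))
    omega)
  rw [Finset.mem_union, not_or] at h3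
  apply h3.2
  rw [Finset.mem_image]
  exact ⟨x, Finset.mem_filter.2 ⟨Finset.mem_univ _, h1, h2, h3.1⟩, rfl⟩

theorem step_lemma (c : Sym2 V → ℕ) (τ : ℕ → ℕ) (s u h m0 m : ℕ)
    (hA1 : ∀ i < 4, ∀ (v : V) (U : Finset ℕ), U.card ≤ h → ∃ w, w ≠ v ∧ τ (c s(v, w)) = i ∧ c s(v, w) ∉ U)
    (hexp : ∀ i < 4, ∀ (A Z : Finset V) (U : Finset ℕ), s ≤ A.card → m < Z.card →
      U.card ≤ u → ∃ a ∈ A, ∃ z ∈ Z, a ≠ z ∧ τ (c s(a, z)) = i ∧ c s(a, z) ∉ U)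
    (hs : 1 ≤ s) (hh : u + (6 * s + 3) ≤ h) (hm0 : 2 * m + 2 ≤ m0 / 4)
    (L : List V) (U : Finset ℕ) (hL : L.Nodup) (hLm : m0 ≤ L.length) (hU : U.card ≤ u) :
      ∃ (L' : List V) (N : Finset (Sym2 V)), L'.Nodup ∧ L.length ≤ L'.length ∧ N.card ≤ 4 ∧
        (∀ e ∈ cedges L', e ∈ ledges L ∨ e ∈ N) ∧ (∀ e ∈ N, c e ∉ U ∧ τ (c e) < 4) ∧
        (∀ e ∈ N, ∀ e' ∈ N, c e = c e' → e = e') := by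
  have hlen : 2 ≤ L.length := by omega
  obtain ⟨b, y, hb, hy, hby⟩ : ∃ b y, L.head? = some b ∧ L.getLast? = some y ∧ b ≠ y := by
    match L, hL, hlen with
    | x :: z :: l, hL, _ =>
      refine ⟨x, (z :: l).getLast (by simp), by simp, ?_, ?_⟩
      · rw [List.getLast?_cons_cons, List.getLast?_eq_some_getLast]
      · intro h
        apply (List.nodup_cons.1 hL).1
        rw [h]
        exact List.getLast_mem _
  obtain ⟨Ny, y1, y2⟩ := fresh_nbrs c τ u h (6 * s + 3) hA1 hh 0 (by norm_num) y U hU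
  obtain ⟨Nb, b1, b2⟩ := fresh_nbrs c τ u h (6 * s + 3) hA1 hh 1 (by norm_num) b U hU
  obtain ⟨I, hI, J, hJ, T, A, B, hT, hA, hB, hAB⟩ := exists_ends L b y hL hb hy hby Ny Nb
    (fun h => (y2 y h).1 rfl) (fun h => (b2 b h).1 rfl) s y1 b1
  have hTn : T.Nodup := by
    obtain ⟨a, ha⟩ := Finset.card_pos.1 (lt_of_lt_of_le hs hA)
    obtain ⟨b', hb'⟩ := Finset.card_pos.1 (lt_of_lt_of_le hs hB)
    obtain ⟨R, zi, zj, r1, r2, r3, r4, r5, r6, r7, r8⟩ := hAB a ha b' hb'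
    exact r3.sublist r8.sublist
  obtain ⟨T1, p, q, T2, hTe, ⟨a, ha, hap, ta, fa⟩, ⟨b', hb', hbq, tb, fb⟩⟩ := consec T hTn
    (fun x => ∃ a ∈ A, a ≠ x ∧ τ (c s(a, x)) = 2 ∧ c s(a, x) ∉ U)
    (fun x => ∃ a ∈ B, a ≠ x ∧ τ (c s(a, x)) = 3 ∧ c s(a, x) ∉ U) m
    (by
      intro Z hZ
      by_contra hlt
      obtain ⟨a, ha, z, hz, h⟩ := hexp 2 (by norm_num) A Z U hA (by omega) hU
      exact hZ z hz ⟨a, ha, h⟩)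
    (by
      intro Z hZ
      by_contra hlt
      obtain ⟨a, ha, z, hz, h⟩ := hexp 3 (by norm_num) B Z U hB (by omega) hU
      exact hZ z hz ⟨a, ha, h⟩)
    (by omega)
  obtain ⟨R, zi, zj, r1, r2, r3, r4, r5, r6, r7, ⟨Q1, Q2, r8⟩⟩ := hAB a ha b' hb'
  obtain ⟨R1, R2, hR⟩ : ∃ R1 R2, R = (R1 ++ [p]) ++ (q :: R2) :=
    ⟨Q1 ++ T1, T2 ++ Q2, by rw [← r8, hTe]; simp⟩
  have hperm : ((R1 ++ [p]) ++ (q :: R2).reverse).Perm R := by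
    rw [hR]; exact List.Perm.append_left _ (List.reverse_perm _)
  have hhead : (R1 ++ [p]).head? = some b' := by
    rw [← r5, hR]; cases R1 <;> simp
  have hlast : (q :: R2).getLast? = some a := by
    rw [← r6, hR, List.getLast?_append_of_ne_nil _ (by simp)]
  have i1 := y2 zi (hI r1)
  have i2 := b2 zj (hJ r2)
  refine ⟨(R1 ++ [p]) ++ (q :: R2).reverse, {s(y, zi), s(b, zj), s(a, p), s(b', q)}, hperm.nodup_iff.2 r3,
    r4.trans hperm.length_eq.ge, Finset.card_le_four, ?_, ?_, ?_⟩
  · intro e he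
    have key : e ∈ ledges R ∨ e = s(a, p) ∨ e = s(b', q) := by
      rw [cedges_eq (x := b') (by rw [List.head?_append, hhead]; rfl), mem_ledges_append, mem_ledges_append,
        mem_ledges_reverse] at he
      rw [hR, mem_ledges_append]
      rcases he with (he | he | ⟨x, x', hx, hx', rfl⟩) | he | ⟨x, x', hx, hx', rfl⟩
      · exact Or.inl (Or.inl he)
      · exact Or.inl (Or.inr (Or.inl he))
      · right; left
        rw [List.getLast?_concat] at hx
        rw [List.head?_reverse, hlast] at hx'
        simp at hx hx'
        rw [hx, hx', Sym2.eq_swap]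
      · simp at he
      · right; right
        rw [List.getLast?_append, List.getLast?_reverse] at hx
        simp at hx hx'
        rw [hx, hx', Sym2.eq_swap]
    simp only [Finset.mem_insert, Finset.mem_singleton]
    rcases key with h | h | h
    · have := r7 e h; tauto
    · tauto
    · tauto
  · intro e he
    simp only [Finset.mem_insert, Finset.mem_singleton] at he
    rcases he with rfl | rfl | rfl | rfl
    · exact ⟨i1.2.2, by rw [i1.2.1]; norm_num⟩
    · exact ⟨i2.2.2, by rw [i2.2.1]; norm_num⟩
    · exact ⟨fa, by rw [ta]; norm_num⟩
    · exact ⟨fb, by rw [tb]; norm_num⟩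
  · have t1 := i1.2.1
    have t2 := i2.2.1
    intro e he e' he' hcc
    simp only [Finset.mem_insert, Finset.mem_singleton] at he he'
    have hττ := congrArg τ hcc
    rcases he with rfl | rfl | rfl | rfl <;> rcases he' with rfl | rfl | rfl | rfl <;>
      first
      | rfl
      | (exfalso; simp only [t1, t2, ta, tb] at hττ; omega)

end step3

section finish

theorem assembly {V : Type*} [Fintype V] [DecidableEq V] (c : Sym2 V → ℕ) [Nonempty V]
    (hc : ∀ u v w : V, u ≠ v → u ≠ w → v ≠ w → c s(u, v) ≠ c s(u, w))
    (k g s h N q D m0 : ℕ) (hq : 5 ≤ q) (hN1 : 2 * N + 2 * (4 * k) ≤ s * s)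
    (hN2 : N + h + 1 ≤ Fintype.card V)
    (hprob : 4 * (((Fintype.card V : ℝ)) ^ (2 * s + 2 * (4 * k)) + (Fintype.card V : ℝ) ^ (1 + 2 * h)) *
        (1 - 1 / (q : ℝ)) ^ N +
      (Fintype.card V : ℝ) * ((1 / 2 : ℝ) ^ D * (1 + 4 / (q : ℝ)) ^ (Fintype.card V)) < 1)
    (hk : k ≤ Fintype.card V) (hg : Fintype.card V < k * g) (hs : 1 ≤ s)
    (hh : 4 * k + (6 * s + 3) ≤ h) (hm0 : 2 * ((2 * s + 2) * s) + 2 ≤ m0 / 4)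
    (hm : m0 + D + g + 1 ≤ Fintype.card V) :
    ∃ (v : V) (w : (⊤ : SimpleGraph V).Walk v v),
        w.IsCycle ∧ (w.edges.map c).Nodup ∧ Fintype.card V ≤ w.length + D + g + 1 := by
  obtain ⟨τ, hA1, hA2, hA3⟩ := palettes c hc s (4 * k) h N q D hq hN1 hN2 hprob
  obtain ⟨L, B, hL, hlen, hB, h1, h2⟩ :=
    exists_almost_cycle c (fun e => 4 ≤ τ (c e)) hc k D g hk hg hA3
  obtain ⟨L', n', l', i'⟩ := iterate c τ (4 * k) m0 (by omega)
    (fun L U hL hLm hU => step_lemma c τ s (4 * k) h m0 ((2 * s + 2) * s) hA1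
      (fun i hi A Z U hA hZ hU => expansion c hc τ s (4 * k) hA2 i hi A Z U hA hZ.le hU)
      hs hh hm0 L U hL hLm hU) k L B ∅ hB (by simp) hL (by omega)
      (fun e he he' => Or.inl (h1 e he he')) h2
  obtain ⟨v, w, w1, w2, w3⟩ := exists_cycle c L' n' (by omega) i'
  exact ⟨v, w, w1, w2, by omega⟩

theorem prob_bound (n r l s K N q D : ℕ) (hl : n < 2 ^ l) (hl1 : 1 ≤ l) (hr : 10 ≤ r)
    (hs : 2 * s + 8 * r ≤ 1 + 18 * r) (hn : 1 ≤ n)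
    (hK : K = 20 * (r * l) + 2) (hq : q = N / K) (hq5 : 5 ≤ q) (hN : n ≤ 400 * N)
    (hD : D = 6400 * K + l + 2) :
    4 * ((n : ℝ) ^ (2 * s + 2 * (4 * r)) + (n : ℝ) ^ (1 + 2 * (9 * r))) *
        (1 - 1 / (q : ℝ)) ^ N +
      (n : ℝ) * ((1 / 2 : ℝ) ^ D * (1 + 4 / (q : ℝ)) ^ n) < 1 := by
  have hqK : q * K ≤ N := by rw [hq]; exact Nat.div_mul_le_self N K
  have hqK2 : N ≤ 2 * q * K := by
    have h := Nat.lt_div_mul_add (a := N) (b := K) (by omega)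
    rw [← hq] at h
    nlinarith
  have q0 : (0 : ℝ) < q := by exact_mod_cast (by omega : 0 < q)
  have q5 : (5 : ℝ) ≤ q := by exact_mod_cast hq5
  have e1 : (n : ℝ) ≤ 2 ^ l := by exact_mod_cast hl.le
  have n1 : (1 : ℝ) ≤ n := by exact_mod_cast hn
  have p1 : (n : ℝ) ^ (1 + 2 * (9 * r)) ≤ 2 ^ (l * (1 + 2 * (9 * r))) := by
    rw [pow_mul]; gcongr
  have p2 : (n : ℝ) ^ (2 * s + 2 * (4 * r)) ≤ 2 ^ (l * (1 + 2 * (9 * r))) :=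
    le_trans (pow_le_pow_right₀ n1 (by omega)) p1
  have p3 : (1 - 1 / (q : ℝ)) ^ N ≤ (1 / 2) ^ K := by
    have a0 : 0 ≤ 1 - 1 / (q : ℝ) := by
      rw [sub_nonneg, div_le_one q0]; linarith
    have a1 : (1 - 1 / (q : ℝ)) ^ q ≤ 1 / 2 := by
      have : (1 - 1 / (q : ℝ)) ≤ Real.exp (-(1 / q)) := by
        have := Real.add_one_le_exp (-(1 / (q : ℝ))); linarith
      calc (1 - 1 / (q : ℝ)) ^ q ≤ (Real.exp (-(1 / q))) ^ q := by gcongr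
        _ = Real.exp (-1) := by
          rw [← Real.exp_nat_mul]; congr 1; field_simp
        _ ≤ 1 / 2 := by
          rw [Real.exp_neg, ← one_div]
          have := Real.add_one_le_exp 1
          exact one_div_le_one_div_of_le (by norm_num) (by linarith)
    calc (1 - 1 / (q : ℝ)) ^ N ≤ (1 - 1 / (q : ℝ)) ^ (q * K) :=
          pow_le_pow_of_le_one a0 (by have : 0 < 1 / (q : ℝ) := by positivity
                                      linarith) hqK
      _ ≤ (1 / 2) ^ K := by rw [pow_mul]; gcongr
  have p4 : (1 + 4 / (q : ℝ)) ^ n ≤ 2 ^ (6400 * K) := by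
    have a1 : (1 + 4 / (q : ℝ)) ^ q ≤ 2 ^ 8 := by
      calc (1 + 4 / (q : ℝ)) ^ q ≤ (Real.exp (4 / q)) ^ q := by
            gcongr
            have := Real.add_one_le_exp (4 / (q : ℝ)); linarith
        _ = Real.exp 1 ^ 4 := by
          rw [← Real.exp_nat_mul, ← Real.exp_nat_mul]; congr 1; field_simp; norm_num
        _ ≤ 4 ^ 4 := by
          have := Real.exp_one_lt_d9
          gcongr
          linarith
        _ = 2 ^ 8 := by norm_num
    have b1 : 1 ≤ 1 + 4 / (q : ℝ) := by have : 0 < 4 / (q : ℝ) := by positivity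
                                        linarith
    calc (1 + 4 / (q : ℝ)) ^ n ≤ (1 + 4 / (q : ℝ)) ^ (q * (800 * K)) :=
          pow_le_pow_right₀ b1 (by nlinarith)
      _ ≤ (2 ^ 8) ^ (800 * K) := by rw [pow_mul]; gcongr
      _ = 2 ^ (6400 * K) := by rw [← pow_mul]; congr 1; ring
  have f1 : 4 * ((n : ℝ) ^ (2 * s + 2 * (4 * r)) + (n : ℝ) ^ (1 + 2 * (9 * r))) *
        (1 - 1 / (q : ℝ)) ^ N ≤ 1 / 4 := by
    have hE : l * (1 + 2 * (9 * r)) + 5 ≤ K := by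
      have e : l * (1 + 2 * (9 * r)) = l + 18 * (r * l) := by ring
      rw [e, hK]
      nlinarith
    calc _ ≤ 4 * ((2 : ℝ) ^ (l * (1 + 2 * (9 * r))) + 2 ^ (l * (1 + 2 * (9 * r)))) * (1 / 2) ^ K := by
            gcongr
            apply pow_nonneg
            rw [sub_nonneg, div_le_one q0]; linarith
      _ ≤ 4 * ((2 : ℝ) ^ (l * (1 + 2 * (9 * r))) + 2 ^ (l * (1 + 2 * (9 * r)))) * (1 / 2) ^ (l * (1 + 2 * (9 * r)) + 5) := by
            gcongr ?_ * ?_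
            exact pow_le_pow_of_le_one (by norm_num) (by norm_num) hE
      _ = 1 / 4 := by
            rw [pow_add, one_div_pow]
            field_simp
            norm_num
  have f2 : (n : ℝ) * ((1 / 2 : ℝ) ^ D * (1 + 4 / (q : ℝ)) ^ n) ≤ 1 / 4 := by
    calc _ ≤ (2 : ℝ) ^ l * ((1 / 2 : ℝ) ^ D * 2 ^ (6400 * K)) := by gcongr
      _ = 1 / 4 := by
        rw [hD, pow_add, pow_add, one_div_pow, one_div_pow]
        field_simp
        norm_num
  linarith

theorem main_fin (n r l : ℕ) (hr1 : r * r ≤ n) (hr2 : n < (r + 1) * (r + 1)) (hl : n < 2 ^ l)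
    (hl1 : 1 ≤ l) (hrl : 1000000 * l ≤ r) (c : Sym2 (Fin n) → ℕ)
    (hc : ∀ u v w : Fin n, u ≠ v → u ≠ w → v ≠ w → c s(u, v) ≠ c s(u, w)) :
    ∃ (v : Fin n) (w : (⊤ : SimpleGraph (Fin n)).Walk v v),
        w.IsCycle ∧ (w.edges.map c).Nodup ∧ n ≤ w.length + 200000 * (r * l) := by
  have hR : 1000000 * r ≤ r * r := by nlinarith
  have hRl : 1000000 * (r * l) ≤ r * r := by nlinarith
  have hrl' : r ≤ r * l := by nlinarith
  have hll : l ≤ r * l := by nlinarith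
  have : Nonempty (Fin n) := ⟨⟨0, by nlinarith⟩⟩
  set K := 20 * (r * l) + 2 with hK
  set N := n / 200 with hN
  set D := 6400 * K + l + 2 with hD
  obtain ⟨s, hs1, hs2⟩ : ∃ s, 8 * s ≤ r ∧ r < 8 * s + 8 := ⟨r / 8, by omega, by omega⟩
  have hr2' : n ≤ r * r + 2 * r := by nlinarith
  have hss1 : r * r ≤ 64 * (s * s) + 16 * r + 64 := by nlinarith
  have hss2 : 64 * (s * s) ≤ r * r := by nlinarith
  have hq5 : 5 ≤ N / K := by
    rw [Nat.le_div_iff_mul_le (by omega)]; omega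
  have hmm : (2 * s + 2) * s = 2 * (s * s) + 2 * s := by ring
  obtain ⟨v, w, w1, w2, w3⟩ := assembly c hc r (r + 3) s (9 * r) N (N / K) D (n / 2) hq5
    (by omega) (by simp; omega)
    (by
      have := prob_bound n r l s K N (N / K) D hl hl1 (by omega) (by omega) (by omega) hK rfl hq5
        (by omega) hD
      simpa only [Fintype.card_fin] using this)
    (by simp; omega) (by simp; nlinarith) (by omega) (by omega) (by rw [hmm]; omega)
    (by simp only [Fintype.card_fin]; omega)
  refine ⟨v, w, w1, w2, ?_⟩
  simp only [Fintype.card_fin] at w3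
  omega

theorem eventually_params : ∃ N : ℕ, ∀ n : ℕ, N ≤ n → 2 ≤ n ∧
    1000000 * (Nat.log 2 n + 1) ≤ Nat.sqrt n := by
  have h := (isLittleO_log_rpow_atTop (r := 1 / 2) (by norm_num)).comp_tendsto
    (tendsto_natCast_atTop_atTop (R := ℝ))
  have h1 := h.bound (c := 1 / 16000000) (by norm_num)
  have h2 : ∀ᶠ n : ℕ in Filter.atTop, 10 ^ 20 ≤ n := Filter.eventually_ge_atTop _
  obtain ⟨N, hN⟩ := Filter.eventually_atTop.1 (h1.and h2)
  refine ⟨N, fun n hn => ?_⟩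
  obtain ⟨a, b⟩ := hN n hn
  refine ⟨by omega, ?_⟩
  have b' : (10 ^ 20 : ℝ) ≤ n := by exact_mod_cast b
  have n0 : (0 : ℝ) < n := by linarith
  simp only [Function.comp_apply, Real.norm_eq_abs] at a
  rw [← Real.sqrt_eq_rpow, abs_of_nonneg (Real.sqrt_nonneg _)] at a
  have a2 := le_trans (le_abs_self _) a
  have hlog : ((Nat.log 2 n : ℕ) : ℝ) ≤ 2 * Real.log n := by
    have := Real.natLog_le_logb n 2
    refine this.trans ?_
    rw [Real.logb, div_le_iff₀ (Real.log_pos (by norm_num))]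
    have l2 := Real.log_two_gt_d9
    have ln : 0 ≤ Real.log n := Real.log_nonneg (by linarith)
    push_cast
    nlinarith
  have hs : Real.sqrt n ≤ Nat.sqrt n + 1 := by
    exact Real.real_sqrt_le_nat_sqrt_succ
  have hs' : (10 ^ 10 : ℝ) ≤ Real.sqrt n := Real.le_sqrt_of_sq_le (by linarith)
  have : (1000000 * (Nat.log 2 n + 1) : ℝ) ≤ Nat.sqrt n := by linarith
  exact_mod_cast this

end finish

end helpers

/-- There exists a constant `C` such that for all sufficiently large `n`, every properly
edge-colored complete graph on `n` vertices contains a rainbow cycle on at least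
`n - C * (log₂ n) * √n` vertices.  (A cycle is rainbow when the colors on its edges are
pairwise distinct; the number of vertices of a cycle equals its length.) -/
theorem long_rainbow_cycle :
    ∃ C : ℝ, ∃ N : ℕ, ∀ n : ℕ, N ≤ n → ∀ c : Sym2 (Fin n) → ℕ,
      IsProperEdgeColoring (⊤ : SimpleGraph (Fin n)) c →
      ∃ (v : Fin n) (w : (⊤ : SimpleGraph (Fin n)).Walk v v),
        w.IsCycle ∧ (w.edges.map c).Nodup ∧
        (n : ℝ) - C * Real.logb 2 n * Real.sqrt n ≤ (w.length : ℝ) := by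
  obtain ⟨N, hN⟩ := eventually_params
  refine ⟨400000, N, fun n hn c hc => ?_⟩
  obtain ⟨h2, hr⟩ := hN n hn
  obtain ⟨v, w, w1, w2, w3⟩ := main_fin n (Nat.sqrt n) (Nat.log 2 n + 1) (Nat.sqrt_le n)
    (Nat.lt_succ_sqrt n) (Nat.lt_pow_succ_log_self (by norm_num) n) (by omega) hr c (by
      intro u v w h1 h2 h3
      apply hc
      · simpa using h1
      · simpa using h2
      · intro h
        have h' : v = w ∨ u = w ∧ v = u := by simpa using h
        rcases h' with h' | h'
        · exact h3 h'
        · exact h2 h'.1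
      · exact ⟨u, by simp, by simp⟩)
  refine ⟨v, w, w1, w2, ?_⟩
  have w3' : (n : ℝ) ≤ w.length + 200000 * (Nat.sqrt n * (Nat.log 2 n + 1)) := by exact_mod_cast w3
  have a1 : ((Nat.sqrt n : ℕ) : ℝ) ≤ Real.sqrt n := Real.nat_sqrt_le_real_sqrt
  have a2 : ((Nat.log 2 n : ℕ) : ℝ) ≤ Real.logb 2 n := by
    exact_mod_cast Real.natLog_le_logb n 2
  have a3 : (1 : ℝ) ≤ Real.logb 2 n := by
    refine le_trans ?_ a2
    exact_mod_cast Nat.log_pos (by norm_num) h2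
  have a4 : ((Nat.sqrt n : ℕ) : ℝ) * (Nat.log 2 n + 1) ≤ Real.sqrt n * (2 * Real.logb 2 n) := by
    gcongr
    linarith
  linarith
end

section
/- For every sufficiently small ε > 0 there exists a constant C such that the following holds. Let G be a properly edge-colored graph on n vertices with minimum degree δ(G) ≥ (1 - δ)n for some δ = δ(n), and let H be the random spanning subgraph of G obtained by including every color class independently with probability p. Then with probability tending to 1 as n → ∞, for every pair of disjoint vertex sets A and B with |A| ≥ C (log n)/p and |B| ≥ max{ C ((log n)/p)^2, C δ n }, the number of edges of H with one endpoint in A and one endpoint in B is at least (1 - ε) p |A| |B|. -/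
open scoped Classical

/-- The spanning subgraph of `G` consisting of the color classes (w.r.t. the coloring `c`)
whose color lies in `S`. -/
noncomputable def colorSubgraph {V : Type*} (G : SimpleGraph V) (c : Sym2 V → ℕ)
    (S : Finset ℕ) : SimpleGraph V :=
  SimpleGraph.fromEdgeSet {e | e ∈ G.edgeSet ∧ c e ∈ S}

/-- `eBetween G A B` is the number of edges of `G` with one endpoint in `A` and the other
endpoint in `B`. -/
noncomputable def eBetween {V : Type*} (G : SimpleGraph V) (A B : Finset V) : ℕ :=
  {e : Sym2 V | e ∈ G.edgeSet ∧ ∃ u ∈ A, ∃ v ∈ B, e = s(u, v)}.ncard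

/-- The probability that the random spanning subgraph of `G` obtained by keeping every
color class independently with probability `p` satisfies the event `E` (an event is a
predicate on the set of chosen colors). -/
noncomputable def probEvent {V : Type*} [Fintype V] (G : SimpleGraph V) (c : Sym2 V → ℕ)
    (p : ℝ) (E : Finset ℕ → Prop) : ℝ :=
  ∑ S ∈ (G.edgeFinset.image c).powerset,
    (if E S then 1 else 0) * p ^ S.card * (1 - p) ^ ((G.edgeFinset.image c).card - S.card)


namespace RCS

/-- Total mass of the product weights. -/
lemma sum_weight (U : Finset ℕ) (p : ℝ) :
    ∑ S ∈ U.powerset, p ^ S.card * (1 - p) ^ (U.card - S.card) = 1 := by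
  have h := Finset.prod_add (fun _ : ℕ => p) (fun _ => 1 - p) U
  simp only [Finset.prod_const] at h
  rw [show p + (1 - p) = 1 by ring, one_pow] at h
  refine Eq.trans ?_ h.symm
  refine Finset.sum_congr rfl fun S hS => ?_
  rw [Finset.card_sdiff_of_subset (Finset.mem_powerset.1 hS)]

/-- Moment generating function bound. -/
lemma mgf_bound (U M : Finset ℕ) (hM : M ⊆ U) (p l : ℝ) (hp0 : 0 < p) (hp1 : p ≤ 1)
    (hl0 : 0 ≤ l) (hl1 : l ≤ 1) :
    ∑ S ∈ U.powerset, Real.exp (-l * ((S ∩ M).card : ℝ)) *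
      (p ^ S.card * (1 - p) ^ (U.card - S.card)) ≤
      Real.exp (-(p * M.card * (l - l ^ 2))) := by
  have h := Finset.prod_add (fun i : ℕ => p * (if i ∈ M then Real.exp (-l) else 1))
    (fun _ => 1 - p) U
  have h2 : ∑ S ∈ U.powerset, Real.exp (-l * ((S ∩ M).card : ℝ)) *
      (p ^ S.card * (1 - p) ^ (U.card - S.card)) =
      ∏ i ∈ U, (p * (if i ∈ M then Real.exp (-l) else 1) + (1 - p)) := by
    rw [h]
    refine Finset.sum_congr rfl fun S hS => ?_
    rw [Finset.prod_mul_distrib, Finset.prod_const, Finset.prod_const,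
      Finset.card_sdiff_of_subset (Finset.mem_powerset.1 hS), Finset.prod_ite_mem,
      Finset.prod_const, ← Real.exp_nat_mul]
    rw [mul_comm (-l)]
    ring
  rw [h2]
  have h3 : ∏ i ∈ U, (p * (if i ∈ M then Real.exp (-l) else 1) + (1 - p)) =
      ∏ i ∈ M, (p * Real.exp (-l) + (1 - p)) := by
    rw [← Finset.prod_subset hM]
    · refine Finset.prod_congr rfl fun i hi => ?_
      rw [if_pos hi]
    · intro i _ hi
      rw [if_neg hi]; ring
  rw [h3, Finset.prod_const]
  have h4 : p * Real.exp (-l) + (1 - p) ≤ Real.exp (-(p * (l - l ^ 2))) := by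
    have h5 : |Real.exp (-l) - 1 - (-l)| ≤ (-l) ^ 2 :=
      Real.abs_exp_sub_one_sub_id_le (by rw [abs_neg, abs_of_nonneg hl0]; exact hl1)
    have h6 := (abs_le.1 h5).2
    have h7 := Real.add_one_le_exp (-(p * (l - l ^ 2)))
    nlinarith
  have h8 : 0 ≤ p * Real.exp (-l) + (1 - p) := by
    have := Real.exp_pos (-l)
    have : 0 ≤ p * Real.exp (-l) := by positivity
    linarith
  calc _ ≤ (Real.exp (-(p * (l - l ^ 2)))) ^ M.card := pow_le_pow_left₀ h8 h4 _
    _ = _ := by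
      rw [← Real.exp_nat_mul]
      congr 1; ring

/-- Chernoff lower tail. -/
lemma chernoff (U M : Finset ℕ) (hM : M ⊆ U) (p ε K2 : ℝ) (hp0 : 0 < p) (hp1 : p ≤ 1)
    (hε0 : 0 < ε) (hε1 : ε ≤ 1) (hK : (M.card : ℝ) ≤ K2) :
    ∑ S ∈ U.powerset, (if ((S ∩ M).card : ℝ) < p * M.card - ε / 2 * p * K2 then (1 : ℝ) else 0) *
      (p ^ S.card * (1 - p) ^ (U.card - S.card)) ≤
      Real.exp (-(ε ^ 2 * p * K2 / 16)) := by
  have h := mgf_bound U M hM p (ε / 4) hp0 hp1 (by linarith) (by linarith)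
  set a := p * M.card - ε / 2 * p * K2 with ha
  have h1 : ∑ S ∈ U.powerset, (if ((S ∩ M).card : ℝ) < a then (1 : ℝ) else 0) *
      (p ^ S.card * (1 - p) ^ (U.card - S.card)) ≤
      Real.exp (ε / 4 * a) * ∑ S ∈ U.powerset, Real.exp (-(ε / 4) * ((S ∩ M).card : ℝ)) *
      (p ^ S.card * (1 - p) ^ (U.card - S.card)) := by
    rw [Finset.mul_sum]
    refine Finset.sum_le_sum fun S _ => ?_
    rw [← mul_assoc (Real.exp (ε / 4 * a))]
    have hw : 0 ≤ p ^ S.card * (1 - p) ^ (U.card - S.card) := by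
      have : 0 ≤ 1 - p := by linarith
      positivity
    refine mul_le_mul_of_nonneg_right ?_ hw
    split_ifs with hlt
    · rw [← Real.exp_add]
      refine Real.one_le_exp ?_
      nlinarith
    · positivity
  refine h1.trans ?_
  calc _ ≤ Real.exp (ε / 4 * a) * Real.exp (-(p * M.card * (ε / 4 - (ε / 4) ^ 2))) :=
        mul_le_mul_of_nonneg_left h (Real.exp_pos _).le
    _ ≤ _ := by
      rw [← Real.exp_add]
      refine Real.exp_le_exp.2 ?_
      rw [ha]
      have : 0 ≤ p * ε ^ 2 := by positivity
      nlinarith [mul_le_mul_of_nonneg_left hK this]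

/-- Union bound. -/
lemma union_bound {ι : Type*} [Fintype ι] (U : Finset ℕ) (M : ι → Finset ℕ) (hM : ∀ i, M i ⊆ U)
    (p ε K2 : ℝ) (hp0 : 0 < p) (hp1 : p ≤ 1)
    (hε0 : 0 < ε) (hε1 : ε ≤ 1) (hK : ∀ i, ((M i).card : ℝ) ≤ K2)
    (E : Finset ℕ → Prop)
    (hE : ∀ S, (∀ i, p * (M i).card - ε / 2 * p * K2 ≤ ((S ∩ M i).card : ℝ)) → E S) :
    1 - Fintype.card ι * Real.exp (-(ε ^ 2 * p * K2 / 16)) ≤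
      ∑ S ∈ U.powerset, (if E S then 1 else 0) * p ^ S.card * (1 - p) ^ (U.card - S.card) := by
  have h1 : ∑ i : ι, ∑ S ∈ U.powerset,
      (if ((S ∩ M i).card : ℝ) < p * (M i).card - ε / 2 * p * K2 then (1 : ℝ) else 0) *
      (p ^ S.card * (1 - p) ^ (U.card - S.card)) ≤
      Fintype.card ι * Real.exp (-(ε ^ 2 * p * K2 / 16)) := by
    calc _ ≤ ∑ i : ι, Real.exp (-(ε ^ 2 * p * K2 / 16)) :=
          Finset.sum_le_sum fun i _ => chernoff U (M i) (hM i) p ε K2 hp0 hp1 hε0 hε1 (hK i)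
      _ = _ := by simp
  rw [Finset.sum_comm] at h1
  have h2 := sum_weight U p
  have h3 : ∑ S ∈ U.powerset, p ^ S.card * (1 - p) ^ (U.card - S.card) ≤
      ∑ S ∈ U.powerset, ((if E S then 1 else 0) * p ^ S.card * (1 - p) ^ (U.card - S.card) +
       ∑ i : ι, 
      (if ((S ∩ M i).card : ℝ) < p * (M i).card - ε / 2 * p * K2 then (1 : ℝ) else 0) *
      (p ^ S.card * (1 - p) ^ (U.card - S.card))) := by
    refine Finset.sum_le_sum fun S _ => ?_
    have hw : 0 ≤ p ^ S.card * (1 - p) ^ (U.card - S.card) := by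
      have : 0 ≤ 1 - p := by linarith
      positivity
    have hnn : ∀ i ∈ (Finset.univ : Finset ι), 0 ≤ 
      (if ((S ∩ M i).card : ℝ) < p * (M i).card - ε / 2 * p * K2 then (1 : ℝ) else 0) *
      (p ^ S.card * (1 - p) ^ (U.card - S.card)) := by
      intro i _
      split_ifs <;> simp [hw]
    by_cases hES : E S
    · rw [if_pos hES, one_mul]
      have := Finset.sum_nonneg hnn
      linarith
    · have : ∃ i, ((S ∩ M i).card : ℝ) < p * (M i).card - ε / 2 * p * K2 := by
        by_contra hcon
        push Not at hcon
        exact hES (hE S hcon)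
      obtain ⟨i, hi⟩ := this
      have := Finset.single_le_sum hnn (Finset.mem_univ i)
      rw [if_pos hi, one_mul] at this
      rw [if_neg hES]
      linarith
  rw [Finset.sum_add_distrib, h2] at h3
  linarith

/-- Cardinality of image plus collisions. -/
lemma card_le_image_add {α : Type*} (T : Finset α) (φ : α → ℕ) :
    T.card ≤ (T.image φ).card +
      ((T ×ˢ T).filter fun q => q.1 ≠ q.2 ∧ φ q.1 = φ q.2).card := by
  induction T using Finset.induction_on with
  | empty => simp
  | insert x T hx ih =>
    rw [Finset.card_insert_of_notMem hx, Finset.image_insert]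
    have hsub : ((T ×ˢ T).filter fun q => q.1 ≠ q.2 ∧ φ q.1 = φ q.2) ⊆
        (((insert x T) ×ˢ (insert x T)).filter fun q => q.1 ≠ q.2 ∧ φ q.1 = φ q.2) := by
      intro q hq
      simp only [Finset.mem_filter, Finset.mem_product, Finset.mem_insert] at hq ⊢
      exact ⟨⟨Or.inr hq.1.1, Or.inr hq.1.2⟩, hq.2⟩
    by_cases h : φ x ∈ T.image φ
    · rw [Finset.insert_eq_of_mem h]
      obtain ⟨y, hy, hxy⟩ := Finset.mem_image.1 h
      have : ((T ×ˢ T).filter fun q => q.1 ≠ q.2 ∧ φ q.1 = φ q.2).card <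
        (((insert x T) ×ˢ (insert x T)).filter fun q => q.1 ≠ q.2 ∧ φ q.1 = φ q.2).card := by
        refine Finset.card_lt_card ((Finset.ssubset_iff_of_subset hsub).2 ⟨(x, y), ?_, ?_⟩)
        · simp only [Finset.mem_filter, Finset.mem_product, Finset.mem_insert]
          refine ⟨⟨by simp, Or.inr hy⟩, ?_, hxy.symm⟩
          rintro rfl
          exact hx hy
        · simp [hx]
      omega
    · rw [Finset.card_insert_of_notMem h]
      have := Finset.card_le_card hsub
      omega

/-- Collision counting for one pair of coordinates. -/
lemma coll_count {V : Type*} (k : ℕ) (B : Finset V) (j j' : Fin k) (hj : j ≠ j')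
    (r : V → V → Prop) (hr : ∀ x y y', r x y → r x y' → y = y') :
    ((Fintype.piFinset fun _ : Fin k => B).filter fun g => r (g j) (g j')).card * B.card ≤
      B.card ^ k := by
  have hc : (Fintype.piFinset fun _ : Fin k => B).card = B.card ^ k := by
    simp [Fintype.card_piFinset]
  rw [← hc, ← Finset.card_product]
  refine Finset.card_le_card_of_injOn (fun q => Function.update q.1 j' q.2) ?_ ?_
  · intro q hq
    simp only [Finset.coe_product, Set.mem_prod, Finset.mem_coe, Finset.mem_filter,
      Fintype.mem_piFinset] at hq ⊢
    intro a
    by_cases h : a = j'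
    · subst h; simpa using hq.2
    · rw [Function.update_of_ne h]; exact hq.1.1 a
  · rintro ⟨g, b⟩ hq ⟨g', b'⟩ hq' heq
    simp only [Finset.coe_product, Set.mem_prod, Finset.mem_coe, Finset.mem_filter,
      Fintype.mem_piFinset] at hq hq' heq
    have hb : b = b' := by simpa using congrFun heq j'
    have hne : ∀ a, a ≠ j' → g a = g' a := by
      intro a ha
      simpa [Function.update_of_ne ha] using congrFun heq a
    have hg : g = g' := by
      funext a
      by_cases h : a = j'
      · subst h
        have h1 := hq.1.2
        rw [hne j hj] at h1
        exact hr _ _ _ h1 hq'.1.2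
      · exact hne a h
    rw [hb, hg]

/-- Averaging of the edge count over all samples. -/
lemma avg_count {V : Type*} (k : ℕ) (A B : Finset V) (r : V → V → Prop) :
    (∑ f ∈ Fintype.piFinset (fun _ : Fin k => A), ∑ g ∈ Fintype.piFinset (fun _ : Fin k => B),
      ((Finset.univ : Finset (Fin k × Fin k)).filter fun q => r (f q.1) (g q.2)).card) *
      (A.card * B.card) = k ^ 2 * A.card ^ k * B.card ^ k *
        ((A ×ˢ B).filter fun q => r q.1 q.2).card := by
  rcases Nat.eq_zero_or_pos k with rfl | hk
  · simp
  simp only [Finset.card_filter]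
  have h1 : (∑ f ∈ Fintype.piFinset (fun _ : Fin k => A),
      ∑ g ∈ Fintype.piFinset (fun _ : Fin k => B),
      ∑ q : Fin k × Fin k, if r (f q.1) (g q.2) then 1 else 0) =
      ∑ q : Fin k × Fin k, A.card ^ (k - 1) * (B.card ^ (k - 1) *
        ∑ x ∈ A, ∑ y ∈ B, if r x y then 1 else 0) := by
    simp_rw [Finset.sum_comm (t := (Finset.univ : Finset (Fin k × Fin k)))]
    refine Finset.sum_congr rfl fun q _ => ?_
    have h2 : ∀ f : Fin k → V, ∑ g ∈ Fintype.piFinset (fun _ : Fin k => B),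
        (if r (f q.1) (g q.2) then 1 else 0) =
        B.card ^ (k - 1) * ∑ y ∈ B, if r (f q.1) y then 1 else 0 := by
      intro f
      have := Fintype.sum_piFinset_apply (κ := V) (fun y => if r (f q.1) y then 1 else 0) B q.2
      simpa using this
    simp_rw [h2]
    have := Fintype.sum_piFinset_apply (κ := V)
      (fun x => B.card ^ (k - 1) * ∑ y ∈ B, if r x y then 1 else 0) A q.1
    rw [this]
    simp [Finset.mul_sum]
  rw [h1, Finset.sum_product]
  obtain ⟨m, rfl⟩ : ∃ m, k = m + 1 := ⟨k - 1, by omega⟩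
  simp only [Finset.sum_const, Finset.card_univ, Fintype.card_prod, Fintype.card_fin, smul_eq_mul,
    Nat.add_sub_cancel]
  ring

/-- Index pairs which give an edge. -/
noncomputable def T {n k : ℕ} (G : SimpleGraph (Fin n)) (f g : Fin k → Fin n) :
    Finset (Fin k × Fin k) :=
  Finset.univ.filter fun q => G.Adj (f q.1) (g q.2)

/-- Colors seen between two samples. -/
noncomputable def M {n k : ℕ} (G : SimpleGraph (Fin n)) (c : Sym2 (Fin n) → ℕ)
    (f g : Fin k → Fin n) : Finset ℕ :=
  (T G f g).image fun q => c s(f q.1, g q.2)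

/-- Collisions between two samples. -/
noncomputable def coll {n k : ℕ} (G : SimpleGraph (Fin n)) (c : Sym2 (Fin n) → ℕ)
    (f g : Fin k → Fin n) : Finset ((Fin k × Fin k) × (Fin k × Fin k)) :=
  (T G f g ×ˢ T G f g).filter fun q => q.1 ≠ q.2 ∧
    c s(f q.1.1, g q.1.2) = c s(f q.2.1, g q.2.2)

lemma M_card_le {n k : ℕ} (G : SimpleGraph (Fin n)) (c : Sym2 (Fin n) → ℕ)
    (f g : Fin k → Fin n) : ((M G c f g).card : ℝ) ≤ (k : ℝ) ^ 2 := by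
  have h1 : (M G c f g).card ≤ (T G f g).card := Finset.card_image_le
  have h2 : (T G f g).card ≤ k ^ 2 := by
    refine (Finset.card_le_univ _).trans ?_
    simp [sq]
  exact_mod_cast h1.trans h2

lemma adj_colorSubgraph {n : ℕ} (G : SimpleGraph (Fin n)) (c : Sym2 (Fin n) → ℕ)
    (S : Finset ℕ) (x y : Fin n) :
    (colorSubgraph G c S).Adj x y ↔ G.Adj x y ∧ c s(x, y) ∈ S := by
  unfold colorSubgraph
  rw [SimpleGraph.fromEdgeSet_adj]
  simp only [Set.mem_ofPred_eq, SimpleGraph.mem_edgeSet]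
  constructor
  · exact fun h => h.1
  · exact fun h => ⟨h, h.1.ne⟩

lemma inter_card_le {n k : ℕ} (G : SimpleGraph (Fin n)) (c : Sym2 (Fin n) → ℕ)
    (S : Finset ℕ) (f g : Fin k → Fin n) :
    (S ∩ M G c f g).card ≤ (T (colorSubgraph G c S) f g).card := by
  refine le_trans (Finset.card_le_card ?_) (Finset.card_image_le (s := T (colorSubgraph G c S) f g)
    (f := fun q => c s(f q.1, g q.2)))
  intro x hx
  rw [Finset.mem_inter] at hx
  obtain ⟨hxS, hxM⟩ := hx
  obtain ⟨q, hq, rfl⟩ := Finset.mem_image.1 hxM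
  refine Finset.mem_image.2 ⟨q, ?_, rfl⟩
  simp only [T, Finset.mem_filter, Finset.mem_univ, true_and, adj_colorSubgraph] at hq ⊢
  exact ⟨hq, hxS⟩

lemma proper_right {n : ℕ} {G : SimpleGraph (Fin n)} {c : Sym2 (Fin n) → ℕ}
    (hc : IsProperEdgeColoring G c) {u y y' : Fin n} (h1 : G.Adj u y) (h2 : G.Adj u y')
    (h : c s(u, y) = c s(u, y')) : y = y' := by
  by_contra hne
  refine hc (e₁ := s(u, y)) (e₂ := s(u, y')) h1 h2 ?_ ⟨u, by simp, by simp⟩ h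
  intro he
  exact hne (Sym2.congr_right.1 he)

lemma coll_sum {n k : ℕ} (G : SimpleGraph (Fin n)) (c : Sym2 (Fin n) → ℕ)
    (hc : IsProperEdgeColoring G c) (A B : Finset (Fin n)) (hA : 0 < A.card) (hB : 0 < B.card) :
    ∑ f ∈ Fintype.piFinset (fun _ : Fin k => A), ∑ g ∈ Fintype.piFinset (fun _ : Fin k => B),
      ((coll G c f g).card : ℝ) ≤ (A.card : ℝ) ^ k * (B.card : ℝ) ^ k *
        ((k : ℝ) ^ 4 / B.card + (k : ℝ) ^ 3 / A.card) := by
  have hA' : (0 : ℝ) < A.card := by exact_mod_cast hA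
  have hB' : (0 : ℝ) < B.card := by exact_mod_cast hB
  set D : ℝ := (A.card : ℝ) ^ k * (B.card : ℝ) ^ k with hD
  have hD0 : 0 < D := by positivity
  have hcA : ((Fintype.piFinset fun _ : Fin k => A).card : ℝ) = (A.card : ℝ) ^ k := by
    simp [Fintype.card_piFinset]
  have hcB : ((Fintype.piFinset fun _ : Fin k => B).card : ℝ) = (B.card : ℝ) ^ k := by
    simp [Fintype.card_piFinset]
  have h1 : ∀ f g : Fin k → Fin n, ((coll G c f g).card : ℝ) =
      ∑ q : (Fin k × Fin k) × (Fin k × Fin k), if q ∈ coll G c f g then (1 : ℝ) else 0 := by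
    intro f g
    simp
  simp_rw [h1]
  simp_rw [Finset.sum_comm (t := (Finset.univ : Finset ((Fin k × Fin k) × (Fin k × Fin k))))]
  have h2 : ∀ q : (Fin k × Fin k) × (Fin k × Fin k),
      ∑ f ∈ Fintype.piFinset (fun _ : Fin k => A), ∑ g ∈ Fintype.piFinset (fun _ : Fin k => B),
        (if q ∈ coll G c f g then (1 : ℝ) else 0) ≤
        D / B.card + (if q.1.2 = q.2.2 then D / A.card else 0) := by
    rintro ⟨⟨i, j⟩, ⟨i', j'⟩⟩
    by_cases hj : j = j'
    · subst hj
      by_cases hi : i = i'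
      · subst hi
        simp only [coll, Finset.mem_filter, ne_eq, not_true_eq_false, false_and, and_false,
          if_false, Finset.sum_const_zero, if_true]
        positivity
      · rw [Finset.sum_comm]
        have h3 : ∀ g ∈ Fintype.piFinset (fun _ : Fin k => B),
            ∑ f ∈ Fintype.piFinset (fun _ : Fin k => A),
            (if ((i, j), (i', j)) ∈ coll G c f g then (1 : ℝ) else 0) ≤
            (A.card : ℝ) ^ k / A.card := by
          intro g _
          have h4 := coll_count k A i i' hi
            (fun x y => G.Adj x (g j) ∧ G.Adj y (g j) ∧ c s(x, g j) = c s(y, g j)) (by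
              rintro x y y' ⟨_, hy, he⟩ ⟨_, hy', he'⟩
              refine proper_right hc hy.symm hy'.symm ?_
              rw [Sym2.eq_swap, ← he, he', Sym2.eq_swap])
          replace h4 := (Nat.cast_le (α := ℝ)).2 h4
          push_cast at h4
          rw [le_div_iff₀ hA', Finset.sum_boole]
          refine le_trans ?_ h4
          refine mul_le_mul_of_nonneg_right ?_ hA'.le
          norm_cast
          refine Finset.card_le_card fun f hf => ?_
          simp only [coll, T, Finset.mem_filter, Finset.mem_product, Finset.mem_univ,
            true_and] at hf ⊢
          exact ⟨hf.1, hf.2.1.1, hf.2.1.2, hf.2.2.2⟩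
        refine (Finset.sum_le_sum h3).trans ?_
        rw [Finset.sum_const, nsmul_eq_mul, hcB, if_pos rfl]
        have : (0 : ℝ) ≤ D / B.card := by positivity
        have h5 : (B.card : ℝ) ^ k * ((A.card : ℝ) ^ k / A.card) = D / A.card := by
          rw [hD]; ring
        linarith
    · have h3 : ∀ f ∈ Fintype.piFinset (fun _ : Fin k => A),
          ∑ g ∈ Fintype.piFinset (fun _ : Fin k => B),
          (if ((i, j), (i', j')) ∈ coll G c f g then (1 : ℝ) else 0) ≤
          (B.card : ℝ) ^ k / B.card := by
        intro f _
        have h4 := coll_count k B j j' hj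
          (fun x y => G.Adj (f i) x ∧ G.Adj (f i') y ∧ c s(f i, x) = c s(f i', y)) (by
            rintro x y y' ⟨_, hy, he⟩ ⟨_, hy', he'⟩
            exact proper_right hc hy hy' (he.symm.trans he'))
        replace h4 := (Nat.cast_le (α := ℝ)).2 h4
        push_cast at h4
        rw [le_div_iff₀ hB', Finset.sum_boole]
        refine le_trans ?_ h4
        refine mul_le_mul_of_nonneg_right ?_ hB'.le
        norm_cast
        refine Finset.card_le_card fun g hg => ?_
        simp only [coll, T, Finset.mem_filter, Finset.mem_product, Finset.mem_univ,
          true_and] at hg ⊢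
        exact ⟨hg.1, hg.2.1.1, hg.2.1.2, hg.2.2.2⟩
      refine (Finset.sum_le_sum h3).trans ?_
      rw [Finset.sum_const, nsmul_eq_mul, hcA, if_neg hj]
      have h5 : (A.card : ℝ) ^ k * ((B.card : ℝ) ^ k / B.card) = D / B.card := by
        rw [hD]; ring
      linarith
  refine (Finset.sum_le_sum fun q _ => h2 q).trans ?_
  rw [Finset.sum_add_distrib]
  have h6 : ∑ q : (Fin k × Fin k) × (Fin k × Fin k), (if q.1.2 = q.2.2 then D / A.card else 0) =
      (k : ℝ) ^ 3 * (D / A.card) := by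
    simp only [Fintype.sum_prod_type]
    simp
    ring
  rw [h6]
  simp only [Finset.sum_const, Finset.card_univ, Fintype.card_prod, Fintype.card_fin, nsmul_eq_mul]
  push_cast
  apply le_of_eq
  ring

lemma eBetween_ge {n : ℕ} (H : SimpleGraph (Fin n)) (A B : Finset (Fin n)) (hAB : Disjoint A B) :
    ((A ×ˢ B).filter fun q => H.Adj q.1 q.2).card ≤ eBetween H A B := by
  unfold eBetween
  have hinj : Set.InjOn (fun q : Fin n × Fin n => s(q.1, q.2))
      ((A ×ˢ B).filter fun q => H.Adj q.1 q.2 : Finset (Fin n × Fin n)) := by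
    rintro ⟨a, b⟩ h ⟨a', b'⟩ h' he
    simp only [Finset.coe_filter, Finset.mem_product, Set.mem_ofPred_eq] at h h' he
    rcases Sym2.eq_iff.1 he with ⟨h1, h2⟩ | ⟨h1, h2⟩
    · rw [h1, h2]
    · exact absurd (h1 ▸ h.1.1) (fun h3 => (Finset.disjoint_left.1 hAB h3) h'.1.2)
  rw [← Finset.card_image_of_injOn hinj, ← Set.ncard_coe_finset]
  refine Set.ncard_le_ncard ?_ (Set.toFinite _)
  intro e he
  obtain ⟨q, hq, rfl⟩ := Finset.mem_image.1 (Finset.mem_coe.1 he)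
  rw [Finset.mem_filter, Finset.mem_product] at hq
  exact ⟨hq.2, q.1, hq.1.1, q.2, hq.1.2, rfl⟩

lemma eG_ge {n : ℕ} (G : SimpleGraph (Fin n)) (d : ℝ)
    (hd : ∀ v : Fin n, (1 - d) * n ≤ ((G.neighborSet v).ncard : ℝ)) (A B : Finset (Fin n)) :
    (A.card : ℝ) * (B.card - d * n) ≤ ((A ×ˢ B).filter fun q => G.Adj q.1 q.2).card := by
  rw [Finset.card_filter, Finset.sum_product]
  push_cast
  rw [← nsmul_eq_mul, ← Finset.sum_const]
  refine Finset.sum_le_sum fun a _ => ?_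
  rw [Finset.sum_boole]
  have h1 : (G.neighborSet a).ncard = ((Finset.univ : Finset (Fin n)).filter (G.Adj a)).card := by
    rw [← Set.ncard_coe_finset]
    congr 1
    ext x
    simp
  have h2 := hd a
  rw [h1] at h2
  have h3 : B.card + ((Finset.univ : Finset (Fin n)).filter (G.Adj a)).card ≤
      (B.filter (G.Adj a)).card + n := by
    have h4 : B.filter (G.Adj a) = B ∩ (Finset.univ : Finset (Fin n)).filter (G.Adj a) := by
      ext x; simp
    rw [h4, ← Finset.card_union_add_card_inter, add_comm]
    have := Finset.card_le_univ (B ∪ (Finset.univ : Finset (Fin n)).filter (G.Adj a))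
    rw [Fintype.card_fin] at this
    omega
  have h5 : (B.card : ℝ) + ((Finset.univ : Finset (Fin n)).filter (G.Adj a)).card ≤
      (B.filter (G.Adj a)).card + n := by exact_mod_cast h3
  linarith

/-- The deterministic part. -/
lemma deterministic {n k : ℕ} (hk : 0 < k) (G : SimpleGraph (Fin n)) (c : Sym2 (Fin n) → ℕ)
    (hc : IsProperEdgeColoring G c) (d p ε : ℝ) (hp0 : 0 < p)
    (hd : ∀ v : Fin n, (1 - d) * n ≤ ((G.neighborSet v).ncard : ℝ)) (S : Finset ℕ)
    (hS : ∀ f g : Fin k → Fin n,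
      p * (M G c f g).card - ε / 2 * p * (k : ℝ) ^ 2 ≤ ((S ∩ M G c f g).card : ℝ))
    (A B : Finset (Fin n)) (hAB : Disjoint A B) (hA : 0 < A.card) (hB : 0 < B.card)
    (h1 : (k : ℝ) ^ 2 ≤ ε / 8 * B.card) (h2 : (k : ℝ) ≤ ε / 8 * A.card)
    (h3 : d * n ≤ ε / 8 * B.card) :
    (1 - ε) * p * A.card * B.card ≤ (eBetween (colorSubgraph G c S) A B : ℝ) := by
  have hA' : (0 : ℝ) < A.card := by exact_mod_cast hA
  have hB' : (0 : ℝ) < B.card := by exact_mod_cast hB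
  have hk' : (0 : ℝ) < k := by exact_mod_cast hk
  refine le_trans ?_ (Nat.cast_le.2 (eBetween_ge (colorSubgraph G c S) A B hAB))
  have hG := eG_ge G d hd A B
  have hcs := coll_sum (k := k) G c hc A B hA hB
  have haG := avg_count k A B G.Adj
  have haH := avg_count k A B (colorSubgraph G c S).Adj
  set eG := ((A ×ˢ B).filter fun q => G.Adj q.1 q.2).card
  set eH := ((A ×ˢ B).filter fun q => (colorSubgraph G c S).Adj q.1 q.2).card
  have hpt : ∀ f g : Fin k → Fin n,
      p * (T G f g).card - p * (coll G c f g).card - ε / 2 * p * (k : ℝ) ^ 2 ≤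
        ((T (colorSubgraph G c S) f g).card : ℝ) := by
    intro f g
    have e1 : ((S ∩ M G c f g).card : ℝ) ≤ (T (colorSubgraph G c S) f g).card := by
      exact_mod_cast inter_card_le G c S f g
    have e2 : ((T G f g).card : ℝ) ≤ (M G c f g).card + (coll G c f g).card := by
      exact_mod_cast card_le_image_add (T G f g) (fun q => c s(f q.1, g q.2))
    have e3 := hS f g
    nlinarith
  have hsum := Finset.sum_le_sum fun f (_ : f ∈ Fintype.piFinset (fun _ : Fin k => A)) =>
    Finset.sum_le_sum fun g (_ : g ∈ Fintype.piFinset (fun _ : Fin k => B)) => hpt f g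
  simp only [Finset.sum_sub_distrib, ← Finset.mul_sum, Finset.sum_const, nsmul_eq_mul,
    Fintype.card_piFinset, Finset.prod_const, Finset.card_univ, Fintype.card_fin,
    Nat.cast_pow] at hsum
  set D : ℝ := (A.card : ℝ) ^ k * (B.card : ℝ) ^ k with hD
  have hD0 : 0 < D := by positivity
  have haG' : (∑ f ∈ Fintype.piFinset (fun _ : Fin k => A),
      ∑ g ∈ Fintype.piFinset (fun _ : Fin k => B), ((T G f g).card : ℝ)) * (A.card * B.card) =
      (k : ℝ) ^ 2 * D * eG := by
    replace haG := congrArg (Nat.cast (R := ℝ)) haG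
    push_cast at haG
    rw [hD, ← mul_assoc ((k : ℝ) ^ 2)]
    exact haG
  have haH' : (∑ f ∈ Fintype.piFinset (fun _ : Fin k => A),
      ∑ g ∈ Fintype.piFinset (fun _ : Fin k => B),
        ((T (colorSubgraph G c S) f g).card : ℝ)) * (A.card * B.card) =
      (k : ℝ) ^ 2 * D * eH := by
    replace haH := congrArg (Nat.cast (R := ℝ)) haH
    push_cast at haH
    rw [hD, ← mul_assoc ((k : ℝ) ^ 2)]
    exact haH
  have hcs2 : D * ((k : ℝ) ^ 4 / B.card + (k : ℝ) ^ 3 / A.card) ≤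
      (k : ℝ) ^ 2 * D * (ε / 4) := by
    have e1 : (k : ℝ) ^ 4 / B.card ≤ (k : ℝ) ^ 2 * (ε / 8) := by
      rw [div_le_iff₀ hB']
      nlinarith [mul_le_mul_of_nonneg_left h1 (sq_nonneg (k : ℝ))]
    have e2 : (k : ℝ) ^ 3 / A.card ≤ (k : ℝ) ^ 2 * (ε / 8) := by
      rw [div_le_iff₀ hA']
      nlinarith [mul_le_mul_of_nonneg_left h2 (sq_nonneg (k : ℝ))]
    nlinarith
  have hcs3 := hcs.trans hcs2
  set sG := ∑ f ∈ Fintype.piFinset (fun _ : Fin k => A),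
      ∑ g ∈ Fintype.piFinset (fun _ : Fin k => B), ((T G f g).card : ℝ)
  set sH := ∑ f ∈ Fintype.piFinset (fun _ : Fin k => A),
      ∑ g ∈ Fintype.piFinset (fun _ : Fin k => B),
        ((T (colorSubgraph G c S) f g).card : ℝ)
  set sC := ∑ f ∈ Fintype.piFinset (fun _ : Fin k => A),
      ∑ g ∈ Fintype.piFinset (fun _ : Fin k => B), ((coll G c f g).card : ℝ)
  have hs2 : p * sG - (k : ℝ) ^ 2 * D * (3 / 4 * ε * p) ≤ sH := by
    have := mul_le_mul_of_nonneg_left hcs3 hp0.le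
    have e : ε / 2 * p * ((B.card : ℝ) ^ k * ((A.card : ℝ) ^ k * (k : ℝ) ^ 2)) =
      (k : ℝ) ^ 2 * D * (ε / 2 * p) := by rw [hD]; ring
    rw [e] at hsum
    linarith
  have hs3 := mul_le_mul_of_nonneg_right hs2 (mul_pos hA' hB').le
  have hs4 : (k : ℝ) ^ 2 * D * (p * eG - 3 / 4 * ε * p * (A.card * B.card)) ≤
      (k : ℝ) ^ 2 * D * eH := by
    rw [← haH']
    refine le_trans (le_of_eq ?_) hs3
    rw [sub_mul, mul_assoc p, haG']
    ring
  have hs5 := le_of_mul_le_mul_left hs4 (by positivity)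
  have hs6 : (A.card : ℝ) * (B.card - ε / 8 * B.card) ≤ eG := by
    refine le_trans ?_ hG
    refine mul_le_mul_of_nonneg_left ?_ hA'.le
    linarith
  have hs7 := mul_le_mul_of_nonneg_left hs6 hp0.le
  have hε : 0 ≤ ε * p * (A.card * B.card) := by
    have : 0 < ε := by
      by_contra hneg
      push Not at hneg
      have : ε / 8 * A.card ≤ 0 := mul_nonpos_of_nonpos_of_nonneg (by linarith) hA'.le
      linarith
    positivity
  nlinarith

end RCS

/-- For every sufficiently small `ε > 0` there is a constant `C` such that the following
holds.  Let `G = G(n)` be a properly edge-colored graph on `n` vertices with minimum degree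
at least `(1 - δ)n` where `δ = δ(n)`, and let `H` be the random spanning subgraph of `G`
obtained by including every color class independently with probability `p = p(n)`.  Then
with probability tending to `1` as `n → ∞`, every pair of disjoint vertex sets `A`, `B` with
`|A| ≥ C log n / p` and `|B| ≥ max{C (log n / p)², C δ n}` satisfies
`e_H(A,B) ≥ (1 - ε) p |A| |B|`. -/
theorem random_color_subgraph_edges_between :
    ∃ ε₀ : ℝ, 0 < ε₀ ∧ ∀ ε : ℝ, 0 < ε → ε ≤ ε₀ → ∃ C : ℝ,
      ∀ (G : ∀ n : ℕ, SimpleGraph (Fin n)) (c : ∀ n : ℕ, Sym2 (Fin n) → ℕ) (δ p : ℕ → ℝ),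
        (∀ n, IsProperEdgeColoring (G n) (c n)) →
        (∀ n, 0 < p n ∧ p n ≤ 1) →
        (∀ n, ∀ v : Fin n, (1 - δ n) * n ≤ (((G n).neighborSet v).ncard : ℝ)) →
        Filter.Tendsto
          (fun n => probEvent (G n) (c n) (p n) (fun S =>
            ∀ A B : Finset (Fin n), Disjoint A B →
              C * Real.logb 2 n / p n ≤ (A.card : ℝ) →
              max (C * (Real.logb 2 n / p n) ^ 2) (C * δ n * n) ≤ (B.card : ℝ) →
              (1 - ε) * p n * A.card * B.card ≤
                (eBetween (colorSubgraph (G n) (c n) S) A B : ℝ)))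
          Filter.atTop (nhds 1) := by
  refine ⟨1, one_pos, fun ε hε0 hε1 => ⟨32 * (48 / ε ^ 2) ^ 2 / ε, ?_⟩⟩
  intro G c δ p hproper hp hdeg
  have hlow : ∀ n : ℕ, 2 ≤ n → 1 - 1 / (n : ℝ) ≤ probEvent (G n) (c n) (p n) (fun S =>
            ∀ A B : Finset (Fin n), Disjoint A B →
              32 * (48 / ε ^ 2) ^ 2 / ε * Real.logb 2 n / p n ≤ (A.card : ℝ) →
              max (32 * (48 / ε ^ 2) ^ 2 / ε * (Real.logb 2 n / p n) ^ 2)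
                (32 * (48 / ε ^ 2) ^ 2 / ε * δ n * n) ≤ (B.card : ℝ) →
              (1 - ε) * p n * A.card * B.card ≤
                (eBetween (colorSubgraph (G n) (c n) S) A B : ℝ)) := by
    intro n hn
    obtain ⟨hp0, hp1⟩ := hp n
    have hnR : (2 : ℝ) ≤ n := by exact_mod_cast hn
    set K : ℝ := 48 / ε ^ 2 with hK
    have hKε : K * ε ^ 2 = 48 := by rw [hK]; field_simp
    have hK1 : 1 ≤ K := by
      rw [hK, le_div_iff₀ (by positivity)]
      nlinarith
    set C : ℝ := 32 * K ^ 2 / ε with hC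
    have hCε : C * ε = 32 * K ^ 2 := by rw [hC]; field_simp
    have hC0 : 0 < C := by rw [hC]; positivity
    have hlog0 : 0 < Real.log n := Real.log_pos (by linarith)
    have hLg1 : 1 ≤ Real.logb 2 n := by
      rw [Real.le_logb_iff_rpow_le (by norm_num) (by linarith)]
      simpa using hnR
    have hLgln : Real.log n ≤ Real.logb 2 n := by
      rw [Real.logb, le_div_iff₀ (Real.log_pos (by norm_num))]
      have : Real.log 2 ≤ 1 := by linarith [Real.log_two_lt_d9]
      nlinarith
    set L : ℝ := Real.logb 2 n / p n with hL
    have hLp : L * p n = Real.logb 2 n := by rw [hL]; field_simp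
    have hL1 : 1 ≤ L := by
      rw [hL, le_div_iff₀ hp0]
      linarith
    have hKL : 1 ≤ K * L := by nlinarith
    set k : ℕ := ⌈K * L⌉₊ with hk
    have hk1 : K * L ≤ k := Nat.le_ceil _
    have hk2 : (k : ℝ) ≤ 2 * (K * L) := by
      have := Nat.ceil_lt_add_one (a := K * L) (by linarith)
      linarith
    have hk1' : (1 : ℝ) ≤ k := hKL.trans hk1
    have hk0 : 0 < k := by exact_mod_cast lt_of_lt_of_le one_pos hk1'
    have hub := RCS.union_bound (ι := (Fin k → Fin n) × (Fin k → Fin n))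
      ((G n).edgeFinset.image (c n)) (fun q => RCS.M (G n) (c n) q.1 q.2) (by
        intro q x hx
        obtain ⟨r, hr, rfl⟩ := Finset.mem_image.1 hx
        simp only [RCS.T, Finset.mem_filter, Finset.mem_univ, true_and] at hr
        refine Finset.mem_image.2 ⟨_, ?_, rfl⟩
        rw [SimpleGraph.mem_edgeFinset]
        exact hr) (p n) ε ((k : ℝ) ^ 2) hp0 hp1 hε0 hε1
      (fun q => RCS.M_card_le (G n) (c n) q.1 q.2)
      (fun S => ∀ A B : Finset (Fin n), Disjoint A B →
              C * Real.logb 2 n / p n ≤ (A.card : ℝ) →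
              max (C * L ^ 2) (C * δ n * n) ≤ (B.card : ℝ) →
              (1 - ε) * p n * A.card * B.card ≤
                (eBetween (colorSubgraph (G n) (c n) S) A B : ℝ)) (by
        intro S hS A B hAB hA hB
        rw [mul_div_assoc, ← hL] at hA
        have hB1 := (le_max_left _ _).trans hB
        have hB2 := (le_max_right _ _).trans hB
        have hA0 : (0 : ℝ) < A.card := lt_of_lt_of_le (by positivity) hA
        have hB0 : (0 : ℝ) < B.card := lt_of_lt_of_le (by positivity) hB1
        refine RCS.deterministic hk0 (G n) (c n) (hproper n) (δ n) (p n) ε hp0 (hdeg n) S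
          (fun f g => hS (f, g)) A B hAB (by exact_mod_cast hA0) (by exact_mod_cast hB0) ?_ ?_ ?_
        · have e1 : ε / 8 * (C * L ^ 2) ≤ ε / 8 * B.card :=
            mul_le_mul_of_nonneg_left hB1 (by positivity)
          have e2 : ε / 8 * (C * L ^ 2) = (2 * (K * L)) ^ 2 := by
            rw [show ε / 8 * (C * L ^ 2) = C * ε * L ^ 2 / 8 by ring, hCε]; ring
          rw [e2] at e1
          exact (pow_le_pow_left₀ (by linarith) hk2 2).trans e1
        · have e1 : ε / 8 * (C * L) ≤ ε / 8 * A.card :=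
            mul_le_mul_of_nonneg_left hA (by positivity)
          have e2 : ε / 8 * (C * L) = 4 * K * (K * L) := by
            rw [show ε / 8 * (C * L) = C * ε * L / 8 by ring, hCε]; ring
          nlinarith
        · have e1 : ε / 8 * (C * δ n * n) ≤ ε / 8 * B.card :=
            mul_le_mul_of_nonneg_left hB2 (by positivity)
          have e2 : ε / 8 * (C * δ n * n) = 4 * K ^ 2 * (δ n * n) := by
            rw [show ε / 8 * (C * δ n * n) = C * ε * (δ n * n) / 8 by ring, hCε]; ring
          rw [e2] at e1
          have e3 : 0 ≤ δ n * n := by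
            have hv := hdeg n ⟨0, by omega⟩
            have h4 : ((G n).neighborSet ⟨0, by omega⟩).ncard ≤ n := by
              have := Set.ncard_le_ncard (Set.subset_univ ((G n).neighborSet ⟨0, by omega⟩))
              simpa [Set.ncard_univ] using this
            have h5 : (((G n).neighborSet ⟨0, by omega⟩).ncard : ℝ) ≤ n := by exact_mod_cast h4
            linarith
          have e4 : 1 ≤ 4 * K ^ 2 := by nlinarith
          nlinarith)
    have hcard : (Fintype.card ((Fin k → Fin n) × (Fin k → Fin n)) : ℝ) *
        Real.exp (-(ε ^ 2 * p n * (k : ℝ) ^ 2 / 16)) ≤ 1 / n := by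
      have e1 : (Fintype.card ((Fin k → Fin n) × (Fin k → Fin n)) : ℝ) =
          Real.exp (2 * k * Real.log n) := by
        rw [show 2 * (k : ℝ) * Real.log n = ((2 * k : ℕ) : ℝ) * Real.log n by push_cast; ring,
          Real.exp_nat_mul, Real.exp_log (by linarith)]
        simp
        ring
      have e2 : 1 / (n : ℝ) = Real.exp (-Real.log n) := by
        rw [Real.exp_neg, Real.exp_log (by linarith), one_div]
      rw [e1, e2, ← Real.exp_add]
      refine Real.exp_le_exp.2 ?_
      have e3 : K * Real.log n ≤ k * p n := by
        calc K * Real.log n ≤ K * (L * p n) := by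
              rw [hLp]; exact mul_le_mul_of_nonneg_left hLgln (by linarith)
          _ = K * L * p n := by ring
          _ ≤ _ := mul_le_mul_of_nonneg_right hk1 hp0.le
      have e4 : 48 * Real.log n ≤ ε ^ 2 * (k * p n) := by
        have := mul_le_mul_of_nonneg_left e3 (sq_nonneg ε)
        have e : ε ^ 2 * (K * Real.log n) = 48 * Real.log n := by rw [← hKε]; ring
        rwa [e] at this
      have e5 := mul_le_mul_of_nonneg_left e4 (le_trans zero_le_one hk1')
      nlinarith
    refine le_trans ?_ hub
    linarith
  have hup : ∀ n : ℕ, ∀ E : Finset ℕ → Prop, probEvent (G n) (c n) (p n) E ≤ 1 := by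
    intro n E
    obtain ⟨hp0, hp1⟩ := hp n
    rw [← RCS.sum_weight ((G n).edgeFinset.image (c n)) (p n)]
    unfold probEvent
    refine Finset.sum_le_sum fun S _ => ?_
    have : 0 ≤ 1 - p n := by linarith
    rw [mul_assoc]
    refine mul_le_of_le_one_left (by positivity) ?_
    split_ifs <;> norm_num
  refine tendsto_of_tendsto_of_tendsto_of_le_of_le' (g := fun n : ℕ => 1 - 1 / (n : ℝ))
    (h := fun _ => 1) ?_ tendsto_const_nhds ?_ ?_
  · simpa using (tendsto_const_nhds (x := (1 : ℝ))).sub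
      (tendsto_const_div_atTop_nhds_zero_nat (1 : ℝ))
  · filter_upwards [Filter.eventually_ge_atTop 2] with n hn
    exact hlow n hn
  · exact Filter.Eventually.of_forall fun n => hup n _
end

section
/- For every ε > 0 there exists a constant C such that the following holds. Let G be a properly edge-colored graph on n vertices, and let H be the random spanning subgraph of G obtained by including every color class independently with probability p. Then with probability tending to 1 as n → ∞, for every ε-nearly-rainbow pair of disjoint vertex sets S, T with |S| = |T| ≥ C (log n)/p, the number of edges of H between S and T satisfies e_H(S,T) ≥ (1 - 2ε) p |S| |T|. -/
open scoped Classical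

/-- `colorsBetween G c A B` is the number of distinct colors appearing on the edges of `G`
with one endpoint in `A` and the other endpoint in `B`. -/
noncomputable def colorsBetween {V : Type*} (G : SimpleGraph V) (c : Sym2 V → ℕ)
    (A B : Finset V) : ℕ :=
  (c '' {e : Sym2 V | e ∈ G.edgeSet ∧ ∃ u ∈ A, ∃ v ∈ B, e = s(u, v)}).ncard

/-- A pair of disjoint vertex sets `A`, `B` is `ε`-nearly-rainbow if at least
`(1 - ε)|A||B|` distinct colors appear on the edges of `G` between `A` and `B`. -/
def NearlyRainbow {V : Type*} (ε : ℝ) (G : SimpleGraph V) (c : Sym2 V → ℕ)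
    (A B : Finset V) : Prop :=
  (1 - ε) * A.card * B.card ≤ (colorsBetween G c A B : ℝ)

lemma aux_mgf (A M : Finset ℕ) (hM : M ⊆ A) (p y : ℝ) :
    ∑ W ∈ A.powerset, (y ^ (W ∩ M).card) * (p ^ W.card * (1 - p) ^ (A.card - W.card))
      = (p * y + (1 - p)) ^ M.card := by
  have h := Finset.prod_add (fun i => p * (if i ∈ M then y else 1)) (fun _ => 1 - p) A
  have h1 : ∏ i ∈ A, (p * (if i ∈ M then y else 1) + (1 - p)) = (p * y + (1 - p)) ^ M.card := by
    have : ∀ i ∈ A, (p * (if i ∈ M then y else 1) + (1 - p))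
        = if i ∈ M then (p * y + (1 - p)) else 1 := by
      intro i _
      split_ifs <;> ring
    rw [Finset.prod_congr rfl this, Finset.prod_ite_mem, Finset.inter_eq_right.mpr hM,
      Finset.prod_const]
  rw [← h1, h]
  refine Finset.sum_congr rfl fun W hW => ?_
  rw [Finset.mem_powerset] at hW
  rw [Finset.prod_mul_distrib, Finset.prod_const, Finset.prod_const, Finset.prod_ite_mem,
    Finset.prod_const, Finset.card_sdiff_of_subset hW]
  ring

/-- the set of colors between two sets, as a finset -/
noncomputable def auxColors {V : Type*} [Fintype V] (G : SimpleGraph V) (c : Sym2 V → ℕ)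
    (S T : Finset V) : Finset ℕ :=
  (G.edgeFinset.filter (fun e => ∃ u ∈ S, ∃ v ∈ T, e = s(u, v))).image c

lemma auxColors_card {V : Type*} [Fintype V] (G : SimpleGraph V) (c : Sym2 V → ℕ)
    (S T : Finset V) : colorsBetween G c S T = (auxColors G c S T).card := by
  unfold colorsBetween auxColors
  rw [← Set.ncard_coe_finset]
  congr 1
  ext x
  simp

lemma auxColors_sub {V : Type*} [Fintype V] (G : SimpleGraph V) (c : Sym2 V → ℕ)
    (S T : Finset V) : auxColors G c S T ⊆ G.edgeFinset.image c :=
  Finset.image_subset_image (Finset.filter_subset _ _)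

lemma aux_eBetween {V : Type*} [Fintype V] (G : SimpleGraph V) (c : Sym2 V → ℕ)
    (S T : Finset V) (W : Finset ℕ) :
    (W ∩ auxColors G c S T).card ≤ eBetween (colorSubgraph G c W) S T := by
  unfold eBetween
  rw [← Set.ncard_coe_finset]
  refine le_trans (Set.ncard_le_ncard ?_ (Set.toFinite _)) (Set.ncard_image_le (f := c) (Set.toFinite _))
  intro x hx
  simp only [Finset.coe_inter, Set.mem_inter_iff, Finset.mem_coe, auxColors, Finset.mem_image,
    Finset.mem_filter, SimpleGraph.mem_edgeFinset] at hx
  obtain ⟨hxW, e, ⟨he, h2⟩, rfl⟩ := hx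
  refine ⟨e, ⟨?_, h2⟩, rfl⟩
  unfold colorSubgraph
  rw [SimpleGraph.edgeSet_fromEdgeSet]
  exact ⟨⟨he, hxW⟩, G.not_isDiag_of_mem_edgeSet he⟩

lemma aux_sum_nonempty (n : ℕ) (x : ℝ) :
    ∑ S ∈ (Finset.univ : Finset (Finset (Fin n))).filter (fun S => S.Nonempty), x ^ S.card
      = (1 + x) ^ n - 1 := by
  have h := Finset.sum_pow_mul_eq_add_pow x 1 (Finset.univ : Finset (Fin n))
  simp only [one_pow, mul_one, Finset.powerset_univ, Finset.card_univ, Fintype.card_fin] at h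
  rw [add_comm 1 x, ← h]
  have e : (Finset.univ : Finset (Finset (Fin n))).filter (fun S => S.Nonempty)
      = Finset.univ.erase ∅ := by
    ext S
    simp [Finset.nonempty_iff_ne_empty]
  rw [e, ← Finset.add_sum_erase _ _ (Finset.mem_univ (∅ : Finset (Fin n)))]
  simp

lemma aux_num (ε p k m : ℝ) (hε : 0 < ε) (hε2 : ε < 1 / 2) (hp : 0 < p)
    (hm : (1 - ε) * k * k ≤ m) :
    ε * ((1 - 2 * ε) * p * k * k) - p * (1 - Real.exp (-ε)) * m
      ≤ - (2 * ε ^ 3 / (1 + ε)) * (p * k * k) := by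
  have hy : Real.exp (-ε) ≤ 1 / (1 + ε) := by
    rw [Real.exp_neg, ← one_div]
    exact one_div_le_one_div_of_le (by linarith) (by linarith [Real.add_one_le_exp ε])
  have h1 : ε / (1 + ε) ≤ 1 - Real.exp (-ε) := by
    have : ε / (1 + ε) = 1 - 1 / (1 + ε) := by field_simp; ring
    linarith
  have hk : 0 ≤ (1 - ε) * k * k := by nlinarith [mul_self_nonneg k]
  have h2 : p * (ε / (1 + ε)) * ((1 - ε) * k * k) ≤ p * (1 - Real.exp (-ε)) * m := by
    have : 0 ≤ ε / (1 + ε) := by positivity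
    apply mul_le_mul _ hm hk
    · exact mul_nonneg hp.le (this.trans h1)
    · exact mul_le_mul_of_nonneg_left h1 hp.le
  have h3 : ε * ((1 - 2 * ε) * p * k * k) - p * (ε / (1 + ε)) * ((1 - ε) * k * k)
      = - (2 * ε ^ 3 / (1 + ε)) * (p * k * k) := by
    field_simp
    ring
  linarith

lemma aux_term (ε p k m : ℝ) (M : ℕ) (hε : 0 < ε) (hε2 : ε < 1 / 2) (hp : 0 < p) (hp1 : p ≤ 1)
    (hMm : (M : ℝ) = m)
    (hm : (1 - ε) * k * k ≤ m) :
    Real.exp (ε * ((1 - 2 * ε) * p * k * k)) * (p * Real.exp (-ε) + (1 - p)) ^ M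
      ≤ Real.exp (- (2 * ε ^ 3 / (1 + ε)) * (p * k * k)) := by
  have h1 : (p * Real.exp (-ε) + (1 - p)) ^ M ≤ Real.exp (-(p * (1 - Real.exp (-ε))) * m) := by
    rw [← hMm, mul_comm _ (M : ℝ), Real.exp_nat_mul]
    apply pow_le_pow_left₀
    · have := mul_pos hp (Real.exp_pos (-ε)); linarith
    · have := Real.add_one_le_exp (-(p * (1 - Real.exp (-ε))))
      linarith
  calc _ ≤ Real.exp (ε * ((1 - 2 * ε) * p * k * k)) * Real.exp (-(p * (1 - Real.exp (-ε))) * m) := by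
        gcongr
    _ = Real.exp (ε * ((1 - 2 * ε) * p * k * k) - p * (1 - Real.exp (-ε)) * m) := by
        rw [← Real.exp_add]; congr 1; ring
    _ ≤ _ := Real.exp_le_exp.mpr (aux_num ε p k m hε hε2 hp hm)

lemma aux_term2 (δ p : ℝ) (n k : ℕ) (hδ : 0 < δ) (hp : 0 < p) (hn : 1 ≤ n)
    (hk : (4 / δ) * Real.logb 2 n / p ≤ k) :
    Real.exp (- δ * (p * k * k)) ≤ (((n : ℝ) ^ 2)⁻¹) ^ k * (((n : ℝ) ^ 2)⁻¹) ^ k := by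
  have hn0 : (0 : ℝ) < n := by exact_mod_cast hn
  have hlog : 0 ≤ Real.log n := Real.log_natCast_nonneg n
  have h2 : Real.log n ≤ Real.logb 2 n := by
    unfold Real.logb
    rw [le_div_iff₀ (Real.log_pos (by norm_num))]
    nlinarith [Real.log_two_lt_d9]
  rw [div_le_iff₀ hp] at hk
  have h3 : 4 * Real.log n ≤ δ * (k * p) := by
    have : δ * ((4 / δ) * Real.logb 2 n) ≤ δ * (k * p) := mul_le_mul_of_nonneg_left hk hδ.le
    have e : δ * ((4 / δ) * Real.logb 2 n) = 4 * Real.logb 2 n := by field_simp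
    linarith
  have e : (((n : ℝ) ^ 2)⁻¹) ^ k * (((n : ℝ) ^ 2)⁻¹) ^ k = Real.exp (k * (-(4 * Real.log n))) := by
    rw [Real.exp_nat_mul, ← mul_pow, Real.exp_neg]
    congr 1
    rw [show 4 * Real.log n = ((4 : ℕ) : ℝ) * Real.log n by norm_num, Real.exp_nat_mul, Real.exp_log hn0]
    rw [← mul_inv]; congr 1; ring
  rw [e, Real.exp_le_exp]
  have hk0 : (0 : ℝ) ≤ k := Nat.cast_nonneg k
  nlinarith [mul_le_mul_of_nonneg_left h3 hk0]

lemma aux_sum_w (A : Finset ℕ) (p : ℝ) :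
    ∑ W ∈ A.powerset, (p ^ W.card * (1 - p) ^ (A.card - W.card)) = 1 := by
  rw [Finset.sum_pow_mul_eq_add_pow]
  simp

lemma aux_prob_le {V : Type*} [Fintype V] (G : SimpleGraph V) (c : Sym2 V → ℕ) (p : ℝ)
    (hp : 0 < p) (hp1 : p ≤ 1) (E : Finset ℕ → Prop) : probEvent G c p E ≤ 1 := by
  unfold probEvent
  refine le_of_le_of_eq ?_ (aux_sum_w (G.edgeFinset.image c) p)
  refine Finset.sum_le_sum fun W _ => ?_
  have : 0 ≤ p ^ W.card * (1 - p) ^ ((G.edgeFinset.image c).card - W.card) :=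
    mul_nonneg (pow_nonneg hp.le _) (pow_nonneg (by linarith) _)
  split_ifs
  · simp
  · simpa using this

lemma aux_union {V ι : Type*} [Fintype V] (G : SimpleGraph V) (c : Sym2 V → ℕ) (p : ℝ)
    (hp : 0 < p) (hp1 : p ≤ 1) (E : Finset ℕ → Prop) (P : Finset ι) (F : ι → Finset ℕ → ℝ)
    (hF : ∀ i W, 0 ≤ F i W) (h : ∀ W, ¬ E W → ∃ i ∈ P, 1 ≤ F i W) :
    1 - ∑ i ∈ P, ∑ W ∈ (G.edgeFinset.image c).powerset,
      F i W * (p ^ W.card * (1 - p) ^ ((G.edgeFinset.image c).card - W.card))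
      ≤ probEvent G c p E := by
  unfold probEvent
  rw [Finset.sum_comm, sub_le_iff_le_add, ← Finset.sum_add_distrib]
  refine le_of_eq_of_le (aux_sum_w (G.edgeFinset.image c) p).symm ?_
  refine Finset.sum_le_sum fun W _ => ?_
  have hw : 0 ≤ p ^ W.card * (1 - p) ^ ((G.edgeFinset.image c).card - W.card) :=
    mul_nonneg (pow_nonneg hp.le _) (pow_nonneg (by linarith) _)
  rw [← Finset.sum_mul, mul_assoc, ← add_mul]
  refine le_mul_of_one_le_left hw ?_
  have h0 : 0 ≤ ∑ i ∈ P, F i W := Finset.sum_nonneg fun i _ => hF i W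
  split_ifs with hE
  · linarith
  · obtain ⟨i, hi, h1⟩ := h W hE
    have := Finset.single_le_sum (f := fun i => F i W) (fun i _ => hF i W) hi
    linarith

lemma aux_main (ε : ℝ) (hε : 0 < ε) (hε2 : ε < 1 / 2) (n : ℕ) (hn : 1 ≤ n)
    (G : SimpleGraph (Fin n)) (c : Sym2 (Fin n) → ℕ) (p : ℝ) (hp : 0 < p) (hp1 : p ≤ 1) :
    1 - ((1 + ((n : ℝ) ^ 2)⁻¹) ^ n - 1) * ((1 + ((n : ℝ) ^ 2)⁻¹) ^ n - 1) ≤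
      probEvent G c p (fun W =>
            ∀ S T : Finset (Fin n), Disjoint S T → S.card = T.card →
              (4 / (2 * ε ^ 3 / (1 + ε))) * Real.logb 2 n / p ≤ (S.card : ℝ) →
              NearlyRainbow ε G c S T →
              (1 - 2 * ε) * p * S.card * T.card ≤
                (eBetween (colorSubgraph G c W) S T : ℝ)) := by
  set δ := 2 * ε ^ 3 / (1 + ε) with hδ
  have hδ0 : 0 < δ := by positivity
  have hx : (0 : ℝ) ≤ ((n : ℝ) ^ 2)⁻¹ := by positivity
  set N := (Finset.univ : Finset (Finset (Fin n))).filter (fun S => S.Nonempty) with hN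
  set P := (N ×ˢ N).filter (fun q => q.1.card = q.2.card ∧ (4 / δ) * Real.logb 2 n / p ≤ (q.1.card : ℝ)
    ∧ NearlyRainbow ε G c q.1 q.2) with hP
  refine le_trans ?_ (aux_union G c p hp hp1 _ P
    (fun q W => Real.exp (ε * ((1 - 2 * ε) * p * q.1.card * q.1.card)) *
      Real.exp (-ε) ^ (W ∩ auxColors G c q.1 q.2).card) (fun q W => mul_nonneg (Real.exp_pos _).le (pow_nonneg (Real.exp_pos _).le _)) ?_)
  · apply sub_le_sub_left
    rw [← aux_sum_nonempty, Finset.sum_mul_sum]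
    refine le_of_le_of_eq ?_ (Finset.sum_product N N (fun q : Finset (Fin n) × Finset (Fin n) =>
      (((n : ℝ) ^ 2)⁻¹) ^ q.1.card * (((n : ℝ) ^ 2)⁻¹) ^ q.2.card))
    refine le_trans ?_ (Finset.sum_le_sum_of_subset_of_nonneg (Finset.filter_subset _ _ : P ⊆ N ×ˢ N)
      (fun q _ _ => mul_nonneg (pow_nonneg hx _) (pow_nonneg hx _)))
    refine Finset.sum_le_sum fun q hq => ?_
    obtain ⟨_, hc, hk, hr⟩ := Finset.mem_filter.mp hq
    rw [Finset.sum_congr rfl (fun W _ => mul_assoc _ _ _), ← Finset.mul_sum, aux_mgf _ _ (auxColors_sub G c q.1 q.2)]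
    unfold NearlyRainbow at hr
    rw [← hc, auxColors_card] at hr
    rw [← hc]
    exact (aux_term ε p _ _ _ hε hε2 hp hp1 rfl hr).trans (aux_term2 δ p n _ hδ0 hp hn hk)
  · intro W hW
    push Not at hW
    obtain ⟨S, T, _, hc, hk, hr, hlt⟩ := hW
    have hS : S.Nonempty := by
      rw [Finset.nonempty_iff_ne_empty]
      rintro rfl
      simp at hlt
      have : (0 : ℝ) ≤ (eBetween (colorSubgraph G c W) ∅ T : ℝ) := Nat.cast_nonneg _
      linarith
    have hT : T.Nonempty := by
      rw [← Finset.card_pos, ← hc, Finset.card_pos]; exact hS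
    refine ⟨(S, T), ?_, ?_⟩
    · simp only [hP, hN, Finset.mem_filter, Finset.mem_product, Finset.mem_univ, true_and]
      exact ⟨⟨hS, hT⟩, hc, hk, hr⟩
    · simp only
      rw [← Real.exp_nat_mul, ← Real.exp_add]
      apply Real.one_le_exp
      have h1 : ((W ∩ auxColors G c S T).card : ℝ) ≤ eBetween (colorSubgraph G c W) S T := by
        exact_mod_cast aux_eBetween G c S T W
      rw [← hc] at hlt
      nlinarith

lemma aux_tendsto : Filter.Tendsto (fun n : ℕ =>
    1 - ((1 + ((n : ℝ) ^ 2)⁻¹) ^ n - 1) * ((1 + ((n : ℝ) ^ 2)⁻¹) ^ n - 1))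
    Filter.atTop (nhds 1) := by
  have h : Filter.Tendsto (fun n : ℕ => (1 + ((n : ℝ) ^ 2)⁻¹) ^ n) Filter.atTop (nhds 1) := by
    have h2 : Filter.Tendsto (fun n : ℕ => Real.exp ((n : ℝ)⁻¹)) Filter.atTop (nhds 1) := by
      have := (Real.continuous_exp.tendsto 0).comp (tendsto_inv_atTop_nhds_zero_nat (𝕜 := ℝ))
      simpa [Function.comp_def] using this
    refine tendsto_of_tendsto_of_tendsto_of_le_of_le tendsto_const_nhds h2 ?_ ?_
    · intro n
      exact one_le_pow₀ (by simp)
    · intro n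
      rcases Nat.eq_zero_or_pos n with rfl | hn
      · simp
      have hn0 : (0 : ℝ) < n := by exact_mod_cast hn
      have e : ((n : ℝ)⁻¹) = n * ((n : ℝ) ^ 2)⁻¹ := by field_simp
      simp only
      rw [e, Real.exp_nat_mul]
      apply pow_le_pow_left₀ (by positivity)
      rw [add_comm]
      exact Real.add_one_le_exp _
  have h3 := (h.sub_const 1)
  have := (tendsto_const_nhds (x := (1 : ℝ))).sub (h3.mul h3)
  simpa using this

/-- For every `ε > 0` there is a constant `C` such that the following holds.  Let
`G = G(n)` be a properly edge-colored graph on `n` vertices and let `H` be the random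
spanning subgraph of `G` obtained by including every color class independently with
probability `p = p(n)`.  Then with probability tending to `1` as `n → ∞`, every
`ε`-nearly-rainbow pair of disjoint vertex sets `S`, `T` with `|S| = |T| ≥ C log n / p`
satisfies `e_H(S,T) ≥ (1 - 2ε) p |S| |T|`. -/
theorem random_color_subgraph_nearly_rainbow_pairs :
    ∀ ε : ℝ, 0 < ε → ∃ C : ℝ,
      ∀ (G : ∀ n : ℕ, SimpleGraph (Fin n)) (c : ∀ n : ℕ, Sym2 (Fin n) → ℕ) (p : ℕ → ℝ),
        (∀ n, IsProperEdgeColoring (G n) (c n)) →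
        (∀ n, 0 < p n ∧ p n ≤ 1) →
        Filter.Tendsto
          (fun n => probEvent (G n) (c n) (p n) (fun W =>
            ∀ S T : Finset (Fin n), Disjoint S T → S.card = T.card →
              C * Real.logb 2 n / p n ≤ (S.card : ℝ) →
              NearlyRainbow ε (G n) (c n) S T →
              (1 - 2 * ε) * p n * S.card * T.card ≤
                (eBetween (colorSubgraph (G n) (c n) W) S T : ℝ)))
          Filter.atTop (nhds 1) := by
  intro ε hε
  by_cases hε2 : ε < 1 / 2
  · refine ⟨4 / (2 * ε ^ 3 / (1 + ε)), fun G c p _ hp => ?_⟩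
    refine tendsto_of_tendsto_of_tendsto_of_le_of_le' aux_tendsto tendsto_const_nhds ?_ ?_
    · filter_upwards [Filter.eventually_ge_atTop 1] with n hn
      exact aux_main ε hε hε2 n hn (G n) (c n) (p n) (hp n).1 (hp n).2
    · exact Filter.Eventually.of_forall fun n => aux_prob_le _ _ _ (hp n).1 (hp n).2 _
  · refine ⟨0, fun G c p _ hp => ?_⟩
    refine tendsto_const_nhds.congr fun n => ?_
    refine le_antisymm ?_ (aux_prob_le _ _ _ (hp n).1 (hp n).2 _)
    have := aux_union (G n) (c n) (p n) (hp n).1 (hp n).2 (fun W =>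
            ∀ S T : Finset (Fin n), Disjoint S T → S.card = T.card →
              0 * Real.logb 2 n / p n ≤ (S.card : ℝ) →
              NearlyRainbow ε (G n) (c n) S T →
              (1 - 2 * ε) * p n * S.card * T.card ≤
                (eBetween (colorSubgraph (G n) (c n) W) S T : ℝ)) (∅ : Finset ℕ) (fun _ _ => 0)
        (fun _ _ => le_rfl) ?_
    · simpa using this
    · intro W hW
      exfalso
      apply hW
      intro S T _ _ _ _
      have h1 : 0 ≤ p n * S.card * T.card :=
        mul_nonneg (mul_nonneg (hp n).1.le (Nat.cast_nonneg _)) (Nat.cast_nonneg _)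
      have h2 : (0 : ℝ) ≤ (eBetween (colorSubgraph (G n) (c n) W) S T : ℝ) := Nat.cast_nonneg _
      nlinarith
end
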